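/- Let k be an infinite field, d and n integers with 3 ≤ d ≤ n and n odd, R = k[x_1,…,x_d] the standard graded polynomial ring with maximal homogeneous ideal 𝔪, and φ an n×n alternating matrix with homogeneous linear entries from R. Let I = Pf_{n−1}(φ). Assume I has height three and that n − i ≤ ht I_i(φ) for all i with n − d ≤ i ≤ n − 1. Then: (a) Pf_t(φ) = 𝔪^{t/2} for all even integers t with 2 ≤ t ≤ n − d + 1; and (b) the sum of all homogeneous d-residual intersections of I equals 𝔪^{⌈(n−d)/2⌉}. -/

import Mathlib

/-!
Statement 17 (Theorem `Main10` of the paper).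

`k` an infinite field, `3 ≤ d ≤ n`, `n` odd, `R = k[x₁,…,x_d]` standard graded
(encoded via a grading `𝒜` with `𝒜 0` an infinite field and degree-one variables
inducing `k[X] ≃ R`), `𝔪` the maximal homogeneous ideal, `φ` an `n × n` alternating
matrix of linear forms, `I = Pf_{n-1}(φ)` of height three with
`n − i ≤ ht I_i(φ)` for `n − d ≤ i ≤ n − 1`.  Then:
(a) `Pf_t(φ) = 𝔪^{t/2}` for all even `t` with `2 ≤ t ≤ n − d + 1`;
(b) the sum of all homogeneous `d`-residual intersections of `I` equals
    `𝔪^{⌈(n-d)/2⌉}`.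

A homogeneous `d`-residual intersection of `I` is an ideal `K = 𝔞 : I` where
`𝔞 ⊆ I` is generated by `d` homogeneous elements and `d ≤ ht K` (and `K` is
homogeneous).
-/

noncomputable section
namespace Paper

variable {R : Type} [CommRing R]

def maxHomIdeal (𝒜 : ℤ → AddSubgroup R) [GradedRing 𝒜] : Ideal R :=
  Ideal.span ({ r : R | ∃ h : r ∈ 𝒜 0, ¬ IsUnit (⟨r, h⟩ : 𝒜 0) } ∪
    ⋃ (i : ℤ) (_ : i ≠ 0), (𝒜 i : Set R))

def pf : (n : ℕ) → Matrix (Fin n) (Fin n) R → R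
  | 0, _ => 1
  | 1, _ => 0
  | (n + 2), A =>
    ∑ j : Fin (n + 1),
      (-1 : R) ^ (j : ℕ) * A 0 j.succ *
        pf n (A.submatrix (fun i => Fin.succ (j.succAbove i))
          (fun i => Fin.succ (j.succAbove i)))

def pfaffianIdeal (n r : ℕ) (A : Matrix (Fin n) (Fin n) R) : Ideal R :=
  Ideal.span { x | ∃ (S : Finset (Fin n)) (h : S.card = r),
    x = pf r (A.submatrix (S.orderEmbOfFin h) (S.orderEmbOfFin h)) }

def minorsIdeal (n r : ℕ) (A : Matrix (Fin n) (Fin n) R) : Ideal R :=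
  Ideal.span { x | ∃ f g : Fin r → Fin n, x = (A.submatrix f g).det }

def idealHeight (I : Ideal R) : ℕ∞ :=
  ⨅ (𝔭 : PrimeSpectrum R) (_ : I ≤ 𝔭.asIdeal), Order.height 𝔭

def IsAlternating {n : ℕ} (A : Matrix (Fin n) (Fin n) R) : Prop :=
  (∀ i, A i i = 0) ∧ ∀ i j, A j i = - A i j

/-- `K` is a homogeneous `s`-residual intersection of `I`:  `K = 𝔞 : I` for an ideal
`𝔞 ⊆ I` generated by `s` homogeneous elements, with `s ≤ ht K` and `K` homogeneous. -/
def IsHomogResidualIntersection (𝒜 : ℤ → AddSubgroup R) [GradedRing 𝒜]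
    (I K : Ideal R) (s : ℕ) : Prop :=
  ∃ a : Fin s → R,
    (∀ j, ∃ z : ℤ, a j ∈ 𝒜 z) ∧
    Ideal.span (Set.range a) ≤ I ∧
    K = Submodule.colon (Ideal.span (Set.range a)) I ∧
    Ideal.IsHomogeneous 𝒜 K ∧
    ((s : ℕ∞) ≤ idealHeight K)

section
open RingTheory.Sequence
open scoped Pointwise

lemma QuotSMulTop_mk_eq_zero_iff {A X : Type*} [CommRing A] [AddCommGroup X] [Module A X] (r : A)
    (z : X) : (Submodule.Quotient.mk z : QuotSMulTop r X) = 0 ↔ ∃ w, z = r • w := by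
  rw [Submodule.Quotient.mk_eq_zero, Submodule.mem_smul_pointwise_iff_exists]
  simp [eq_comm]

/-- A strand `π t X`, cut out by idempotents of an ambient module `X`, of a sequence of maps
`D t : X → X`: if the strand vanishes at `0`, a weakly regular sequence of length `k` has its
entries act nilpotently on the homology, then the first `k` homologies vanish. -/
theorem acyclicity {A : Type*} [CommRing A] (rs : List A) :
    ∀ (X : Type*) [AddCommGroup X] [Module A X] (D π : ℕ → X →ₗ[A] X), π 0 = 0 →
      (∀ t x, π t (π t x) = π t x) → (∀ t x, D t (π t x) = π (t + 1) (D t x)) →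
      (∀ t x, D (t + 1) (D t (π t x)) = 0) → IsWeaklyRegular X rs →
      (∀ r ∈ rs, ∀ i < rs.length, ∀ z, π (i + 1) z = z → D (i + 1) z = 0 →
        ∃ N v, D i v = r ^ N • z) →
      ∀ i < rs.length, ∀ z, π (i + 1) z = z → D (i + 1) z = 0 → ∃ v, π i v = v ∧ D i v = z := by
  induction rs with
  | nil => intro X _ _ D π _ _ _ _ _ _ i hi; simp at hi
  | cons r rs ih =>
    intro X _ _ D π h0 hid hcomm hDD hreg htor
    rw [isWeaklyRegular_cons_iff] at hreg
    obtain ⟨hr, hreg'⟩ := hreg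
    have htor' : ∀ s ∈ r :: rs, ∀ i < (r :: rs).length, ∀ z, π (i + 1) z = z → D (i + 1) z = 0 →
        ∃ N v, π i v = v ∧ D i v = s ^ N • z := by
      intro s hs i hi z h1 h2
      obtain ⟨N, v, hv⟩ := htor s hs i hi z h1 h2
      exact ⟨N, π i v, hid _ _, by rw [hcomm, hv, map_smul, h1]⟩
    have key := ih (QuotSMulTop r X) (fun t => QuotSMulTop.map r (D t))
      (fun t => QuotSMulTop.map r (π t)) (by simp [h0])
      (by
        intro t x
        obtain ⟨x, rfl⟩ := Submodule.Quotient.mk_surjective _ x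
        simp [hid])
      (by
        intro t x
        obtain ⟨x, rfl⟩ := Submodule.Quotient.mk_surjective _ x
        simp [hcomm])
      (by
        intro t x
        obtain ⟨x, rfl⟩ := Submodule.Quotient.mk_surjective _ x
        simp [hDD])
      hreg'
      (by
        intro s hs i hi z h1 h2
        obtain ⟨z0, rfl⟩ := Submodule.Quotient.mk_surjective _ z
        set z := π (i + 1) z0 with hz
        have hz' : (Submodule.Quotient.mk z0 : QuotSMulTop r X) = Submodule.Quotient.mk z := by
          rw [hz]; simpa using h1.symm
        rw [hz'] at h2 ⊢
        have hzz : π (i + 1) z = z := hid _ _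
        rw [QuotSMulTop.map_apply_mk, QuotSMulTop_mk_eq_zero_iff] at h2
        obtain ⟨w, hw⟩ := h2
        have hw' : D (i + 1) z = r • π (i + 2) w := by
          rw [← hzz, hcomm, hw, map_smul]
        obtain ⟨N, v, hv, hDv⟩ := htor' s (by simp [hs]) (i + 1) (by simpa using hi)
          (π (i + 2) w) (hid _ _) (by
            apply hr
            change r • _ = r • _
            rw [← map_smul, ← hw', ← hzz, hDD, smul_zero])
        obtain ⟨N', v', hv', hDv'⟩ := htor' s (by simp [hs]) i (by simp; omega)
          (s ^ N • z - r • v) (by rw [map_sub, map_smul, map_smul, hzz, hv])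
          (by rw [map_sub, map_smul, map_smul, hw', hDv, smul_comm, sub_self])
        refine ⟨N' + N, Submodule.Quotient.mk v', ?_⟩
        rw [QuotSMulTop.map_apply_mk, hDv', ← Submodule.Quotient.mk_smul, ← sub_eq_zero,
          ← Submodule.Quotient.mk_sub, QuotSMulTop_mk_eq_zero_iff]
        refine ⟨- (s ^ N' • v), ?_⟩
        rw [pow_add, mul_smul, smul_sub, smul_neg, smul_comm r (s ^ N')]
        abel)
    intro i hi z hz hDz
    obtain ⟨N, v, hv, hDv⟩ := htor' r (by simp) i hi z hz hDz
    induction N generalizing v with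
    | zero => exact ⟨v, hv, by simpa using hDv⟩
    | succ N ihN =>
      have h3 : ∃ v', π i v' = v' ∧ D i v = r • D i v' := by
        cases i with
        | zero =>
          refine ⟨0, by simp, ?_⟩
          rw [← hv, h0]; simp
        | succ j =>
          obtain ⟨u, hu, hDu⟩ := key j (by simpa using hi) (Submodule.Quotient.mk v)
            (by rw [QuotSMulTop.map_apply_mk, hv])
            (by
              rw [QuotSMulTop.map_apply_mk, QuotSMulTop_mk_eq_zero_iff]
              exact ⟨r ^ N • z, by rw [hDv, pow_succ', mul_smul]⟩)
          obtain ⟨u, rfl⟩ := Submodule.Quotient.mk_surjective _ u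
          rw [QuotSMulTop.map_apply_mk, eq_comm, ← sub_eq_zero, ← Submodule.Quotient.mk_sub,
            QuotSMulTop_mk_eq_zero_iff] at hDu
          obtain ⟨w, hw⟩ := hDu
          refine ⟨π (j + 1) w, hid _ _, ?_⟩
          have h4 : v = π (j + 1) (D j u) + r • π (j + 1) w := by
            rw [← map_smul, ← hw, map_sub, hv]; abel
          conv_lhs => rw [h4, ← hcomm, map_add, hDD, zero_add, map_smul]
      obtain ⟨v', hv', h3⟩ := h3
      refine ihN v' hv' ?_
      apply hr
      change r • _ = r • _
      rw [← h3, hDv, pow_succ', mul_smul]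

lemma isWeaklyRegular_pi {A : Type*} [CommRing A] {κ : Type*} (rs : List A) :
    ∀ (M : Type*) [AddCommGroup M] [Module A M], IsWeaklyRegular M rs →
      IsWeaklyRegular (κ → M) rs := by
  induction rs with
  | nil => intro M _ _ _; exact .nil _ _
  | cons r rs ih =>
    intro M _ _ h
    rw [isWeaklyRegular_cons_iff] at h ⊢
    refine ⟨fun f g hfg => funext fun i => h.1 (congrFun hfg i), ?_⟩
    let F : QuotSMulTop r (κ → M) →ₗ[A] (κ → QuotSMulTop r M) :=
      LinearMap.pi fun i => QuotSMulTop.map r (LinearMap.proj i)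
    have hF : Function.Bijective F := by
      constructor
      · rw [injective_iff_map_eq_zero]
        intro f hf
        obtain ⟨f, rfl⟩ := Submodule.Quotient.mk_surjective _ f
        rw [QuotSMulTop_mk_eq_zero_iff]
        have : ∀ i, ∃ w, f i = r • w := fun i => by
          rw [← QuotSMulTop_mk_eq_zero_iff]
          exact congrFun hf i
        choose w hw using this
        exact ⟨w, funext hw⟩
      · intro f
        choose g hg using fun i => Submodule.Quotient.mk_surjective _ (f i)
        exact ⟨Submodule.Quotient.mk g, funext hg⟩
    exact ((LinearEquiv.ofBijective F hF).isWeaklyRegular_congr rs).mpr (ih _ h.2)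

/-- The sign of inserting `i` into the wedge indexed by `S`. -/
def wsign (A : Type*) [CommRing A] {N : ℕ} (i : Fin N) (S : Finset (Fin N)) : A :=
  (-1) ^ (S.filter (· < i)).card

section Ext
variable {A : Type*} [CommRing A] {N : ℕ}

lemma wsign_mul_self (i : Fin N) (S : Finset (Fin N)) : wsign A i S * wsign A i S = 1 := by
  rw [wsign, ← pow_add, ← two_mul, pow_mul]; simp

lemma wsign_insert_of_lt {i j : Fin N} {S : Finset (Fin N)} (hj : j ∉ S) (h : j < i) :
    wsign A i (insert j S) = - wsign A i S := by
  rw [wsign, wsign, Finset.filter_insert, if_pos h, Finset.card_insert_of_notMem (by simp [hj]),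
    pow_succ]
  ring

lemma wsign_insert_of_le {i j : Fin N} {S : Finset (Fin N)} (h : i ≤ j) :
    wsign A i (insert j S) = wsign A i S := by
  rw [wsign, wsign, Finset.filter_insert, if_neg (not_lt.mpr h)]

lemma wsign_erase_of_lt {i j : Fin N} {S : Finset (Fin N)} (hj : j ∈ S) (h : j < i) :
    wsign A i (S.erase j) = - wsign A i S := by
  conv_rhs => rw [← Finset.insert_erase hj, wsign_insert_of_lt (Finset.notMem_erase j S) h]
  ring

lemma wsign_erase_of_le {i j : Fin N} {S : Finset (Fin N)} (h : i ≤ j) :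
    wsign A i (S.erase j) = wsign A i S := by
  by_cases hj : j ∈ S
  · conv_rhs => rw [← Finset.insert_erase hj, wsign_insert_of_le h]
  · rw [Finset.erase_eq_of_notMem hj]

/-- The exterior algebra on `A ^ N`, as coefficient functions. -/
abbrev Ext (A : Type*) (N : ℕ) := Finset (Fin N) → A

/-- Exterior multiplication by the `i`-th basis vector. -/
def wedgeE (A : Type*) [CommRing A] {N : ℕ} (i : Fin N) : Ext A N →ₗ[A] Ext A N where
  toFun f S := if i ∈ S then wsign A i S * f (S.erase i) else 0
  map_add' f g := by ext S; by_cases h : i ∈ S <;> simp [h, mul_add]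
  map_smul' a f := by ext S; by_cases h : i ∈ S <;> simp [h]; ring

/-- Contraction by the `i`-th coordinate functional. -/
def contrE (A : Type*) [CommRing A] {N : ℕ} (i : Fin N) : Ext A N →ₗ[A] Ext A N where
  toFun f S := if i ∈ S then 0 else wsign A i S * f (insert i S)
  map_add' f g := by ext S; by_cases h : i ∈ S <;> simp [h, mul_add]
  map_smul' a f := by ext S; by_cases h : i ∈ S <;> simp [h]; ring

lemma wedgeE_apply (i : Fin N) (f : Ext A N) (S) :
    wedgeE A i f S = if i ∈ S then wsign A i S * f (S.erase i) else 0 := rfl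

lemma contrE_apply (i : Fin N) (f : Ext A N) (S) :
    contrE A i f S = if i ∈ S then 0 else wsign A i S * f (insert i S) := rfl

lemma wedgeE_wedgeE_self (i : Fin N) (f : Ext A N) : wedgeE A i (wedgeE A i f) = 0 := by
  ext S; simp [wedgeE_apply]

lemma contrE_contrE_self (i : Fin N) (f : Ext A N) : contrE A i (contrE A i f) = 0 := by
  ext S; simp [contrE_apply]

lemma wedgeE_anticomm (i j : Fin N) (f : Ext A N) :
    wedgeE A i (wedgeE A j f) + wedgeE A j (wedgeE A i f) = 0 := by
  wlog h : i < j generalizing i j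
  · rcases eq_or_lt_of_le (not_lt.mp h) with h | h
    · subst h; simp [wedgeE_wedgeE_self]
    · rw [add_comm]; exact this j i h
  ext S
  simp only [Pi.add_apply, wedgeE_apply, Finset.mem_erase, Pi.zero_apply]
  by_cases hi : i ∈ S <;> by_cases hj : j ∈ S <;> simp only [hi, hj, if_true, if_false] <;>
    simp [h.ne, h.ne', Finset.erase_right_comm (a := i) (b := j)]
  rw [wsign_erase_of_lt hi h, wsign_erase_of_le h.le]; ring

lemma contrE_anticomm (i j : Fin N) (f : Ext A N) :
    contrE A i (contrE A j f) + contrE A j (contrE A i f) = 0 := by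
  wlog h : i < j generalizing i j
  · rcases eq_or_lt_of_le (not_lt.mp h) with h | h
    · subst h; simp [contrE_contrE_self]
    · rw [add_comm]; exact this j i h
  ext S
  simp only [Pi.add_apply, contrE_apply, Finset.mem_insert, Pi.zero_apply]
  by_cases hi : i ∈ S <;> by_cases hj : j ∈ S <;> simp only [hi, hj, if_true, if_false] <;>
    simp [h.ne, h.ne', Finset.insert_comm i j]
  rw [wsign_insert_of_lt hi h, wsign_insert_of_le h.le]; ring

lemma wedgeE_contrE (i j : Fin N) (f : Ext A N) :
    wedgeE A i (contrE A j f) + contrE A j (wedgeE A i f) = if i = j then f else 0 := by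
  ext S
  by_cases hij : i = j
  · subst hij
    simp only [Pi.add_apply, wedgeE_apply, contrE_apply]
    by_cases hi : i ∈ S
    · simp [hi, wsign_erase_of_le, ← mul_assoc, wsign_mul_self]
    · simp [hi, wsign_insert_of_le, ← mul_assoc, wsign_mul_self]
  · have hij' : j ≠ i := Ne.symm hij
    simp only [Pi.add_apply, wedgeE_apply, contrE_apply, Finset.mem_insert, Finset.mem_erase,
      if_neg hij, Pi.zero_apply]
    by_cases hi : i ∈ S <;> by_cases hj : j ∈ S <;> simp [hi, hj, hij, hij']
    rw [Finset.erase_insert_of_ne hij']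
    rcases lt_or_gt_of_ne hij with h | h
    · rw [wsign_erase_of_lt hi h, wsign_insert_of_le h.le]; ring
    · rw [wsign_insert_of_lt hj h, wsign_erase_of_le h.le]; ring

/-- Exterior multiplication by a vector. -/
def wedgeV (v : Fin N → A) : Ext A N →ₗ[A] Ext A N := ∑ i, v i • wedgeE A i

/-- Contraction by a covector. -/
def contrV (v : Fin N → A) : Ext A N →ₗ[A] Ext A N := ∑ i, v i • contrE A i

lemma wedgeV_apply (v : Fin N → A) (f : Ext A N) : wedgeV v f = ∑ i, v i • wedgeE A i f := by
  simp [wedgeV]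

lemma contrV_apply (v : Fin N → A) (f : Ext A N) : contrV v f = ∑ i, v i • contrE A i f := by
  simp [contrV]

lemma sum_anticomm {M : Type*} [AddCommGroup M] [Module A M] {ι : Type*} (s : Finset ι)
    (E F : ι → M →ₗ[A] M) (c : ι → ι → A) (h : ∀ i j f, E i (F j f) + F j (E i f) = c i j • f)
    (u v : ι → A) (f : M) :
    (∑ i ∈ s, u i • E i (∑ j ∈ s, v j • F j f)) + ∑ j ∈ s, v j • F j (∑ i ∈ s, u i • E i f) =
      (∑ i ∈ s, ∑ j ∈ s, u i * v j * c i j) • f := by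
  simp only [map_sum, map_smul, Finset.smul_sum, Finset.sum_smul, mul_smul, ← h, smul_add,
    Finset.sum_add_distrib]
  congr 1
  rw [Finset.sum_comm]
  exact Finset.sum_congr rfl fun i _ => Finset.sum_congr rfl fun j _ => smul_comm _ _ _

lemma wedgeV_anticomm (u v : Fin N → A) (f : Ext A N) :
    wedgeV u (wedgeV v f) + wedgeV v (wedgeV u f) = 0 := by
  simp only [wedgeV_apply]
  rw [sum_anticomm Finset.univ (wedgeE A) (wedgeE A) 0 (by simp [wedgeE_anticomm])]
  simp

lemma contrV_anticomm (u v : Fin N → A) (f : Ext A N) :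
    contrV u (contrV v f) + contrV v (contrV u f) = 0 := by
  simp only [contrV_apply]
  rw [sum_anticomm Finset.univ (contrE A) (contrE A) 0 (by simp [contrE_anticomm])]
  simp

lemma wedgeV_contrV (u v : Fin N → A) (f : Ext A N) :
    wedgeV u (contrV v f) + contrV v (wedgeV u f) = (u ⬝ᵥ v) • f := by
  simp only [contrV_apply, wedgeV_apply]
  rw [sum_anticomm Finset.univ (wedgeE A) (contrE A) (fun i j => if i = j then 1 else 0)
    (by intro i j f; rw [wedgeE_contrE]; split_ifs <;> simp)]
  simp [dotProduct]

lemma wedgeV_wedgeV_self (u : Fin N → A) (f : Ext A N) : wedgeV u (wedgeV u f) = 0 := by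
  have h : ∀ s : Finset (Fin N), ∑ i ∈ s, u i • wedgeE A i (∑ j ∈ s, u j • wedgeE A j f) = 0 := by
    intro s
    induction s using Finset.induction_on with
    | empty => simp
    | insert a s ha ih =>
      simp only [Finset.sum_insert ha, map_add, map_smul, smul_add, Finset.sum_add_distrib, ih,
        wedgeE_wedgeE_self, smul_zero, zero_add, add_zero]
      simp only [map_sum, map_smul, Finset.smul_sum]
      rw [← Finset.sum_add_distrib]
      refine Finset.sum_eq_zero fun i _ => ?_
      rw [smul_comm (u i) (u a), ← smul_add, ← smul_add, wedgeE_anticomm, smul_zero, smul_zero]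
  rw [wedgeV_apply, wedgeV_apply]
  exact h Finset.univ

lemma contrV_contrV_self (u : Fin N → A) (f : Ext A N) : contrV u (contrV u f) = 0 := by
  have h : ∀ s : Finset (Fin N), ∑ i ∈ s, u i • contrE A i (∑ j ∈ s, u j • contrE A j f) = 0 := by
    intro s
    induction s using Finset.induction_on with
    | empty => simp
    | insert a s ha ih =>
      simp only [Finset.sum_insert ha, map_add, map_smul, smul_add, Finset.sum_add_distrib, ih,
        contrE_contrE_self, smul_zero, zero_add, add_zero]
      simp only [map_sum, map_smul, Finset.smul_sum]
      rw [← Finset.sum_add_distrib]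
      refine Finset.sum_eq_zero fun i _ => ?_
      rw [smul_comm (u i) (u a), ← smul_add, ← smul_add, contrE_anticomm, smul_zero, smul_zero]
  rw [contrV_apply, contrV_apply]
  exact h Finset.univ

/-- Projection to the `b`-th exterior power. -/
def degE (A : Type*) [CommRing A] {N : ℕ} (b : ℕ) : Ext A N →ₗ[A] Ext A N where
  toFun f S := if S.card = b then f S else 0
  map_add' f g := by ext S; by_cases h : S.card = b <;> simp [h]
  map_smul' a f := by ext S; by_cases h : S.card = b <;> simp [h]

lemma degE_apply (b : ℕ) (f : Ext A N) (S) : degE A b f S = if S.card = b then f S else 0 := rfl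

lemma degE_degE (b : ℕ) (f : Ext A N) : degE A b (degE A b f) = degE A b f := by
  ext S; by_cases h : S.card = b <;> simp [degE_apply, h]

lemma degE_eq_zero {b : ℕ} (hb : N < b) : degE A (N := N) b = 0 := by
  refine LinearMap.ext fun f => funext fun S => ?_
  rw [degE_apply, if_neg (by have := card_finset_fin_le S; omega)]
  rfl

lemma wedgeE_degE (i : Fin N) (b : ℕ) (f : Ext A N) :
    wedgeE A i (degE A b f) = degE A (b + 1) (wedgeE A i f) := by
  ext S
  simp only [wedgeE_apply, degE_apply]
  by_cases h : i ∈ S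
  · have h1 := Finset.card_erase_add_one h
    have : (S.erase i).card = b ↔ S.card = b + 1 := by omega
    simp only [h, if_true, this, mul_ite, mul_zero]
  · simp [h]

lemma contrE_degE (i : Fin N) (b : ℕ) (f : Ext A N) :
    contrE A i (degE A (b + 1) f) = degE A b (contrE A i f) := by
  ext S
  simp only [contrE_apply, degE_apply]
  by_cases h : i ∈ S
  · simp [h]
  · simp [h, Finset.card_insert_of_notMem]

lemma wedgeV_degE (u : Fin N → A) (b : ℕ) (f : Ext A N) :
    wedgeV u (degE A b f) = degE A (b + 1) (wedgeV u f) := by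
  simp [wedgeV_apply, wedgeE_degE]

lemma contrV_degE (u : Fin N → A) (b : ℕ) (f : Ext A N) :
    contrV u (degE A (b + 1) f) = degE A b (contrV u f) := by
  simp [contrV_apply, contrE_degE]

end Ext

lemma sum_sum_alternating {ι M : Type*} [AddCommGroup M] (s : Finset ι) (g : ι → ι → M)
    (h0 : ∀ i, g i i = 0) (h : ∀ i j, g i j + g j i = 0) : ∑ i ∈ s, ∑ j ∈ s, g i j = 0 := by
  classical
  induction s using Finset.induction_on with
  | empty => simp
  | insert a s ha ih =>
    simp only [Finset.sum_insert ha, Finset.sum_add_distrib, ih, h0, zero_add, add_zero]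
    rw [← Finset.sum_add_distrib]
    exact Finset.sum_eq_zero fun i _ => h _ _

section Clifford
variable {A M ι : Type*} [CommRing A] [AddCommGroup M] [Module A M] [DecidableEq ι]

/-- Apply `e`, lowering the `i`-th exponent. -/
def lowerE (e : M →ₗ[A] M) (i : ι) : ((ι → ℕ) → M) →ₗ[A] ((ι → ℕ) → M) where
  toFun f μ := e (f (μ + Pi.single i 1))
  map_add' f g := by ext; simp
  map_smul' a f := by ext; simp

/-- Apply `e`, raising the `i`-th exponent. -/
def raiseE (e : M →ₗ[A] M) (i : ι) : ((ι → ℕ) → M) →ₗ[A] ((ι → ℕ) → M) where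
  toFun f μ := if μ i = 0 then 0 else e (f (μ - Pi.single i 1))
  map_add' f g := by ext μ; by_cases h : μ i = 0 <;> simp [h]
  map_smul' a f := by ext μ; by_cases h : μ i = 0 <;> simp [h]

lemma lowerE_apply (e : M →ₗ[A] M) (i : ι) (f μ) : lowerE e i f μ = e (f (μ + Pi.single i 1)) := rfl
lemma raiseE_apply (e : M →ₗ[A] M) (i : ι) (f μ) :
    raiseE e i f μ = if μ i = 0 then 0 else e (f (μ - Pi.single i 1)) := rfl

/-- Composite of a list of operators. -/
def opList (o : ι → M →ₗ[A] M) : List ι → M →ₗ[A] M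
  | [] => LinearMap.id
  | i :: l => o i ∘ₗ opList o l

lemma exists_opList_eq {o e : ι → M →ₗ[A] M} {δ : A}
    (he : ∀ i j f, o j (e i f) + e i (o j f) = if i = j then δ • f else 0) (l : List ι) :
    ∀ (_ : l.Nodup) (z) (_ : ∀ i, o i z = 0),
      ∃ w, opList o l w = δ ^ l.length • z ∧ ∀ j, j ∉ l → o j w = 0 := by
  induction l using List.reverseRecOn with
  | nil => intro _ z hz; exact ⟨z, by simp [opList], fun j _ => hz j⟩
  | append_singleton l a ih =>
    intro hl z hz
    rw [List.nodup_append] at hl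
    obtain ⟨w, hw, hw'⟩ := ih hl.1 z hz
    have ha : a ∉ l := fun h => hl.2.2 a h a (by simp) rfl
    have hcomp : ∀ (l : List ι) v, opList o (l ++ [a]) v = opList o l (o a v) := by
      intro l
      induction l with
      | nil => intro v; rfl
      | cons b l ih => intro v; simp only [List.cons_append, opList, LinearMap.comp_apply, ih]
    refine ⟨e a w, ?_, ?_⟩
    · have := he a a w
      rw [hw' a ha, map_zero, add_zero, if_pos rfl] at this
      rw [hcomp, this, map_smul, hw]
      simp [pow_succ', mul_smul]
    · intro j hj
      simp only [List.mem_append, List.mem_singleton, not_or] at hj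
      have := he a j w
      rwa [hw' j hj.1, map_zero, add_zero, if_neg (Ne.symm hj.2)] at this

variable [Fintype ι]

/-- The differential `∑ Tᵢ oᵢ` on divided-power coefficients, where `Tᵢ` lowers exponents. -/
def dDiv (o : ι → M →ₗ[A] M) : ((ι → ℕ) → M) →ₗ[A] ((ι → ℕ) → M) where
  toFun f μ := ∑ i, o i (f (μ + Pi.single i 1))
  map_add' f g := by ext; simp [Finset.sum_add_distrib]
  map_smul' a f := by ext; simp [Finset.smul_sum]

/-- The differential `∑ Tᵢ oᵢ` on polynomial coefficients, where `Tᵢ` raises exponents. -/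
def dSym (o : ι → M →ₗ[A] M) : ((ι → ℕ) → M) →ₗ[A] ((ι → ℕ) → M) where
  toFun f μ := ∑ i, if μ i = 0 then 0 else o i (f (μ - Pi.single i 1))
  map_add' f g := by
    ext; simp only [Pi.add_apply, ← Finset.sum_add_distrib]
    exact Finset.sum_congr rfl fun i _ => by split_ifs <;> simp
  map_smul' a f := by
    ext; simp only [Pi.smul_apply, Finset.smul_sum, RingHom.id_apply]
    exact Finset.sum_congr rfl fun i _ => by split_ifs <;> simp

lemma dDiv_apply (o : ι → M →ₗ[A] M) (f μ) : dDiv o f μ = ∑ i, o i (f (μ + Pi.single i 1)) := rfl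
lemma dSym_apply (o : ι → M →ₗ[A] M) (f μ) :
    dSym o f μ = ∑ i, if μ i = 0 then 0 else o i (f (μ - Pi.single i 1)) := rfl

lemma dDiv_dDiv {o : ι → M →ₗ[A] M} (h0 : ∀ i f, o i (o i f) = 0)
    (h : ∀ i j f, o i (o j f) + o j (o i f) = 0) (f) : dDiv o (dDiv o f) = 0 := by
  ext μ
  simp only [dDiv_apply, map_sum, Pi.zero_apply]
  refine sum_sum_alternating _ (fun i j => o i (o j (f (μ + Pi.single i 1 + Pi.single j 1))))
    (fun i => h0 _ _) fun i j => ?_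
  rw [add_right_comm μ (Pi.single i 1) (Pi.single j 1)]; exact h _ _ _

lemma dSym_dSym {o : ι → M →ₗ[A] M} (h0 : ∀ i f, o i (o i f) = 0)
    (h : ∀ i j f, o i (o j f) + o j (o i f) = 0) (f) : dSym o (dSym o f) = 0 := by
  ext μ
  simp only [dSym_apply, Pi.zero_apply]
  have key := sum_sum_alternating Finset.univ
    (fun i j => if μ i = 0 ∨ (μ - Pi.single i 1 : ι → ℕ) j = 0
    then 0 else o i (o j (f (μ - Pi.single i 1 - Pi.single j 1))))
    (fun i => by simp [h0]) (fun i j => by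
      by_cases hij : i = j
      · subst hij; simp [h0]
      · have e1 : (μ - Pi.single i 1 : ι → ℕ) j = μ j := by simp [Ne.symm hij]
        have e2 : (μ - Pi.single j 1 : ι → ℕ) i = μ i := by simp [hij]
        simp only [e1, e2, or_comm (a := μ j = 0), tsub_right_comm (b := Pi.single j 1)]
        split_ifs
        · simp
        · exact h _ _ _)
  refine Eq.trans ?_ key
  refine Finset.sum_congr rfl fun i _ => ?_
  by_cases hi : μ i = 0
  · simp [hi]
  · simp only [hi, if_false, false_or, map_sum]
    refine Finset.sum_congr rfl fun j _ => ?_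
    split_ifs <;> simp

lemma exists_of_homotopies {δ : A} (d : ((ι → ℕ) → M) →ₗ[A] ((ι → ℕ) → M)) (hdd : ∀ f, d (d f) = 0)
    (h : ι → ((ι → ℕ) → M) →ₗ[A] ((ι → ℕ) → M)) (q : ι → M →ₗ[A] M)
    (hh : ∀ i f μ, d (h i f) μ + h i (d f) μ = δ • f μ - if μ i = 0 then q i (f μ) else 0)
    (z) (hz : d z = 0) (hz0 : z 0 = 0) : ∃ w, d w = δ ^ Fintype.card ι • z := by
  have key : ∀ s : Finset ι, ∃ w z', δ ^ s.card • z = d w + z' ∧ d z' = 0 ∧ z' 0 = 0 ∧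
      ∀ i ∈ s, ∀ μ, μ i ≠ 0 → z' μ = 0 := by
    intro s
    induction s using Finset.induction_on with
    | empty => exact ⟨0, z, by simp, hz, hz0, by simp⟩
    | insert a s ha ih =>
      obtain ⟨w, z', h1, h2, h3, h4⟩ := ih
      have h5 : ∀ μ, (δ • z' - d (h a z')) μ = if μ a = 0 then q a (z' μ) else 0 := by
        intro μ
        have := hh a z' μ
        rw [h2, map_zero, Pi.zero_apply, add_zero] at this
        rw [Pi.sub_apply, this]; simp
      refine ⟨δ • w + h a z', δ • z' - d (h a z'), ?_, ?_, ?_, ?_⟩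
      · rw [Finset.card_insert_of_notMem ha, pow_succ', mul_smul, h1]
        simp
      · rw [map_sub, map_smul, h2, hdd]; simp
      · rw [h5]; simp [h3]
      · intro i hi μ hμ
        rw [h5]
        rcases Finset.mem_insert.mp hi with rfl | hi
        · simp [hμ]
        · simp [h4 i hi μ hμ]
  obtain ⟨w, z', h1, -, h3, h4⟩ := key Finset.univ
  refine ⟨w, ?_⟩
  have : z' = 0 := by
    ext μ
    by_cases hμ : μ = 0
    · rw [hμ, h3]; rfl
    · obtain ⟨i, hi⟩ := Function.ne_iff.mp hμ
      exact h4 i (Finset.mem_univ _) μ hi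
  rw [← Finset.card_univ, h1, this, add_zero]

theorem dDiv_exact {o e : ι → M →ₗ[A] M} {δ : A} (h0 : ∀ i f, o i (o i f) = 0)
    (h : ∀ i j f, o i (o j f) + o j (o i f) = 0)
    (he : ∀ i j f, o j (e i f) + e i (o j f) = if i = j then δ • f else 0)
    (z) (hz : dDiv o z = 0) (hz0 : z 0 = 0) : ∃ w, dDiv o w = δ ^ Fintype.card ι • z := by
  refine exists_of_homotopies _ (dDiv_dDiv h0 h) (fun i => raiseE (e i) i)
    (fun i => e i ∘ₗ o i) ?_ z hz hz0
  intro i f μ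
  simp only [dDiv_apply, raiseE_apply, LinearMap.comp_apply]
  have hself := he i i (f μ)
  rw [if_pos rfl] at hself
  have e0 : ∀ j, j ≠ i → (μ + Pi.single j 1 : ι → ℕ) i = μ i := fun j hj => by simp [hj.symm]
  rw [← Finset.add_sum_erase _ _ (Finset.mem_univ i)]
  by_cases hi : μ i = 0
  · rw [Finset.sum_eq_zero]
    · simp [hi, ← hself]
    · intro j hj
      rw [if_pos (by rw [e0 j (Finset.ne_of_mem_erase hj), hi]), map_zero]
  · have e1 : (μ + Pi.single i 1 - Pi.single i 1 : ι → ℕ) = μ := add_tsub_cancel_right _ _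
    have hle : Pi.single i 1 ≤ μ := by
      intro j
      by_cases hj : j = i
      · subst hj; simp; omega
      · simp [hj]
    have e2 : (μ - Pi.single i 1 + Pi.single i 1 : ι → ℕ) = μ := tsub_add_cancel_of_le hle
    rw [if_neg (by simp), e1, if_neg hi, if_neg hi, map_sum,
      ← Finset.add_sum_erase _ _ (Finset.mem_univ i), e2, sub_zero, ← hself]
    rw [add_add_add_comm, ← Finset.sum_add_distrib, Finset.sum_eq_zero, add_zero]
    intro j hj
    have hj := Finset.ne_of_mem_erase hj
    rw [if_neg (by rw [e0 j hj]; exact hi), tsub_add_eq_add_tsub hle, he, if_neg (Ne.symm hj)]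

theorem dSym_exact {o e : ι → M →ₗ[A] M} {δ : A} (h0 : ∀ i f, o i (o i f) = 0)
    (h : ∀ i j f, o i (o j f) + o j (o i f) = 0)
    (he : ∀ i j f, o j (e i f) + e i (o j f) = if i = j then δ • f else 0)
    (z) (hz : dSym o z = 0) (hz0 : z 0 = 0) : ∃ w, dSym o w = δ ^ Fintype.card ι • z := by
  refine exists_of_homotopies _ (dSym_dSym h0 h) (fun i => lowerE (e i) i)
    (fun i => o i ∘ₗ e i) ?_ z hz hz0
  intro i f μ
  simp only [dSym_apply, lowerE_apply, LinearMap.comp_apply]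
  have hself := he i i (f μ)
  rw [if_pos rfl] at hself
  have e1 : (μ + Pi.single i 1 - Pi.single i 1 : ι → ℕ) = μ := add_tsub_cancel_right _ _
  have e4 : (μ + Pi.single i 1 : ι → ℕ) i ≠ 0 := by simp
  have s1 := Finset.add_sum_erase Finset.univ (fun j => if μ j = 0 then 0 else
    o j (e i (f (μ - Pi.single j 1 + Pi.single i 1)))) (Finset.mem_univ i)
  have s2 := Finset.add_sum_erase Finset.univ (fun j => e i (if (μ + Pi.single i 1 : ι → ℕ) j = 0
    then 0 else o j (f (μ + Pi.single i 1 - Pi.single j 1)))) (Finset.mem_univ i)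
  rw [map_sum, ← s1, ← s2, add_add_add_comm, ← Finset.sum_add_distrib, Finset.sum_eq_zero,
    add_zero]
  · rw [if_neg e4, e1]
    by_cases hi : μ i = 0
    · simp [hi, ← hself]
    · have hle : Pi.single i 1 ≤ μ := by
        intro j
        by_cases hj : j = i
        · subst hj; simp; omega
        · simp [hj]
      have e2 : (μ - Pi.single i 1 + Pi.single i 1 : ι → ℕ) = μ := tsub_add_cancel_of_le hle
      rw [if_neg hi, if_neg hi, e2, hself, sub_zero]
  · intro j hj
    have hj := Finset.ne_of_mem_erase hj
    have e3 : (μ + Pi.single i 1 : ι → ℕ) j = μ j := by simp [hj]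
    rw [e3]
    split_ifs with hj0
    · simp
    · have hle : Pi.single j 1 ≤ μ := by
        intro l
        by_cases hl : l = j
        · subst hl; simp; omega
        · simp [hl]
      rw [tsub_add_eq_add_tsub hle, he, if_neg (Ne.symm hj)]

lemma exists_sum_eq_of_opList_eq_zero {o e : ι → M →ₗ[A] M} {δ : A}
    (h : ∀ i j f, o i (o j f) + o j (o i f) = 0)
    (he : ∀ i j f, o j (e i f) + e i (o j f) = if i = j then δ • f else 0) (l : List ι) :
    ∀ (_ : l.Nodup) (z) (_ : opList o l z = 0), ∃ w : ι → M, ∑ i, o i (w i) = δ ^ l.length • z := by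
  induction l with
  | nil => intro _ z hz; exact ⟨0, by simp only [opList, LinearMap.id_apply] at hz; simp [hz]⟩
  | cons a l ih =>
    intro hl z hz
    rw [List.nodup_cons] at hl
    have hcomm : ∀ (l : List ι), a ∉ l →
        ∀ z, opList o l (o a (e a z)) = o a (e a (opList o l z)) := by
      intro l hl z
      induction l with
      | nil => rfl
      | cons b l ih =>
        simp only [List.mem_cons, not_or] at hl
        simp only [opList, LinearMap.comp_apply]
        rw [ih hl.2]
        set y := opList o l z
        have h1 := h b a (e a y)
        have h2 := he a b y
        rw [if_neg hl.1] at h2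
        rw [eq_neg_of_add_eq_zero_left h1, eq_neg_of_add_eq_zero_left h2, map_neg, neg_neg]
    obtain ⟨w, hw⟩ := ih hl.2 (δ • z - o a (e a z)) (by
      have := he a a (opList o l z)
      simp only [opList, LinearMap.comp_apply] at hz
      rw [hz, map_zero, add_zero, if_pos rfl] at this
      rw [map_sub, map_smul, hcomm l hl.1, this, sub_self])
    refine ⟨w + Pi.single a (δ ^ l.length • e a z), ?_⟩
    simp only [Pi.add_apply, map_add, Finset.sum_add_distrib, hw]
    rw [Finset.sum_eq_single a]
    · simp [pow_succ, mul_smul, smul_sub]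
    · intro b _ hb; simp [hb]
    · simp

end Clifford

/-- The element of the exterior algebra whose coefficients are the sub-Pfaffians of `φ`. -/
def pfE {n : ℕ} (φ : Matrix (Fin n) (Fin n) R) : Ext R n := fun S =>
  pf S.card (φ.submatrix (S.orderEmbOfFin rfl) (S.orderEmbOfFin rfl))

lemma pf_submatrix_orderEmbOfFin {n r : ℕ} (φ : Matrix (Fin n) (Fin n) R) (S : Finset (Fin n))
    (h : S.card = r) :
    pf r (φ.submatrix (S.orderEmbOfFin h) (S.orderEmbOfFin h)) = pfE φ S := by
  subst h; rfl

lemma pf_submatrix_strictMono {n r : ℕ} (φ : Matrix (Fin n) (Fin n) R) (f : Fin r → Fin n)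
    (hf : StrictMono f) : pf r (φ.submatrix f f) = pfE φ (Finset.univ.image f) := by
  have hc : (Finset.univ.image f).card = r := by
    rw [Finset.card_image_of_injective _ hf.injective]; simp
  rw [← pf_submatrix_orderEmbOfFin φ _ hc,
    ← Finset.orderEmbOfFin_unique hc (fun x => by simp) hf]

lemma pfE_empty {n : ℕ} (φ : Matrix (Fin n) (Fin n) R) : pfE φ ∅ = 1 := by
  rw [← pf_submatrix_orderEmbOfFin φ ∅ Finset.card_empty, pf]

lemma pfE_singleton {n : ℕ} (φ : Matrix (Fin n) (Fin n) R) (i : Fin n) : pfE φ {i} = 0 := by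
  rw [← pf_submatrix_orderEmbOfFin φ {i} (Finset.card_singleton i), pf]

lemma card_filter_lt_orderEmbOfFin {n r : ℕ} (S : Finset (Fin n)) (h : S.card = r) (j : Fin r) :
    (S.filter (· < S.orderEmbOfFin h j)).card = j := by
  have : S.filter (· < S.orderEmbOfFin h j) =
      (Finset.Iio j).map (S.orderEmbOfFin h).toEmbedding := by
    ext l
    simp only [Finset.mem_filter, Finset.mem_map, Finset.mem_Iio]
    constructor
    · rintro ⟨hl, hlt⟩
      have : l ∈ Set.range (S.orderEmbOfFin h) := by simpa using hl
      obtain ⟨i, rfl⟩ := this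
      exact ⟨i, by simpa using hlt, rfl⟩
    · rintro ⟨i, hi, rfl⟩
      exact ⟨Finset.orderEmbOfFin_mem _ _ _, by simpa using hi⟩
  rw [this, Finset.card_map, Fin.card_Iio]

lemma contrE_pfE_of_lt {n : ℕ} (φ : Matrix (Fin n) (Fin n) R) (i : Fin n) (S : Finset (Fin n))
    (hS : ∀ l ∈ S, i < l) : contrE R i (pfE φ) S = wedgeV (φ i) (pfE φ) S := by
  have hi : i ∉ S := fun h => lt_irrefl _ (hS i h)
  have hs : wsign R i S = 1 := by
    rw [wsign, Finset.filter_eq_empty_iff.mpr (fun l hl => not_lt.mpr (hS l hl).le)]; simp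
  rw [contrE_apply, if_neg hi, hs, one_mul, wedgeV_apply, Finset.sum_apply]
  simp only [Pi.smul_apply, wedgeE_apply, smul_eq_mul]
  obtain ⟨m, hm⟩ : ∃ m, S.card = m := ⟨_, rfl⟩
  cases m with
  | zero =>
    rw [Finset.card_eq_zero] at hm
    subst hm
    simp [pfE_singleton]
  | succ m =>
    set f := S.orderEmbOfFin hm with hf
    have hg : StrictMono (Fin.cons i f : Fin (m + 2) → Fin n) := by
      refine Fin.strictMono_iff_lt_succ.mpr ?_
      intro j
      refine Fin.cases ?_ (fun j => ?_) j
      · simpa using hS _ (Finset.orderEmbOfFin_mem _ _ _)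
      · rw [Fin.cons_succ, ← Fin.succ_castSucc, Fin.cons_succ]
        exact f.strictMono Fin.castSucc_lt_succ
    have hfS : Finset.univ.image f = S := Finset.image_orderEmbOfFin_univ S hm
    have him : Finset.univ.image (Fin.cons i f : Fin (m + 2) → Fin n) = insert i S := by
      ext l
      simp only [Finset.mem_image, Finset.mem_univ, true_and]
      rw [Fin.exists_fin_succ]
      simp only [Fin.cons_zero, Fin.cons_succ, Finset.mem_insert, eq_comm (a := i)]
      rw [← hfS]; simp
    rw [← him, ← pf_submatrix_strictMono φ _ hg, pf]
    rw [← Finset.sum_subset (Finset.subset_univ S) (fun l _ hl => by simp [hl]), ← hfS,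
      Finset.sum_image (fun a _ b _ h => f.injective h)]
    refine Finset.sum_congr rfl fun j _ => ?_
    rw [hfS, if_pos (Finset.orderEmbOfFin_mem _ _ _), wsign, hf, card_filter_lt_orderEmbOfFin, ← hf]
    rw [Matrix.submatrix_submatrix]
    have h1 : StrictMono ((Fin.cons i f : Fin (m + 2) → Fin n) ∘ fun l => (j.succAbove l).succ) :=
      hg.comp (fun a b h => Fin.succ_lt_succ_iff.mpr (Fin.strictMono_succAbove j h))
    rw [pf_submatrix_strictMono φ _ h1]
    have h2 : Finset.univ.image ((Fin.cons i f : Fin (m + 2) → Fin n) ∘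
        fun l => (j.succAbove l).succ) = S.erase (f j) := by
      ext l
      simp only [Finset.mem_image, Finset.mem_univ, true_and, Function.comp, Fin.cons_succ,
        Finset.mem_erase]
      rw [← hfS]
      constructor
      · rintro ⟨a, rfl⟩
        exact ⟨fun h => Fin.succAbove_ne j a (f.injective h), by simp⟩
      · rintro ⟨h, h'⟩
        simp only [Finset.mem_image, Finset.mem_univ, true_and] at h'
        obtain ⟨a, rfl⟩ := h'
        obtain ⟨b, rfl⟩ := Fin.exists_succAbove_eq (fun h'' => h (congrArg f h''))
        exact ⟨b, rfl⟩
    rw [h2]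
    simp only [Matrix.submatrix_apply, Fin.cons_zero, Fin.cons_succ]
    ring

lemma wedgeV_apply_eq_zero {n : ℕ} (v : Fin n → R) (f : Ext R n) (S : Finset (Fin n))
    (h : ∀ T : Finset (Fin n), T.card < S.card → f T = 0) : wedgeV v f S = 0 := by
  rw [wedgeV_apply, Finset.sum_apply]
  refine Finset.sum_eq_zero fun i _ => ?_
  rw [Pi.smul_apply, wedgeE_apply]
  split_ifs with hi
  · rw [h _ (Finset.card_erase_lt_of_mem hi)]; simp
  · simp

lemma contrE_wedgeV {n : ℕ} (i : Fin n) (v : Fin n → R) (f : Ext R n) :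
    contrE R i (wedgeV v f) = v i • f - wedgeV v (contrE R i f) := by
  have h := wedgeV_contrV v (Pi.single i 1) f
  have e : contrV (Pi.single i 1 : Fin n → R) = contrE R i := by
    rw [contrV, Finset.sum_eq_single i]
    · simp
    · intro b _ hb; simp [hb]
    · simp
  rw [e] at h
  rw [eq_sub_iff_add_eq, add_comm, h]
  simp

theorem contrE_pfE {n : ℕ} {φ : Matrix (Fin n) (Fin n) R} (hφ : IsAlternating φ) (i : Fin n) :
    contrE R i (pfE φ) = wedgeV (φ i) (pfE φ) := by
  suffices h : ∀ (m : ℕ) (i : Fin n) (S : Finset (Fin n)), S.card = m →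
      (contrE R i (pfE φ) - wedgeV (φ i) (pfE φ)) S = 0 by
    ext S; exact sub_eq_zero.mp (h _ i S rfl)
  intro m
  induction m using Nat.strong_induction_on with
  | _ m ih =>
  intro i S hS
  set Ψ : Fin n → Ext R n := fun i => contrE R i (pfE φ) - wedgeV (φ i) (pfE φ) with hΨ
  have hΨ' : ∀ i, contrE R i (pfE φ) = Ψ i + wedgeV (φ i) (pfE φ) := fun i => by simp [hΨ]
  change Ψ i S = 0
  have hlt : (∀ l ∈ S, i < l) → Ψ i S = 0 := fun h => by
    simp only [hΨ, Pi.sub_apply, contrE_pfE_of_lt φ i S h, sub_self]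
  rcases S.eq_empty_or_nonempty with rfl | hne
  · exact hlt (by simp)
  · obtain ⟨k, hk, hmin⟩ : ∃ k ∈ S, ∀ l ∈ S, k ≤ l :=
      ⟨S.min' hne, S.min'_mem hne, fun l hl => S.min'_le l hl⟩
    rcases lt_or_ge i k with hik | hik
    · exact hlt fun l hl => hik.trans_le (hmin l hl)
    · obtain ⟨S', hkS', rfl⟩ : ∃ S', k ∉ S' ∧ insert k S' = S :=
        ⟨S.erase k, by simp, Finset.insert_erase hk⟩
      have hcard : S'.card < m := by
        rw [Finset.card_insert_of_notMem hkS'] at hS; omega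
      have hval : ∀ f : Ext R n, f (insert k S') = wsign R k S' * contrE R k f S' := by
        intro f
        rw [contrE_apply, if_neg hkS', ← mul_assoc, wsign_mul_self, one_mul]
      have hsmall : ∀ (v : Fin n → R) (j : Fin n), wedgeV v (Ψ j) S' = 0 := fun v j =>
        wedgeV_apply_eq_zero v _ _ fun T hT => ih _ (hT.trans hcard) j T rfl
      rw [hval (Ψ i)]
      suffices h : contrE R k (Ψ i) S' = 0 by rw [h, mul_zero]
      rcases eq_or_lt_of_le hik with rfl | hik
      · have : contrE R k (Ψ k) = wedgeV (φ k) (Ψ k) := by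
          have e1 : contrE R k (Ψ k) = contrE R k (contrE R k (pfE φ)) -
            (φ k k • pfE φ - wedgeV (φ k) (contrE R k (pfE φ))) := by
            rw [← contrE_wedgeV, ← map_sub]
          rw [e1, contrE_contrE_self, hΨ' k, map_add, wedgeV_wedgeV_self, hφ.1]
          simp
        rw [this, hsmall]
      · have h1 : contrE R k (Ψ i) =
            - contrE R i (Ψ k) + wedgeV (φ i) (Ψ k) + wedgeV (φ k) (Ψ i) := by
          have e1 : contrE R k (Ψ i) = contrE R k (contrE R i (pfE φ)) -
            (φ i k • pfE φ - wedgeV (φ i) (contrE R k (pfE φ))) := by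
            rw [← contrE_wedgeV, ← map_sub]
          have e2 : contrE R k (contrE R i (pfE φ)) = - contrE R i (contrE R k (pfE φ)) :=
            eq_neg_of_add_eq_zero_left (contrE_anticomm _ _ _)
          have e3 : wedgeV (φ i) (wedgeV (φ k) (pfE φ)) = - wedgeV (φ k) (wedgeV (φ i) (pfE φ)) :=
            eq_neg_of_add_eq_zero_left (wedgeV_anticomm _ _ _)
          rw [e1, e2, hΨ' k, map_add, map_add, contrE_wedgeV, hΨ' i, map_add, e3, hφ.2 k i]
          rw [hφ.2 i k]
          simp only [neg_smul, neg_neg]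
          abel
        rw [h1, Pi.add_apply, Pi.add_apply, hsmall, hsmall, Pi.neg_apply, contrE_apply]
        split_ifs with hi
        · simp
        · have : Ψ k (insert i S') = 0 := by
            simp only [hΨ, Pi.sub_apply]
            rw [contrE_pfE_of_lt, sub_self]
            intro l hl
            rcases Finset.mem_insert.mp hl with rfl | hl
            · exact hik
            · exact lt_of_le_of_ne (hmin l (Finset.mem_insert_of_mem hl))
                (fun h => hkS' (h ▸ hl))
          rw [this]; simp

/-- The signed maximal sub-Pfaffians of `φ`. -/
def pfVec {n : ℕ} (φ : Matrix (Fin n) (Fin n) R) (i : Fin n) : R :=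
  wedgeE R i (pfE φ) Finset.univ

lemma pfVec_eq {n : ℕ} (φ : Matrix (Fin n) (Fin n) R) (i : Fin n) :
    pfVec φ i = wsign R i Finset.univ * pfE φ (Finset.univ.erase i) := by
  rw [pfVec, wedgeE_apply, if_pos (Finset.mem_univ _)]

lemma wedgeV_apply_apply {n : ℕ} (v : Fin n → R) (f : Ext R n) (S) :
    wedgeV v f S = ∑ i, v i * wedgeE R i f S := by
  simp [wedgeV_apply]

lemma contrE_univ {n : ℕ} (i : Fin n) (f : Ext R n) : contrE R i f Finset.univ = 0 := by
  simp [contrE_apply]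

lemma mulVec_pfVec {n : ℕ} {φ : Matrix (Fin n) (Fin n) R} (hφ : IsAlternating φ) :
    φ.mulVec (pfVec φ) = 0 := by
  ext i
  have := congrFun (contrE_pfE hφ i) Finset.univ
  rw [contrE_univ, wedgeV_apply_apply] at this
  exact this.symm

lemma wedgeE_wedgeE_wedgeV {n : ℕ} {φ : Matrix (Fin n) (Fin n) R} (hφ : IsAlternating φ)
    (i j l : Fin n) : wedgeE R j (wedgeV (φ i) (wedgeE R l (pfE φ))) Finset.univ =
      (if i = j then pfVec φ l else 0) - if i = l then pfVec φ j else 0 := by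
  have e : ∀ l f, wedgeV (φ i) (wedgeE R l f) = - wedgeE R l (wedgeV (φ i) f) := fun l f => by
    rw [eq_neg_iff_add_eq_zero]
    simp only [wedgeV_apply, map_sum, map_smul, ← Finset.sum_add_distrib, ← smul_add,
      wedgeE_anticomm, smul_zero, Finset.sum_const_zero]
  have c : ∀ l f, wedgeE R l (contrE R i f) = (if l = i then f else 0) -
      contrE R i (wedgeE R l f) := fun l f => eq_sub_of_add_eq (wedgeE_contrE l i f)
  rw [e, ← contrE_pfE hφ, c, map_neg, map_sub, c]
  simp only [Pi.neg_apply, Pi.sub_apply, contrE_univ, sub_zero, pfVec, eq_comm (a := i)]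
  split_ifs <;> simp

/-- The third exterior coefficients of `pfE φ`, giving homotopies for multiplication by a
maximal sub-Pfaffian. -/
def pfHom {n : ℕ} (φ : Matrix (Fin n) (Fin n) R) (l k j : Fin n) : R :=
  wedgeE R j (wedgeE R k (wedgeE R l (pfE φ))) Finset.univ

lemma sum_mul_pfHom {n : ℕ} {φ : Matrix (Fin n) (Fin n) R} (hφ : IsAlternating φ)
    (i j l : Fin n) : ∑ k, φ i k * pfHom φ l k j =
      (if i = j then pfVec φ l else 0) - if i = l then pfVec φ j else 0 := by
  rw [← wedgeE_wedgeE_wedgeV hφ, wedgeV_apply, map_sum, Finset.sum_apply]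
  simp [pfHom]

lemma exists_mulVec_eq_pfVec_smul {n : ℕ} {φ : Matrix (Fin n) (Fin n) R} (hφ : IsAlternating φ)
    (l : Fin n) (c : Fin n → R) (hc : pfVec φ ⬝ᵥ c = 0) :
    ∃ v, φ.mulVec v = pfVec φ l • c := by
  refine ⟨fun k => ∑ j, pfHom φ l k j * c j, ?_⟩
  ext i
  simp only [Matrix.mulVec, dotProduct, Finset.mul_sum]
  rw [Finset.sum_comm]
  simp only [← mul_assoc, ← Finset.sum_mul, sum_mul_pfHom hφ, sub_mul, Finset.sum_sub_distrib]
  simp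
  intro _; exact hc

lemma pfVec_mul_comm_of_mulVec_eq_zero {n : ℕ} {φ : Matrix (Fin n) (Fin n) R}
    (hφ : IsAlternating φ) (y : Fin n → R) (hy : φ.mulVec y = 0) (l j : Fin n) :
    pfVec φ l * y j = y l * pfVec φ j := by
  have h : ∑ i, y i * ∑ k, φ i k * pfHom φ l k j = 0 := by
    simp only [Finset.mul_sum]
    rw [Finset.sum_comm]
    refine Finset.sum_eq_zero fun k _ => ?_
    have := congrFun hy k
    simp only [Matrix.mulVec, dotProduct, Pi.zero_apply] at this
    have h2 : ∑ i, y i * (φ i k * pfHom φ l k j) = - (∑ i, φ k i * y i) * pfHom φ l k j := by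
      rw [← Finset.sum_neg_distrib, Finset.sum_mul]
      exact Finset.sum_congr rfl fun i _ => by rw [hφ.2 k i]; ring
    rw [h2, this]; simp
  simp only [sum_mul_pfHom hφ] at h
  simp only [mul_sub, mul_ite, mul_zero, Finset.sum_sub_distrib, Finset.sum_ite_eq',
    Finset.mem_univ, if_true] at h
  linear_combination h

lemma mul_pfE_mem {n : ℕ} {φ : Matrix (Fin n) (Fin n) R} (hφ : IsAlternating φ)
    (y : Fin n → R) (U : Finset (Fin n)) (J : Ideal R)
    (hJ : ∀ i ∈ U, ∑ l ∈ U, φ i l * y l ∈ J) {j : Fin n} (hj : j ∈ U) : y j * pfE φ U ∈ J := by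
  have key : ∀ l ∈ U, (if j = l then pfE φ U else 0) =
      ∑ i ∈ U, φ l i * wedgeE R j (wedgeE R i (pfE φ)) U := by
    intro l hl
    have h1 : wedgeE R j (contrE R l (pfE φ)) U = if j = l then pfE φ U else 0 := by
      have := congrFun (wedgeE_contrE j l (pfE φ)) U
      rw [Pi.add_apply, contrE_apply _ _ U, if_pos hl, add_zero] at this
      rw [this]; split_ifs <;> rfl
    rw [← h1, contrE_pfE hφ, wedgeV_apply, map_sum, Finset.sum_apply]
    symm
    refine Finset.sum_subset_zero_on_sdiff (Finset.subset_univ U) ?_ ?_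
    · intro i hi
      simp only [Finset.mem_sdiff, Finset.mem_univ, true_and] at hi
      simp [wedgeE_apply, hi]
    · intro i _; simp
  have : y j * pfE φ U = ∑ i ∈ U, - wedgeE R j (wedgeE R i (pfE φ)) U * ∑ l ∈ U, φ i l * y l := by
    simp only [Finset.mul_sum]
    rw [Finset.sum_comm]
    have h0 : y j * pfE φ U = ∑ l ∈ U, if j = l then y l * pfE φ U else 0 := by
      rw [Finset.sum_ite_eq, if_pos hj]
    rw [h0]
    refine Finset.sum_congr rfl fun l hl => ?_
    rw [show (if j = l then y l * pfE φ U else 0) = y l * if j = l then pfE φ U else 0 by simp,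
      key l hl, Finset.mul_sum]
    exact Finset.sum_congr rfl fun i _ => by rw [hφ.2 i l]; ring
  rw [this]
  exact Ideal.sum_mem _ fun i hi => Ideal.mul_mem_left _ _ (hJ i hi)

/-- `R` is, with its grading `𝒜`, the standard graded polynomial ring over the field `k` in the
variables `x`. -/
structure StdGraded (k : Type) {R : Type} [Field k] [CommRing R] [Algebra k R]
    (𝒜 : ℤ → AddSubgroup R) [GradedRing 𝒜] {d : ℕ} (x : Fin d → R) : Prop where
  mem_zero_iff : ∀ r, r ∈ 𝒜 0 ↔ ∃ c : k, algebraMap k R c = r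
  mem_one : ∀ i, x i ∈ 𝒜 1
  bijective : Function.Bijective (MvPolynomial.aeval x : MvPolynomial (Fin d) k →ₐ[k] R)

namespace StdGraded

variable {k R : Type} [Field k] [CommRing R] [Algebra k R] {𝒜 : ℤ → AddSubgroup R}
  [GradedRing 𝒜] {d : ℕ} {x : Fin d → R}

/-- The presentation of `R` as a polynomial ring. -/
def equiv (h : StdGraded k 𝒜 x) : MvPolynomial (Fin d) k ≃ₐ[k] R :=
  AlgEquiv.ofBijective _ h.bijective

lemma isNoetherianRing (h : StdGraded k 𝒜 x) : IsNoetherianRing R :=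
  isNoetherianRing_of_ringEquiv _ h.equiv.toRingEquiv

lemma algebraMap_mem (h : StdGraded k 𝒜 x) (c : k) : algebraMap k R c ∈ 𝒜 0 :=
  (h.mem_zero_iff _).mpr ⟨c, rfl⟩

lemma smul_mem (h : StdGraded k 𝒜 x) {z : ℤ} (c : k) {r : R} (hr : r ∈ 𝒜 z) : c • r ∈ 𝒜 z := by
  rw [Algebra.smul_def]
  simpa using SetLike.mul_mem_graded (h.algebraMap_mem c) hr

lemma pow_mem {r : R} (hr : r ∈ 𝒜 1) (n : ℕ) : r ^ n ∈ 𝒜 (n : ℤ) := by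
  simpa using SetLike.pow_mem_graded n hr

lemma prod_pow_mem (h : StdGraded k 𝒜 x) (μ : Fin d → ℕ) :
    ∏ i, x i ^ μ i ∈ 𝒜 ((∑ i, μ i : ℕ) : ℤ) := by
  rw [Nat.cast_sum]
  exact SetLike.prod_mem_graded 𝒜 _ _ fun i _ => pow_mem (h.mem_one i) _

lemma aeval_mem (h : StdGraded k 𝒜 x) {F : MvPolynomial (Fin d) k} {s : ℕ}
    (hF : F.IsHomogeneous s) : MvPolynomial.aeval x F ∈ 𝒜 (s : ℤ) := by
  rw [MvPolynomial.aeval_def, MvPolynomial.eval₂_eq]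
  refine AddSubgroup.sum_mem _ fun μ hμ => ?_
  rw [← Algebra.smul_def]
  refine h.smul_mem _ ?_
  have h1 := h.prod_pow_mem μ
  have h2 : ∑ i, μ i = s := by
    have := hF (MvPolynomial.mem_support_iff.mp hμ)
    rw [Finsupp.weight_apply, Finsupp.sum_fintype _ _ (by simp)] at this
    simpa using this
  rw [h2] at h1
  rwa [Finset.prod_subset (Finset.subset_univ _)]
  intro i _ hi
  simp [Finsupp.notMem_support_iff.mp hi]

lemma eq_zero_of_neg (h : StdGraded k 𝒜 x) {z : ℤ} (hz : ∀ s : ℕ, z ≠ s) {r : R}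
    (hr : r ∈ 𝒜 z) : r = 0 := by
  obtain ⟨F, rfl⟩ := h.bijective.2 r
  rw [← DirectSum.decompose_of_mem_same 𝒜 hr, ← GradedRing.proj_apply]
  conv_lhs => rw [← MvPolynomial.sum_homogeneousComponent F, map_sum, map_sum]
  exact Finset.sum_eq_zero fun i _ => DirectSum.decompose_of_mem_ne 𝒜
    (h.aeval_mem (MvPolynomial.homogeneousComponent_isHomogeneous i F)) (hz i).symm

lemma exists_aeval_eq (h : StdGraded k 𝒜 x) {s : ℕ} {r : R} (hr : r ∈ 𝒜 (s : ℤ)) :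
    ∃ F : MvPolynomial (Fin d) k, F.IsHomogeneous s ∧ MvPolynomial.aeval x F = r := by
  obtain ⟨F, rfl⟩ := h.bijective.2 r
  refine ⟨MvPolynomial.homogeneousComponent s F,
    MvPolynomial.homogeneousComponent_isHomogeneous s F, ?_⟩
  rw [← DirectSum.decompose_of_mem_same 𝒜 hr, ← GradedRing.proj_apply]
  conv_rhs => rw [← MvPolynomial.sum_homogeneousComponent F, map_sum, map_sum]
  rw [Finset.sum_eq_single s]
  · exact (DirectSum.decompose_of_mem_same 𝒜
      (h.aeval_mem (MvPolynomial.homogeneousComponent_isHomogeneous s F))).symm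
  · intro i _ hi
    exact DirectSum.decompose_of_mem_ne 𝒜
      (h.aeval_mem (MvPolynomial.homogeneousComponent_isHomogeneous i F))
      (fun e => hi (by exact_mod_cast e))
  · intro hs
    rw [MvPolynomial.homogeneousComponent_eq_zero _ _ (by simpa using hs)]
    simp

lemma mem_span (h : StdGraded k 𝒜 x) {s : ℕ} {r : R} (hr : r ∈ 𝒜 (s : ℤ)) :
    r ∈ Submodule.span k {m | ∃ μ : Fin d → ℕ, ∑ i, μ i = s ∧ m = ∏ i, x i ^ μ i} := by
  obtain ⟨F, hF, rfl⟩ := h.exists_aeval_eq hr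
  rw [MvPolynomial.aeval_def, MvPolynomial.eval₂_eq]
  refine Submodule.sum_mem _ fun μ hμ => ?_
  rw [← Algebra.smul_def]
  refine Submodule.smul_mem _ _ (Submodule.subset_span ⟨μ, ?_, ?_⟩)
  · have := hF (MvPolynomial.mem_support_iff.mp hμ)
    rw [Finsupp.weight_apply, Finsupp.sum_fintype _ _ (by simp)] at this
    simpa using this
  · refine Finset.prod_subset (Finset.subset_univ _) ?_
    intro i _ hi
    simp [Finsupp.notMem_support_iff.mp hi]

lemma exists_linear (h : StdGraded k 𝒜 x) {r : R} (hr : r ∈ 𝒜 1) :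
    ∃ c : Fin d → k, r = ∑ i, c i • x i := by
  have := h.mem_span (s := 1) (by exact_mod_cast hr)
  have h2 : r ∈ Submodule.span k (Set.range x) := by
    refine Submodule.span_mono ?_ this
    rintro _ ⟨μ, hμ, rfl⟩
    obtain ⟨i, hi⟩ : ∃ i, μ i ≠ 0 := by
      by_contra! hc
      simp [hc] at hμ
    refine ⟨i, ?_⟩
    rw [Finset.prod_eq_single i]
    · have := Finset.single_le_sum (f := μ) (fun _ _ => Nat.zero_le _) (Finset.mem_univ i)
      rw [show μ i = 1 by omega, pow_one]
    · intro j _ hj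
      have := Finset.add_le_sum (f := μ) (fun _ _ => Nat.zero_le _) (Finset.mem_univ i)
        (Finset.mem_univ j) hj.symm
      rw [show μ j = 0 by omega, pow_zero]
    · simp
  obtain ⟨c, hc⟩ := (Submodule.mem_span_range_iff_exists_fun k).mp h2
  exact ⟨c, hc.symm⟩

lemma linearIndependent (h : StdGraded k 𝒜 x) : LinearIndependent k x := by
  rw [Fintype.linearIndependent_iff]
  intro g hg i
  have h1 : ∑ i, g i • (MvPolynomial.X i : MvPolynomial (Fin d) k) = 0 :=
    h.bijective.1 (by simpa using hg)
  have h2 := congrArg (MvPolynomial.coeff (Finsupp.single i 1)) h1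
  simpa [MvPolynomial.coeff_sum, MvPolynomial.coeff_X, Finsupp.single_left_inj] using h2

lemma mem_zero_sub (h : StdGraded k 𝒜 x) {r : R} (hr : r ∈ 𝒜 0) (hr0 : r ≠ 0) :
    IsUnit (⟨r, hr⟩ : 𝒜 0) := by
  obtain ⟨c, rfl⟩ := (h.mem_zero_iff r).mp hr
  have hc : c ≠ 0 := by rintro rfl; simp at hr0
  refine IsUnit.of_mul_eq_one ⟨algebraMap k R c⁻¹, h.algebraMap_mem _⟩ ?_
  ext
  change algebraMap k R c * algebraMap k R c⁻¹ = 1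
  rw [← map_mul, mul_inv_cancel₀ hc, map_one]

lemma mem_span_pow (h : StdGraded k 𝒜 x) {s : ℕ} {r : R} (hr : r ∈ 𝒜 (s : ℤ)) :
    r ∈ Ideal.span (Set.range x) ^ s := by
  refine Submodule.span_induction (p := fun r _ => r ∈ Ideal.span (Set.range x) ^ s)
    ?_ (zero_mem _) (fun _ _ _ _ => add_mem) ?_ (h.mem_span hr)
  · rintro _ ⟨μ, rfl, rfl⟩
    rw [← Finset.prod_pow_eq_pow_sum]
    exact Ideal.prod_mem_prod fun i _ =>
      Ideal.pow_mem_pow (Ideal.subset_span (Set.mem_range_self i)) _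
  · intro c r _ hr
    rw [Algebra.smul_def]
    exact Ideal.mul_mem_left _ _ hr

lemma maxHomIdeal_eq (h : StdGraded k 𝒜 x) : maxHomIdeal 𝒜 = Ideal.span (Set.range x) := by
  apply le_antisymm
  · rw [maxHomIdeal, Ideal.span_le]
    rintro r (⟨hr, hu⟩ | hr)
    · by_cases h0 : r = 0
      · simp [h0]
      · exact absurd (h.mem_zero_sub hr h0) hu
    · simp only [Set.mem_iUnion] at hr
      obtain ⟨z, hz, hr⟩ := hr
      by_cases hs : ∃ s : ℕ, z = s
      · obtain ⟨s, rfl⟩ := hs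
        exact Ideal.pow_le_self (by simpa using hz) (h.mem_span_pow hr)
      · push Not at hs
        rw [h.eq_zero_of_neg hs hr]; simp
  · refine Ideal.span_mono ?_
    rintro _ ⟨i, rfl⟩
    refine Or.inr ?_
    simp only [Set.mem_iUnion]
    exact ⟨1, one_ne_zero, h.mem_one i⟩

/-- Powers of the irrelevant ideal are generated by their forms of lowest degree. -/
lemma span_pow_eq (h : StdGraded k 𝒜 x) (s : ℕ) :
    Ideal.span (Set.range x) ^ s = Ideal.span (𝒜 (s : ℤ) : Set R) := by
  refine le_antisymm ?_ (Ideal.span_le.mpr fun r hr => h.mem_span_pow hr)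
  rw [Ideal.span, Submodule.span_pow, Submodule.span_le]
  intro r hr
  refine Submodule.subset_span ?_
  have : (Set.range x) ^ s ⊆ (𝒜 (s : ℤ) : Set R) := by
    clear hr
    induction s with
    | zero =>
      rintro _ rfl
      simpa using SetLike.GradedOne.one_mem (A := 𝒜)
    | succ s ih =>
      rw [pow_succ]
      rintro _ ⟨a, ha, _, ⟨i, rfl⟩, rfl⟩
      have := SetLike.mul_mem_graded (ih ha) (h.mem_one i)
      exact_mod_cast this
  exact this hr

/-- Linear changes of variables. -/
lemma of_linearIndependent (h : StdGraded k 𝒜 x) {y : Fin d → R} (hy : ∀ i, y i ∈ 𝒜 1)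
    (hli : LinearIndependent k y) : StdGraded k 𝒜 y where
  mem_zero_iff := h.mem_zero_iff
  mem_one := hy
  bijective := by
    choose M hM using fun i => h.exists_linear (hy i)
    have hM' : LinearIndependent k M := by
      rw [Fintype.linearIndependent_iff] at hli ⊢
      intro g hg
      refine hli g ?_
      simp only [hM, Finset.smul_sum, smul_smul]
      rw [Finset.sum_comm]
      simp only [← Finset.sum_smul]
      refine Finset.sum_eq_zero fun j _ => ?_
      have := congrFun hg j
      simp only [Finset.sum_apply, Pi.smul_apply, smul_eq_mul, Pi.zero_apply] at this
      rw [this, zero_smul]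
    obtain ⟨u, hu⟩ : IsUnit (Matrix.of M) := Matrix.linearIndependent_rows_iff_isUnit.mp hM'
    set A := Matrix.of M with hA
    have hAM : ∀ i j, M i j = A i j := fun _ _ => rfl
    set B : Matrix (Fin d) (Fin d) k := (↑u⁻¹ : Matrix (Fin d) (Fin d) k)
    have hAB : A * B = 1 := by rw [← hu]; exact u.mul_inv
    have hBA : B * A = 1 := by rw [← hu]; exact u.inv_mul
    let lin (C : Matrix (Fin d) (Fin d) k) : MvPolynomial (Fin d) k →ₐ[k] MvPolynomial (Fin d) k :=
      MvPolynomial.aeval fun i => ∑ j, C i j • MvPolynomial.X j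
    have hcomp : ∀ C D : Matrix (Fin d) (Fin d) k, C * D = 1 → (lin D).comp (lin C) = .id k _ := by
      intro C D hCD
      ext1 i
      simp only [lin, AlgHom.comp_apply, MvPolynomial.aeval_X, map_sum, map_smul, Finset.smul_sum,
        smul_smul, AlgHom.id_apply]
      rw [Finset.sum_comm]
      simp only [← Finset.sum_smul, ← Matrix.mul_apply, hCD, Matrix.one_apply]
      simp
    have hl : Function.Bijective (lin A) := by
      refine Function.bijective_iff_has_inverse.mpr ⟨lin B, fun p => ?_, fun p => ?_⟩
      · exact AlgHom.congr_fun (hcomp A B hAB) p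
      · exact AlgHom.congr_fun (hcomp B A hBA) p
    have : (MvPolynomial.aeval y : MvPolynomial (Fin d) k →ₐ[k] R) =
        (MvPolynomial.aeval x).comp (lin A) := by
      ext1 i
      simp only [lin, AlgHom.comp_apply, MvPolynomial.aeval_X, map_sum, map_smul]
      exact hM i
    rw [this, AlgHom.coe_comp]
    exact h.bijective.comp hl

end StdGraded

lemma mem_span_X_of_X_mul_mem {σ K : Type*} [CommRing K] {s : Set σ} {i : σ} (hi : i ∉ s)
    {F : MvPolynomial σ K} (hF : MvPolynomial.X i * F ∈
      Ideal.span (MvPolynomial.X '' s : Set (MvPolynomial σ K))) :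
    F ∈ Ideal.span (MvPolynomial.X '' s : Set (MvPolynomial σ K)) := by
  rw [MvPolynomial.mem_ideal_span_X_image] at hF ⊢
  intro m hm
  obtain ⟨j, hj, hj0⟩ := hF (Finsupp.single i 1 + m) (by
    rw [MvPolynomial.mem_support_iff] at hm ⊢
    rwa [MvPolynomial.coeff_X_mul])
  refine ⟨j, hj, fun h0 => hj0 ?_⟩
  have : i ≠ j := fun e => hi (e ▸ hj)
  simp [h0, this]

lemma isWeaklyRegular_map_X {σ K : Type*} [CommRing K] (l : List σ) (hl : l.Nodup) :
    IsWeaklyRegular (MvPolynomial σ K) (l.map (MvPolynomial.X (R := K))) := by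
  refine ⟨fun i hi => ?_⟩
  rw [List.length_map] at hi
  have hI : (Ideal.ofList ((l.map (MvPolynomial.X (R := K))).take i) • ⊤ :
      Submodule (MvPolynomial σ K) (MvPolynomial σ K)) =
      Ideal.span (MvPolynomial.X '' {j | j ∈ l.take i}) := by
    rw [smul_eq_mul, Ideal.mul_top, ← List.map_take, Ideal.ofList]
    congr 1
    ext; simp [-List.map_take, eq_comm]
  rw [hI, isSMulRegular_iff_right_eq_zero_of_smul]
  intro F hF
  obtain ⟨F, rfl⟩ := Submodule.Quotient.mk_surjective _ F
  rw [← Submodule.Quotient.mk_smul, Submodule.Quotient.mk_eq_zero, List.getElem_map,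
    smul_eq_mul] at hF
  rw [Submodule.Quotient.mk_eq_zero]
  refine mem_span_X_of_X_mul_mem ?_ hF
  intro hmem
  obtain ⟨j, hj, e⟩ := List.mem_take_iff_getElem.mp hmem
  have := (List.Nodup.getElem_inj_iff hl).mp e
  omega

namespace StdGraded

variable {k R : Type} [Field k] [CommRing R] [Algebra k R] {𝒜 : ℤ → AddSubgroup R}
  [GradedRing 𝒜] {d : ℕ} {x : Fin d → R}

lemma isWeaklyRegular (h : StdGraded k 𝒜 x) : IsWeaklyRegular R (List.ofFn x) := by
  have h1 := isWeaklyRegular_map_X (K := k) (List.finRange d) (List.nodup_finRange d)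
  refine (AddEquiv.isWeaklyRegular_congr (e := h.equiv.toAddEquiv) ?_).mp h1
  rw [List.ofFn_eq_map, List.forall₂_map_left_iff, List.forall₂_map_right_iff,
    List.forall₂_same]
  intro i _ F
  change h.equiv (MvPolynomial.X i * F) = x i * h.equiv F
  rw [map_mul]
  congr 1
  exact MvPolynomial.aeval_X _ _

end StdGraded

section Minors

variable {ι κ : Type} [Fintype ι]

lemma le_rank_of_det_ne_zero {L : Type*} [Field L] (M : Matrix κ ι L) {r : ℕ}
    (f : Fin r → κ) (g : Fin r → ι) (h : (M.submatrix f g).det ≠ 0) : r ≤ M.rank := by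
  have h1 := Matrix.rank_of_det_ne_zero h
  rw [Fintype.card_fin] at h1
  rw [← h1]
  exact Matrix.rank_submatrix_le _ _ _

variable [Fintype κ]

lemma exists_linearIndependent_rows {L : Type*} [Field L] (M : Matrix κ ι L) {r : ℕ}
    (hr : r ≤ M.rank) : ∃ f : Fin r → κ, LinearIndependent L (M.submatrix f id).row := by
  obtain ⟨g, hg, -, hli⟩ := Submodule.exists_fun_fin_finrank_span_eq L (Set.range M.row)
  choose f hf using hg
  rw [M.rank_eq_finrank_span_row] at hr
  refine ⟨fun i => f (Fin.castLE hr i), ?_⟩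
  have := hli.comp _ (Fin.castLE_injective hr)
  have e : (M.submatrix (fun i => f (Fin.castLE hr i)) id).row = g ∘ Fin.castLE hr := by
    ext i : 1
    simp only [Function.comp_apply, ← hf]
    rfl
  rwa [e]

lemma exists_submatrix_det_ne_zero {L : Type*} [Field L] (M : Matrix κ ι L) {r : ℕ}
    (hr : r ≤ M.rank) : ∃ (f : Fin r → κ) (g : Fin r → ι), (M.submatrix f g).det ≠ 0 := by
  obtain ⟨f, hf⟩ := exists_linearIndependent_rows M hr
  have h1 : (M.submatrix f id).transpose.rank = r := by
    rw [Matrix.rank_transpose, hf.rank_matrix, Fintype.card_fin]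
  obtain ⟨g, hg⟩ := exists_linearIndependent_rows _ h1.ge
  refine ⟨f, g, ?_⟩
  have h2 := (Matrix.isUnit_iff_isUnit_det _).mp (Matrix.linearIndependent_rows_iff_isUnit.mp hg)
  rw [← Matrix.det_transpose]
  exact h2.ne_zero

/-- A matrix whose rows are independent over the residue field of `P` is onto up to a factor
outside of `P`. -/
lemma exists_notMem_mulVec_eq {A : Type*} [CommRing A] {r : ℕ} (M : Matrix (Fin r) ι A)
    (P : Ideal A) [P.IsPrime] (h : r ≤ (M.map (algebraMap A P.ResidueField)).rank) :
    ∃ s ∉ P, ∀ y : Fin r → A, ∃ v, M.mulVec v = s • y := by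
  classical
  obtain ⟨f, g, hfg⟩ := exists_submatrix_det_ne_zero _ h
  rw [Matrix.submatrix_map, ← RingHom.mapMatrix_apply, ← RingHom.map_det, Ne,
    Ideal.algebraMap_residueField_eq_zero] at hfg
  have hf : Function.Injective f := by
    by_contra hf
    simp only [Function.Injective, not_forall] at hf
    obtain ⟨a, b, hab, hne⟩ := hf
    refine hfg ?_
    rw [Matrix.det_zero_of_row_eq hne]
    · exact zero_mem _
    · ext j; simp [hab]
  have hfe : Function.Bijective f := Finite.injective_iff_bijective.mp hf
  set N := M.submatrix f g with hN
  refine ⟨N.det, hfg, fun y => ⟨fun l => ∑ j, if g j = l then N.adjugate.mulVec (y ∘ f) j else 0,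
    ?_⟩⟩
  ext i
  obtain ⟨i, rfl⟩ := hfe.2 i
  have h1 : N.mulVec (N.adjugate.mulVec (y ∘ f)) i = N.det * y (f i) := by
    rw [Matrix.mulVec_mulVec, Matrix.mul_adjugate, Matrix.smul_mulVec, Matrix.one_mulVec]
    simp
  rw [Pi.smul_apply, smul_eq_mul, ← h1]
  simp only [Matrix.mulVec, dotProduct, Finset.mul_sum, mul_ite, mul_zero]
  rw [Finset.sum_comm]
  refine Finset.sum_congr rfl fun j _ => ?_
  rw [Finset.sum_ite_eq, if_pos (Finset.mem_univ _)]
  rfl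

/-- The ideal of elements annihilating the cokernel of a matrix. -/
def annCoker {A : Type*} [CommRing A] {r : ℕ} (M : Matrix (Fin r) ι A) : Ideal A where
  carrier := {s | ∀ y : Fin r → A, ∃ v, M.mulVec v = s • y}
  zero_mem' y := ⟨0, by simp⟩
  add_mem' {a b} ha hb y := by
    obtain ⟨v, hv⟩ := ha y
    obtain ⟨w, hw⟩ := hb y
    exact ⟨v + w, by rw [Matrix.mulVec_add, hv, hw, add_smul]⟩
  smul_mem' c a ha y := by
    obtain ⟨v, hv⟩ := ha y
    exact ⟨c • v, by rw [Matrix.mulVec_smul, hv, smul_smul, smul_eq_mul]⟩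

lemma mem_annCoker {A : Type*} [CommRing A] {r : ℕ} {M : Matrix (Fin r) ι A} {s : A} :
    s ∈ annCoker M ↔ ∀ y : Fin r → A, ∃ v, M.mulVec v = s • y := Iff.rfl

/-- If the rows of `M` become independent in every field where `t` is invertible, then a power
of `t` annihilates the cokernel of `M`. -/
lemma exists_pow_mem_annCoker {A : Type} [CommRing A] {r : ℕ} (M : Matrix (Fin r) ι A) (t : A)
    (h : ∀ (L : Type) [Field L] (f : A →+* L), f t ≠ 0 → ∀ y : Fin r → L,
      Matrix.vecMul y (M.map f) = 0 → y = 0) : ∃ K : ℕ, t ^ K ∈ annCoker M := by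
  by_contra hc
  have : t ∉ (annCoker M).radical := fun ⟨K, hK⟩ => hc ⟨K, hK⟩
  rw [Ideal.radical_eq_sInf, Ideal.mem_sInf] at this
  push Not at this
  obtain ⟨P, ⟨hJP, hP⟩, htP⟩ := this
  have hP' : P.IsPrime := hP
  have hrank : r ≤ (M.map (algebraMap A P.ResidueField)).rank := by
    have hli : LinearIndependent P.ResidueField (M.map (algebraMap A P.ResidueField)).row := by
      rw [← Matrix.vecMul_injective_iff]
      refine (injective_iff_map_eq_zero
        (Matrix.vecMulLinear (M.map (algebraMap A P.ResidueField)))).mpr fun y hy => ?_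
      exact h _ _ (by rwa [Ne, Ideal.algebraMap_residueField_eq_zero]) y hy
    rw [hli.rank_matrix, Fintype.card_fin]
  obtain ⟨s, hs, hsy⟩ := exists_notMem_mulVec_eq M P hrank
  exact hs (hJP hsy)

end Minors

section Strands

variable {A ι : Type} [CommRing A] [Fintype ι] {N : ℕ}

/-- The projection to polynomial degree `c` and exterior degree `b`. -/
def biE (A ι : Type) [CommRing A] [Fintype ι] {N : ℕ} (c b : ℕ) :
    ((ι → ℕ) → Ext A N) →ₗ[A] ((ι → ℕ) → Ext A N) where
  toFun f μ := if ∑ i, μ i = c then degE A b (f μ) else 0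
  map_add' f g := by ext1 μ; by_cases h : ∑ i, μ i = c <;> simp [h]
  map_smul' a f := by ext1 μ; by_cases h : ∑ i, μ i = c <;> simp [h]

lemma biE_apply (c b : ℕ) (f : (ι → ℕ) → Ext A N) (μ) :
    biE A ι c b f μ = if ∑ i, μ i = c then degE A b (f μ) else 0 := rfl

lemma biE_biE (c b : ℕ) (f : (ι → ℕ) → Ext A N) : biE A ι c b (biE A ι c b f) = biE A ι c b f := by
  ext1 μ
  simp only [biE_apply]
  split_ifs <;> simp [degE_degE]

lemma biE_eq_zero {c b : ℕ} (hb : N < b) : biE A ι (N := N) c b = 0 := by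
  refine LinearMap.ext fun f => funext fun μ => ?_
  simp [biE_apply, degE_eq_zero hb]

lemma biE_apply_zero {c b : ℕ} (hc : c ≠ 0) (f : (ι → ℕ) → Ext A N) : biE A ι c b f 0 = 0 := by
  simp [biE_apply, hc.symm]

variable [DecidableEq ι]

lemma sum_add_single (μ : ι → ℕ) (i : ι) : ∑ j, (μ + Pi.single i 1 : ι → ℕ) j = ∑ j, μ j + 1 := by
  simp [Finset.sum_add_distrib]

lemma sum_sub_single {μ : ι → ℕ} {i : ι} (h : μ i ≠ 0) :
    ∑ j, (μ - Pi.single i 1 : ι → ℕ) j + 1 = ∑ j, μ j := by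
  have : μ = (μ - Pi.single i 1) + Pi.single i 1 := by
    ext j
    by_cases e : j = i
    · subst e
      simp only [Pi.add_apply, Pi.sub_apply, Pi.single_eq_same]
      omega
    · simp [e]
  conv_rhs => rw [this, sum_add_single]

variable {o : ι → Ext A N →ₗ[A] Ext A N}

lemma dDiv_biE {b b' : ℕ} (ho : ∀ i f, o i (degE A b f) = degE A b' (o i f)) (c : ℕ)
    (f : (ι → ℕ) → Ext A N) : dDiv o (biE A ι (c + 1) b f) = biE A ι c b' (dDiv o f) := by
  ext1 μ
  simp only [dDiv_apply, biE_apply, sum_add_single, add_left_inj]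
  split_ifs <;> simp [ho]

lemma dDiv_biE_zero (b : ℕ) (f : (ι → ℕ) → Ext A N) : dDiv o (biE A ι 0 b f) = 0 := by
  ext1 μ
  simp only [dDiv_apply, biE_apply, sum_add_single]
  simp

lemma dSym_biE {b b' : ℕ} (ho : ∀ i f, o i (degE A b f) = degE A b' (o i f)) (c : ℕ)
    (f : (ι → ℕ) → Ext A N) : dSym o (biE A ι c b f) = biE A ι (c + 1) b' (dSym o f) := by
  ext1 μ
  simp only [dSym_apply, biE_apply, map_sum]
  by_cases hs : ∑ i, μ i = c + 1
  · rw [if_pos hs]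
    refine Finset.sum_congr rfl fun i _ => ?_
    by_cases h : μ i = 0
    · simp [h]
    · have := sum_sub_single h
      simp only [h, if_false]
      rw [if_pos (by omega), ho]
  · rw [if_neg hs]
    refine Finset.sum_eq_zero fun i _ => ?_
    by_cases h : μ i = 0
    · simp [h]
    · have := sum_sub_single h
      simp only [h, if_false]
      rw [if_neg (by omega), map_zero]

/-- Exactness of the strands of the divided power complex of degree-raising operators, given
enough partners. -/
theorem dDiv_strand_exact (h0 : ∀ i f, o i (o i f) = 0)
    (h : ∀ i j f, o i (o j f) + o j (o i f) = 0)
    (ho : ∀ i b f, o i (degE A b f) = degE A (b + 1) (o i f)) (rs : List A)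
    (hreg : IsWeaklyRegular A rs)
    (hpart : ∀ r ∈ rs, ∃ (K : ℕ) (e : ι → Ext A N →ₗ[A] Ext A N),
      ∀ i j f, o j (e i f) + e i (o j f) = if i = j then r ^ K • f else 0)
    (j b : ℕ) (hj : j ≠ 0) (hjb : j + b = rs.length) (z : (ι → ℕ) → Ext A N)
    (hz : biE A ι j b z = z) (hdz : dDiv o z = 0) : ∃ w, dDiv o w = z := by
  set q := rs.length with hq
  set D : ℕ → ((ι → ℕ) → Ext A N) →ₗ[A] ((ι → ℕ) → Ext A N) :=
    fun t => if t = 0 then 0 else dDiv o with hD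
  set π : ℕ → ((ι → ℕ) → Ext A N) →ₗ[A] ((ι → ℕ) → Ext A N) :=
    fun t => if t ≠ 0 ∧ t ≤ q + 1 then biE A ι (q + 1 - t) (t - 1) else 0 with hπ
  have key := acyclicity rs _ D π (by simp [hπ])
    (by
      intro t x
      simp only [hπ]
      split_ifs
      · exact biE_biE _ _ _
      · simp)
    (by
      intro t x
      rcases Nat.eq_zero_or_pos t with rfl | ht
      · simp [hD]
      · simp only [hD, hπ, ht.ne', if_false]
        rcases lt_trichotomy t (q + 1) with hlt | rfl | hlt
        · rw [if_pos ⟨ht.ne', by omega⟩, if_pos ⟨by omega, by omega⟩]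
          obtain ⟨c, hc⟩ : ∃ c, q + 1 - t = c + 1 := ⟨q - t, by omega⟩
          obtain ⟨b, rfl⟩ : ∃ b, t = b + 1 := ⟨t - 1, by omega⟩
          rw [hc, show q + 1 - (b + 1 + 1) = c by omega]
          exact dDiv_biE (fun i f => ho i b f) c x
        · rw [if_pos ⟨ht.ne', by omega⟩, if_neg (by omega)]
          simp [dDiv_biE_zero]
        · rw [if_neg (by omega), if_neg (by omega)]
          simp)
    (by
      intro t x
      rcases Nat.eq_zero_or_pos t with rfl | ht
      · simp [hD]
      · simp only [hD, ht.ne', if_false, Nat.succ_ne_zero]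
        exact dDiv_dDiv h0 h _)
    (isWeaklyRegular_pi rs _ (isWeaklyRegular_pi rs A hreg))
    (by
      intro r hr i hi y hy hdy
      simp only [hπ, hD, Nat.succ_ne_zero, if_false] at hy hdy
      rw [if_pos ⟨by simp, by omega⟩] at hy
      obtain ⟨K, e, he⟩ := hpart r hr
      have hy0 : y 0 = 0 := by
        rw [← hy]; exact biE_apply_zero (by omega) _
      rcases Nat.eq_zero_or_pos i with rfl | hi0
      · refine ⟨K * Fintype.card ι, 0, ?_⟩
        obtain ⟨w, hw⟩ := dDiv_exact h0 h he y hdy hy0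
        rw [map_zero]
        have : biE A ι q 0 (dDiv o w) = 0 := by
          ext μ S
          simp only [biE_apply]
          split_ifs
          · rw [dDiv_apply, degE_apply]
            split_ifs with hS
            · rw [Finset.sum_apply, Pi.zero_apply, Pi.zero_apply]
              refine Finset.sum_eq_zero fun i _ => ?_
              have hsplit : w (μ + Pi.single i 1) =
                  ∑ b ∈ Finset.range (N + 1), degE A b (w (μ + Pi.single i 1)) := by
                ext T
                rw [Finset.sum_apply]
                simp only [degE_apply]
                rw [Finset.sum_ite_eq, if_pos]
                have := card_finset_fin_le T
                simp; omega
              rw [hsplit, map_sum, Finset.sum_apply]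
              refine Finset.sum_eq_zero fun b _ => ?_
              rw [ho, degE_apply, if_neg (by omega)]
            · rfl
          · rfl
        rw [hw, map_smul] at this
        rw [pow_mul, ← this]
        congr 1
      · obtain ⟨w, hw⟩ := dDiv_exact h0 h he y hdy hy0
        exact ⟨K * Fintype.card ι, w, by simp only [hD, hi0.ne', if_false, pow_mul]; exact hw⟩)
  obtain ⟨w, -, hw⟩ := key b (by omega) z (by
      simp only [hπ]
      rw [if_pos ⟨by omega, by omega⟩, show q + 1 - (b + 1) = j by omega]
      exact hz) (by simpa [hD] using hdz)
  by_cases hb : b = 0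
  · simp only [hD, hb, if_true, LinearMap.zero_apply] at hw
    exact ⟨0, by rw [map_zero, hw]⟩
  · simp only [hD, hb, if_false] at hw
    exact ⟨w, hw⟩

end Strands

section Powers

variable {k R : Type} [Field k] [CommRing R] [Algebra k R] {𝒜 : ℤ → AddSubgroup R}
  [GradedRing 𝒜] {d n m : ℕ} {x : Fin d → R}

lemma map_wsign_mul {S : Type} [CommRing S] (F : R →+ S) (i : Fin n) (T : Finset (Fin n)) (r : R) :
    F (wsign R i T * r) = wsign S i T * F r := by
  rw [wsign, wsign]
  rcases neg_one_pow_eq_or R (T.filter (· < i)).card with h | h <;>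
    rcases Nat.even_or_odd (T.filter (· < i)).card with h' | h' <;>
    simp [h'.neg_one_pow]

/-- The linear forms `∑ T_c λ_{ci} φ_{il}`, written as a matrix in the variables `x`. -/
def pencil (φc : Fin d → Fin n → Fin n → k) (lam : Fin m → Fin n → k) :
    Fin d → Fin n → MvPolynomial (Fin m) k := fun a l =>
  ∑ c, ∑ i, MvPolynomial.C (lam c i * φc a i l) * MvPolynomial.X c

/-- The rows `λ_c φ` have no nontrivial linear relation away from the origin. -/
def NonDegenerate (x : Fin d → R) (φ : Matrix (Fin n) (Fin n) R) (lam : Fin m → Fin n → k) : Prop :=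
  ∀ (L : Type) [Field L] (g : R →+* L) (T : Fin m → L), (∃ a, g (x a) ≠ 0) →
    (∀ l, ∑ c, ∑ i, T c * g (algebraMap k R (lam c i)) * g (φ i l) = 0) → T = 0

lemma exists_partners (h : StdGraded k 𝒜 x) {φ : Matrix (Fin n) (Fin n) R}
    {lam : Fin m → Fin n → k} (hND : NonDegenerate x φ lam)
    {φc : Fin d → Fin n → Fin n → k} (hφc : ∀ i l, φ i l = ∑ a, φc a i l • x a) (c : Fin m) :
    ∃ (K : ℕ) (e : Fin d → Ext (MvPolynomial (Fin m) k) n →ₗ[MvPolynomial (Fin m) k]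
        Ext (MvPolynomial (Fin m) k) n),
      ∀ i j f, wedgeV (pencil φc lam j) (e i f) + e i (wedgeV (pencil φc lam j) f) =
        if i = j then (MvPolynomial.X c : MvPolynomial (Fin m) k) ^ K • f else 0 := by
  obtain ⟨K, hK⟩ := exists_pow_mem_annCoker (Matrix.of (pencil φc lam)) (MvPolynomial.X c) (by
    intro L _ f hf y hy
    by_contra hne
    obtain ⟨a, ha⟩ := Function.ne_iff.mp hne
    set g : R →+* L := (MvPolynomial.eval₂Hom (f.comp MvPolynomial.C) y).comp
      h.equiv.symm.toAlgHom.toRingHom with hg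
    have hgx : ∀ a, g (x a) = y a := by
      intro a
      have : h.equiv.symm (x a) = MvPolynomial.X a := by
        rw [AlgEquiv.symm_apply_eq]; simp [StdGraded.equiv]
      simp [hg, this]
    have hgk : ∀ c, g (algebraMap k R c) = f (MvPolynomial.C c) := by
      intro c
      have : h.equiv.symm (algebraMap k R c) = MvPolynomial.C c := by
        rw [AlgEquiv.commutes]; rfl
      simp [hg, this]
    have := hND L g (fun c => f (MvPolynomial.X c)) ⟨a, by rwa [hgx]⟩ (by
      intro l
      have := congrFun hy l
      simp only [Matrix.vecMul, dotProduct, Matrix.map_apply, Matrix.of_apply, pencil, map_sum,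
        map_mul,
        Pi.zero_apply] at this
      rw [← this]
      simp only [hφc, Algebra.smul_def, map_sum, map_mul, hgx, hgk, Finset.mul_sum]
      rw [Finset.sum_congr rfl fun c _ => Finset.sum_comm, Finset.sum_comm]
      refine Finset.sum_congr rfl fun a _ => Finset.sum_congr rfl fun c _ =>
        Finset.sum_congr rfl fun i _ => by ring)
    exact hf (congrFun this c))
  rw [mem_annCoker] at hK
  choose v hv using fun i : Fin d => hK (Pi.single i 1)
  refine ⟨K, fun i => contrV (v i), fun i j f => ?_⟩
  rw [wedgeV_contrV]
  have := congrFun (hv i) j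
  rw [Matrix.mulVec] at this
  refine (congrArg (· • f) this).trans ?_
  by_cases hij : i = j
  · subst hij; simp
  · simp [hij, Ne.symm hij]

lemma sum_sum_sum_sum_mul {S α β γ κ : Type} [CommRing S] [Fintype α] [Fintype β] [Fintype γ]
    [Fintype κ] (P : γ → κ → S) (Q : α → β → κ → S) :
    ∑ a, ∑ l, ∑ c, ∑ i, P c i * Q a l i = ∑ c, ∑ i, P c i * ∑ a, ∑ l, Q a l i := by
  calc _ = ∑ a, ∑ l, ∑ y : γ × κ, P y.1 y.2 * Q a l y.2 := by simp only [Fintype.sum_prod_type]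
    _ = ∑ y : γ × κ, ∑ a, ∑ l, P y.1 y.2 * Q a l y.2 := by
      rw [Finset.sum_congr rfl fun a _ => Finset.sum_comm, Finset.sum_comm]
    _ = _ := by simp only [Fintype.sum_prod_type, Finset.mul_sum]

/-- A functional on a graded piece which kills the Pfaffians of the relevant size is zero. -/
theorem functional_eq_zero (h : StdGraded k 𝒜 x) {φ : Matrix (Fin n) (Fin n) R}
    (halt : IsAlternating φ) (hlin : ∀ i j, φ i j ∈ 𝒜 1)
    {lam : Fin m → Fin n → k} (hND : NonDegenerate x φ lam) {s : ℕ} (hs : 2 * s ≤ m + 1)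
    (u : R →ₗ[k] k) (hu : ∀ T : Finset (Fin n), T.card = 2 * s → u (pfE φ T) = 0)
    (μ : Fin d → ℕ) (hμ : ∑ i, μ i = s) : u (∏ i, x i ^ μ i) = 0 := by
  choose φ' hφ' using fun i l => h.exists_linear (hlin i l)
  set φc : Fin d → Fin n → Fin n → k := fun a i l => φ' i l a with hφcdef
  have hφc : ∀ i l, φ i l = ∑ a, φc a i l • x a := hφ'
  set S := MvPolynomial (Fin m) k
  set Cu : R →ₗ[k] S := (Algebra.linearMap k S).comp u with hCu
  have hws : ∀ (i : Fin n) T r, wsign S i T * Cu r = Cu (wsign R i T * r) :=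
    fun i T r => (map_wsign_mul Cu.toAddMonoidHom i T r).symm
  have hCu_apply : ∀ r, Cu r = MvPolynomial.C (u r) := fun r => rfl
  suffices H : ∀ j ≤ s, ∀ μ : Fin d → ℕ, ∑ i, μ i = j → ∀ T : Finset (Fin n),
      T.card = 2 * (s - j) → u ((∏ i, x i ^ μ i) * pfE φ T) = 0 by
    have := H s le_rfl μ hμ ∅ (by simp)
    rwa [pfE_empty, mul_one] at this
  intro j
  induction j with
  | zero =>
    intro _ μ hμ T hT
    have : μ = 0 := by
      ext i
      exact Finset.sum_eq_zero_iff.mp hμ i (Finset.mem_univ i)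
    subst this
    simpa using hu T (by simpa using hT)
  | succ j ih =>
    intro hj
    replace ih := ih (by omega)
    set v : (Fin d → ℕ) → Ext S n := fun μ T =>
      if ∑ i, μ i = j + 1 ∧ T.card = 2 * (s - (j + 1)) then
        Cu ((∏ i, x i ^ μ i) * pfE φ T) else 0 with hv
    have hdv : dDiv (fun a => wedgeV (pencil φc lam a)) v = 0 := by
      ext1 μ
      ext1 T
      rw [dDiv_apply, Finset.sum_apply]
      simp only [wedgeV_apply_apply, wedgeE_apply, hv, sum_add_single, Pi.zero_apply]
      by_cases hμ : ∑ i, μ i = j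
      swap
      · simp [hμ]
      by_cases hT : T.card = 2 * (s - (j + 1)) + 1
      swap
      · refine Finset.sum_eq_zero fun a _ => Finset.sum_eq_zero fun l _ => ?_
        split_ifs with h1 h2
        · exact absurd (by rw [← h2.2, Finset.card_erase_add_one h1]) hT
        · simp
        · simp
      have e1 : ∀ a l, pencil φc lam a l * (if l ∈ T then wsign S l T *
            (if ∑ i, μ i + 1 = j + 1 ∧ (T.erase l).card = 2 * (s - (j + 1)) then
              Cu ((∏ i, x i ^ (μ + Pi.single a 1 : Fin d → ℕ) i) * pfE φ (T.erase l)) else 0)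
            else 0) =
          ∑ c, ∑ i, (MvPolynomial.C (lam c i) * MvPolynomial.X c : S) *
            Cu ((∏ i, x i ^ μ i) * ((φc a i l • x a) * wedgeE R l (pfE φ) T)) := by
        intro a l
        rw [wedgeE_apply]
        by_cases hl : l ∈ T
        · have hc : (T.erase l).card = 2 * (s - (j + 1)) := by
            rw [Finset.card_erase_of_mem hl, hT]; rfl
          rw [if_pos hl, if_pos hl, if_pos ⟨by rw [hμ], hc⟩, pencil, Finset.sum_mul]
          refine Finset.sum_congr rfl fun c _ => ?_
          rw [Finset.sum_mul]
          refine Finset.sum_congr rfl fun i _ => ?_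
          have e2 : (∏ i, x i ^ (μ + Pi.single a 1 : Fin d → ℕ) i) = (∏ i, x i ^ μ i) * x a := by
            simp only [Pi.add_apply, pow_add, Finset.prod_mul_distrib]
            congr 1
            rw [Finset.prod_eq_single a]
            · simp
            · intro b _ hb; simp [hb]
            · simp
          rw [e2, hws, smul_mul_assoc, mul_smul_comm, map_smul, MvPolynomial.smul_eq_C_mul, map_mul,
            show (∏ i, x i ^ μ i) * (x a * (wsign R l T * pfE φ (T.erase l))) =
            wsign R l T * ((∏ i, x i ^ μ i) * x a * pfE φ (T.erase l)) by ring]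
          ring
        · simp [hl]
      refine (Finset.sum_congr rfl fun a _ => Finset.sum_congr rfl fun l _ => e1 a l).trans ?_
      have e3 : ∀ i, ∑ a, ∑ l, Cu ((∏ i, x i ^ μ i) * ((φc a i l • x a) * wedgeE R l (pfE φ) T))
          = 0 := by
        intro i
        have e4 : ∑ a, ∑ l, Cu ((∏ i, x i ^ μ i) * ((φc a i l • x a) * wedgeE R l (pfE φ) T)) =
            Cu ((∏ i, x i ^ μ i) * ∑ l, φ i l * wedgeE R l (pfE φ) T) := by
          rw [Finset.sum_comm]
          simp only [map_sum, Finset.mul_sum, hφc, Finset.sum_mul]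
        rw [e4, ← wedgeV_apply_apply, ← contrE_pfE halt, contrE_apply]
        split_ifs with hi
        · simp
        · rw [mul_left_comm, ← hws, hCu_apply,
            ih μ hμ _ (by rw [Finset.card_insert_of_notMem hi, hT]; omega)]
          simp
      calc _ = ∑ c, ∑ i, (MvPolynomial.C (lam c i) * MvPolynomial.X c : S) *
            ∑ a, ∑ l, Cu ((∏ i, x i ^ μ i) * ((φc a i l • x a) * wedgeE R l (pfE φ) T)) :=
            sum_sum_sum_sum_mul (fun c i => (MvPolynomial.C (lam c i) * MvPolynomial.X c : S))
              (fun a l i => Cu ((∏ i, x i ^ μ i) * ((φc a i l • x a) * wedgeE R l (pfE φ) T)))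
        _ = 0 := by simp only [e3, mul_zero, Finset.sum_const_zero]
    obtain ⟨w, hw⟩ := dDiv_strand_exact (o := fun a => wedgeV (pencil φc lam a))
      (fun i f => wedgeV_wedgeV_self _ f) (fun i j f => wedgeV_anticomm _ _ f)
      (fun i b f => wedgeV_degE _ b f)
      (((List.finRange m).take (j + 1 + 2 * (s - (j + 1)))).map MvPolynomial.X)
      (isWeaklyRegular_map_X _ ((List.nodup_finRange m).sublist (List.take_sublist _ _)))
      (by
        intro r hr
        obtain ⟨c, -, rfl⟩ := List.mem_map.mp hr
        exact exists_partners h hND hφc c)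
      (j + 1) (2 * (s - (j + 1))) (by omega) (by simp; omega) v (by
        ext1 μ
        ext1 T
        by_cases h1 : ∑ i, μ i = j + 1 <;> by_cases h2 : T.card = 2 * (s - (j + 1)) <;>
          simp [biE_apply, degE_apply, hv, h1, h2]) hdv
    intro μ hμ T hT
    have e4 := congrFun (congrFun hw μ) T
    rw [dDiv_apply, Finset.sum_apply] at e4
    simp only [wedgeV_apply_apply, hv] at e4
    rw [if_pos ⟨hμ, hT⟩, hCu_apply] at e4
    have e5 := congrArg MvPolynomial.constantCoeff e4
    simpa [pencil] using e5.symm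

lemma pf_mem : ∀ (s : ℕ) {A : Matrix (Fin (2 * s)) (Fin (2 * s)) R}, (∀ i j, A i j ∈ 𝒜 1) →
    pf (2 * s) A ∈ 𝒜 (s : ℤ)
  | 0, A, _ => by
    have : pf (2 * 0) A = 1 := rfl
    rw [this]
    exact SetLike.GradedOne.one_mem (A := 𝒜)
  | s + 1, A, hA => by
    have : pf (2 * (s + 1)) A = ∑ j : Fin (2 * s + 1), (-1 : R) ^ (j : ℕ) * A 0 j.succ *
        pf (2 * s) (A.submatrix (fun i => Fin.succ (j.succAbove i))
          (fun i => Fin.succ (j.succAbove i))) := rfl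
    rw [this]
    refine AddSubgroup.sum_mem _ fun j _ => ?_
    have h1 := SetLike.mul_mem_graded (hA 0 j.succ)
      (pf_mem s (A := A.submatrix (fun i => Fin.succ (j.succAbove i))
          (fun i => Fin.succ (j.succAbove i))) fun _ _ => hA _ _)
    rw [mul_assoc, show ((s + 1 : ℕ) : ℤ) = 1 + s by push_cast; ring]
    rcases neg_one_pow_eq_or R (j : ℕ) with e | e <;> rw [e]
    · simpa using h1
    · simpa using neg_mem h1

lemma pfE_mem {φ : Matrix (Fin n) (Fin n) R} (hlin : ∀ i j, φ i j ∈ 𝒜 1) {s : ℕ}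
    {T : Finset (Fin n)} (hT : T.card = 2 * s) : pfE φ T ∈ 𝒜 (s : ℤ) := by
  rw [← pf_submatrix_orderEmbOfFin φ T hT]
  exact pf_mem s fun _ _ => hlin _ _

lemma pfaffianIdeal_eq_span_pfE (r : ℕ) (φ : Matrix (Fin n) (Fin n) R) :
    pfaffianIdeal n r φ = Ideal.span {z | ∃ T : Finset (Fin n), T.card = r ∧ z = pfE φ T} := by
  rw [pfaffianIdeal]
  congr 1
  ext z
  constructor
  · rintro ⟨S, h, rfl⟩
    exact ⟨S, h, pf_submatrix_orderEmbOfFin φ S h⟩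
  · rintro ⟨S, h, rfl⟩
    exact ⟨S, h, (pf_submatrix_orderEmbOfFin φ S h).symm⟩

theorem pfaffianIdeal_eq_pow (h : StdGraded k 𝒜 x) {φ : Matrix (Fin n) (Fin n) R}
    (halt : IsAlternating φ) (hlin : ∀ i j, φ i j ∈ 𝒜 1)
    {lam : Fin m → Fin n → k} (hND : NonDegenerate x φ lam) {s : ℕ} (hs : 2 * s ≤ m + 1) :
    pfaffianIdeal n (2 * s) φ = Ideal.span (Set.range x) ^ s := by
  rw [pfaffianIdeal_eq_span_pfE]
  apply le_antisymm
  · rw [Ideal.span_le]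
    rintro _ ⟨T, hT, rfl⟩
    exact h.mem_span_pow (pfE_mem hlin hT)
  · rw [h.span_pow_eq, Ideal.span_le]
    intro r hr
    have key : r ∈ Submodule.span k {z | ∃ T : Finset (Fin n), T.card = 2 * s ∧ z = pfE φ T} := by
      refine Submodule.span_le.mpr ?_ (h.mem_span hr)
      rintro _ ⟨μ, hμ, rfl⟩
      by_contra hc
      obtain ⟨u, hu0, hu⟩ := Submodule.exists_le_ker_of_notMem hc
      exact hu0 (functional_eq_zero h halt hlin hND hs u
        (fun T hT => hu (Submodule.subset_span ⟨T, hT, rfl⟩)) μ hμ)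
    exact Submodule.span_le_restrictScalars k R _ key

end Powers

section Height
variable {R : Type} [CommRing R]

lemma idealHeight_le {I P : Ideal R} [hP : P.IsPrime] (h : I ≤ P) : idealHeight I ≤ P.height := by
  refine (iInf₂_le ⟨P, hP⟩ h).trans ?_
  rw [← PrimeSpectrum.height_eq_orderHeight]

lemma le_idealHeight {I : Ideal R} {c : ℕ∞}
    (h : ∀ P : Ideal R, P.IsPrime → I ≤ P → c ≤ P.height) : c ≤ idealHeight I := by
  refine le_iInf₂ fun P hP => ?_
  rw [← PrimeSpectrum.height_eq_orderHeight]
  exact h _ P.isPrime hP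

lemma isHomogeneous_of_mem_minimalPrimes {𝒜 : ℤ → AddSubgroup R} [GradedRing 𝒜] {J P : Ideal R}
    (hJ : J.IsHomogeneous 𝒜) (hP : P ∈ J.minimalPrimes) : P.IsHomogeneous 𝒜 := by
  have hp := hP.1.1
  have h1 : J ≤ (P.homogeneousCore 𝒜).toIdeal := by
    classical
    intro r hr
    rw [← DirectSum.sum_support_decompose 𝒜 r]
    exact Ideal.sum_mem _ fun i _ => Ideal.mem_homogeneousCore_of_homogeneous_of_mem
      ⟨i, SetLike.coe_mem _⟩ (hP.1.2 (hJ i hr))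
  have h2 := hP.2 ⟨hp.homogeneousCore, h1⟩ (Ideal.toIdeal_homogeneousCore_le 𝒜 P)
  rw [Ideal.IsHomogeneous.iff_eq]
  exact le_antisymm (Ideal.toIdeal_homogeneousCore_le 𝒜 P) h2

namespace StdGraded
variable {k : Type} [Field k] [Algebra k R] {𝒜 : ℤ → AddSubgroup R}
  [GradedRing 𝒜] {d : ℕ} {x : Fin d → R}

lemma le_span_of_isHomogeneous (h : StdGraded k 𝒜 x) {P : Ideal R} (hP : P.IsHomogeneous 𝒜)
    (hne : P ≠ ⊤) : P ≤ Ideal.span (Set.range x) := by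
  classical
  intro r hr
  rw [← DirectSum.sum_support_decompose 𝒜 r]
  refine Ideal.sum_mem _ fun i _ => ?_
  rw [← h.maxHomIdeal_eq]
  refine Ideal.subset_span ?_
  by_cases hi : i = 0
  · left
    subst hi
    refine ⟨SetLike.coe_mem _, fun hu => hne ?_⟩
    have := hP 0 hr
    refine Ideal.eq_top_of_isUnit_mem _ this ?_
    exact hu.map (SetLike.GradeZero.subring 𝒜).subtype
  · right
    simp only [Set.mem_iUnion]
    exact ⟨i, hi, SetLike.coe_mem _⟩

lemma isPrime_span (h : StdGraded k 𝒜 x) : (Ideal.span (Set.range x)).IsPrime := by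
  have h1 : Ideal.span (Set.range x) =
      RingHom.ker ((MvPolynomial.aeval (fun _ : Fin d => (0 : k))).toRingHom.comp
        h.equiv.symm.toRingEquiv.toRingHom) := by
    have hx : ∀ i, h.equiv.symm (x i) = MvPolynomial.X i := fun i => by
      rw [AlgEquiv.symm_apply_eq]; simp [StdGraded.equiv]
    apply le_antisymm
    · rw [Ideal.span_le]
      rintro _ ⟨i, rfl⟩
      simp [RingHom.mem_ker, hx]
    · intro r hr
      obtain ⟨F, rfl⟩ := h.equiv.surjective r
      have hF : MvPolynomial.constantCoeff F = 0 := by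
        simpa [RingHom.mem_ker, MvPolynomial.aeval_zero', MvPolynomial.constantCoeff_eq] using hr
      have := (MvPolynomial.mem_ideal_span_X_image (s := Set.univ) (x := F)).mpr (by
        intro m hm
        by_contra hc
        have : m = 0 := by ext i; by_contra h'; exact hc ⟨i, trivial, h'⟩
        subst this
        exact MvPolynomial.mem_support_iff.mp hm hF)
      have h2 := Ideal.mem_map_of_mem h.equiv.toRingEquiv.toRingHom this
      rw [Ideal.map_span] at h2
      refine Ideal.span_mono ?_ h2
      rintro _ ⟨_, ⟨i, -, rfl⟩, rfl⟩
      exact ⟨i, by simp [StdGraded.equiv]⟩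
  rw [h1]
  exact RingHom.ker_isPrime _

lemma height_span_le (h : StdGraded k 𝒜 x) : (Ideal.span (Set.range x)).height ≤ d := by
  have := h.isNoetherianRing
  have := h.isPrime_span
  have hm : Ideal.span (Set.range x) ∈ (Ideal.span (Set.range x)).minimalPrimes :=
    ⟨⟨this, le_rfl⟩, fun _ hq _ => hq.2⟩
  refine (Ideal.height_le_card_of_mem_minimalPrimes_span (Set.finite_range x) hm).trans ?_
  rw [← Set.image_univ]
  exact_mod_cast (Set.ncard_image_le Set.finite_univ).trans (by simp)

lemma eq_span_of_le_height (h : StdGraded k 𝒜 x) {P : Ideal R} [P.IsPrime] (hP : P.IsHomogeneous 𝒜)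
    (hd : (d : ℕ∞) ≤ P.height) : P = Ideal.span (Set.range x) := by
  have := h.isNoetherianRing
  have := h.isPrime_span
  by_contra hne
  have hlt := lt_of_le_of_ne (h.le_span_of_isHomogeneous hP Ideal.IsPrime.ne_top') hne
  have := Ideal.height_strict_mono_of_isPrime_of_isPrime hlt
  exact absurd (this.trans_le h.height_span_le) (not_lt.mpr hd)

/-- A homogeneous ideal of maximal height contains powers of the variables. -/
lemma exists_pow_mem (h : StdGraded k 𝒜 x) {J : Ideal R} (hJ : J.IsHomogeneous 𝒜)
    (hd : ∀ P : Ideal R, P.IsPrime → J ≤ P → (d : ℕ∞) ≤ P.height) {r : R}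
    (hr : r ∈ Ideal.span (Set.range x)) : ∃ N, r ^ N ∈ J := by
  suffices r ∈ J.radical from this
  rw [← Ideal.sInf_minimalPrimes, Ideal.mem_sInf]
  intro P hP
  have := hP.1.1
  rwa [h.eq_span_of_le_height (isHomogeneous_of_mem_minimalPrimes hJ hP) (hd P this hP.1.2)]
end StdGraded

lemma isHomogeneous_annCoker {𝒜 : ℤ → AddSubgroup R} [GradedRing 𝒜] {ι : Type} [Fintype ι] {r : ℕ}
    (M : Matrix (Fin r) ι R) (e : ι → ℤ) (hM : ∀ i j, M i j ∈ 𝒜 (e j)) :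
    (annCoker M).IsHomogeneous 𝒜 := by
  intro z s hs
  rw [mem_annCoker] at hs ⊢
  choose v hv using fun i => hs (Pi.single i 1)
  have key : ∀ i, M.mulVec (fun j => (DirectSum.decompose 𝒜 (v i j) (z - e j) : R)) =
      (DirectSum.decompose 𝒜 s z : R) • Pi.single i 1 := by
    intro i
    ext l
    have h1 := congrFun (hv i) l
    have h2 := congrArg (GradedRing.proj 𝒜 z) h1
    simp only [Matrix.mulVec, dotProduct, map_sum] at h2 ⊢
    have h3 : ∀ j, GradedRing.proj 𝒜 z (M l j * v i j) =
        M l j * (DirectSum.decompose 𝒜 (v i j) (z - e j) : R) := by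
      intro j
      rw [GradedRing.proj_apply]
      conv_lhs => rw [show z = e j + (z - e j) by ring]
      exact DirectSum.coe_decompose_mul_add_of_left_mem 𝒜 (hM l j)
    simp only [h3] at h2
    rw [h2]
    by_cases hil : l = i
    · subst hil; simp
    · simp [hil]
  intro y
  refine ⟨∑ i, y i • fun j => (DirectSum.decompose 𝒜 (v i j) (z - e j) : R), ?_⟩
  rw [Matrix.mulVec_sum]
  simp only [Matrix.mulVec_smul, key]
  ext l
  simp [Finset.sum_apply, Pi.single_apply, mul_comm]

end Height

section Generic
variable {k R : Type} [Field k] [CommRing R] [Algebra k R] {n d : ℕ}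

/-- The matrix `φ` with the constant columns in `A` adjoined. -/
def adjoinCols (φ : Matrix (Fin n) (Fin n) R) (A : Finset (Fin n → k)) :
    Matrix (Fin n) (Fin n ⊕ A) R :=
  Matrix.fromCols φ (Matrix.of fun i h => algebraMap k R (h.1 i))

/-- The column space of `adjoinCols φ A` at the prime `P`. -/
def colSpan (φ : Matrix (Fin n) (Fin n) R) (P : Ideal R) [P.IsPrime] (A : Finset (Fin n → k)) :
    Submodule P.ResidueField (Fin n → P.ResidueField) :=
  Submodule.span _ (Set.range (fun j i => algebraMap R P.ResidueField (φ i j)) ∪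
    (fun (h : Fin n → k) i => algebraMap R P.ResidueField (algebraMap k R (h i))) '' A)

lemma rank_adjoinCols (φ : Matrix (Fin n) (Fin n) R) (P : Ideal R) [P.IsPrime]
    (A : Finset (Fin n → k)) :
    ((adjoinCols φ A).map (algebraMap R P.ResidueField)).rank =
      Module.finrank P.ResidueField (colSpan φ P A) := by
  have : Set.range (((adjoinCols φ A).map (algebraMap R P.ResidueField)).col) =
      Set.range (fun j i => algebraMap R P.ResidueField (φ i j)) ∪
        (fun (h : Fin n → k) i => algebraMap R P.ResidueField (algebraMap k R (h i))) '' A := by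
    ext v
    constructor
    · rintro ⟨j | h, rfl⟩
      · exact Or.inl ⟨j, rfl⟩
      · exact Or.inr ⟨h.1, h.2, rfl⟩
    · rintro (⟨j, rfl⟩ | ⟨h, hh, rfl⟩)
      · exact ⟨Sum.inl j, rfl⟩
      · exact ⟨Sum.inr ⟨h, hh⟩, rfl⟩
  rw [Matrix.rank_eq_finrank_span_cols, colSpan, this]

/-- The vectors whose image lies in the column space at `P`. -/
def colSpanComap (φ : Matrix (Fin n) (Fin n) R) (P : Ideal R) [P.IsPrime] (A : Finset (Fin n → k)) :
    Submodule k (Fin n → k) where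
  carrier := {h | (fun i => algebraMap R P.ResidueField (algebraMap k R (h i))) ∈ colSpan φ P A}
  zero_mem' := by
    change (fun i => _) ∈ colSpan φ P A
    simp only [Pi.zero_apply, map_zero]; exact zero_mem _
  add_mem' {a b} ha hb := by
    have := Submodule.add_mem (colSpan φ P A) ha hb
    change (fun i => _) ∈ colSpan φ P A
    simp only [Pi.add_apply, map_add]; exact this
  smul_mem' c a ha := by
    have := Submodule.smul_mem (colSpan φ P A) (algebraMap R P.ResidueField (algebraMap k R c)) ha
    change (fun i => _) ∈ colSpan φ P A
    simp only [Pi.smul_apply, smul_eq_mul, map_mul]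
    exact this

lemma colSpanComap_ne_top {φ : Matrix (Fin n) (Fin n) R} {P : Ideal R} [P.IsPrime]
    {A : Finset (Fin n → k)} (h : Module.finrank P.ResidueField (colSpan φ P A) < n) :
    colSpanComap φ P A ≠ ⊤ := by
  intro ht
  have : colSpan φ P A = ⊤ := by
    rw [eq_top_iff, ← (Pi.basisFun P.ResidueField (Fin n)).span_eq, Submodule.span_le]
    rintro _ ⟨j, rfl⟩
    have hj : (Pi.single j 1 : Fin n → k) ∈ colSpanComap φ P A := by rw [ht]; trivial
    have e : (fun i => algebraMap R P.ResidueField (algebraMap k R ((Pi.single j 1 : Fin n → k) i)))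
        = Pi.basisFun P.ResidueField (Fin n) j := by
      ext i
      by_cases hij : i = j
      · subst hij; simp
      · simp [hij]
    rw [← e]
    exact hj
  rw [this, finrank_top] at h
  simp at h

open scoped Classical in
lemma finrank_colSpan_insert (φ : Matrix (Fin n) (Fin n) R) (P : Ideal R) [P.IsPrime]
    (A : Finset (Fin n → k)) (h : Fin n → k) :
    Module.finrank P.ResidueField (colSpan φ P A) ≤
      Module.finrank P.ResidueField (colSpan φ P (insert h A)) ∧
    (h ∉ colSpanComap φ P A → Module.finrank P.ResidueField (colSpan φ P A) <
      Module.finrank P.ResidueField (colSpan φ P (insert h A))) := by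
  have hle : colSpan φ P A ≤ colSpan φ P (insert h A) := by
    refine Submodule.span_mono (Set.union_subset_union_right _ (Set.image_mono ?_))
    exact_mod_cast Finset.subset_insert h A
  refine ⟨Submodule.finrank_mono hle, fun hh => Submodule.finrank_lt_finrank_of_lt ?_⟩
  refine lt_of_le_of_ne hle fun he => hh ?_
  change _ ∈ colSpan φ P A
  rw [he]
  exact Submodule.subset_span (Or.inr ⟨h, by simp, rfl⟩)

/-- `A` adjoins to `φ` as many independent columns as possible at the primes of height
less than `d`. -/
def IsGeneric (d : ℕ) (φ : Matrix (Fin n) (Fin n) R) (A : Finset (Fin n → k)) : Prop :=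
  ∀ (P : Ideal R) [P.IsPrime] (c : ℕ), P.height = c → c < d →
    n + A.card ≤ Module.finrank P.ResidueField (colSpan φ P A) + 1 + c ∨
      n ≤ Module.finrank P.ResidueField (colSpan φ P A)

lemma isGeneric_empty {φ : Matrix (Fin n) (Fin n) R} (hdn : d ≤ n)
    (hF : ∀ i : ℕ, (n : ℤ) - d ≤ i → (i : ℤ) ≤ (n : ℤ) - 1 →
      ((n - i : ℕ) : ℕ∞) ≤ idealHeight (minorsIdeal n i φ)) :
    IsGeneric d φ (∅ : Finset (Fin n → k)) := by
  intro P _ c hPc hc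
  left
  have h1 := hF (n - 1 - c) (by omega) (by omega)
  have h2 : ¬ minorsIdeal n (n - 1 - c) φ ≤ P := by
    intro h
    have := h1.trans (idealHeight_le h)
    rw [hPc, Nat.cast_le] at this
    omega
  rw [minorsIdeal, Ideal.span_le, Set.not_subset] at h2
  obtain ⟨_, ⟨f, g, rfl⟩, hfg⟩ := h2
  have h3 := le_rank_of_det_ne_zero
    ((adjoinCols φ (∅ : Finset (Fin n → k))).map (algebraMap R P.ResidueField)) f
    (fun i => Sum.inl (g i)) (by
      rw [Matrix.submatrix_map, ← RingHom.mapMatrix_apply, ← RingHom.map_det, Ne,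
        Ideal.algebraMap_residueField_eq_zero]
      exact hfg)
  rw [rank_adjoinCols] at h3
  simp only [Finset.card_empty]
  omega

open scoped Classical in
lemma IsGeneric.exists_insert [IsNoetherianRing R] {φ : Matrix (Fin n) (Fin n) R}
    {A : Finset (Fin n → k)} (hA : IsGeneric d φ A) :
    ∃ W : Finset (Submodule k (Fin n → k)), ⊤ ∉ W ∧
      ∀ h, (∀ w ∈ W, h ∉ w) → IsGeneric d φ (insert h A) := by
  set bad : Set (PrimeSpectrum R) := {P | ∃ c : ℕ, P.asIdeal.height = c ∧ c < d ∧
    Module.finrank P.asIdeal.ResidueField (colSpan φ P.asIdeal A) + 1 + c = n + A.card ∧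
    Module.finrank P.asIdeal.ResidueField (colSpan φ P.asIdeal A) < n} with hbad
  have hfin : bad.Finite := by
    let J : ℕ → Ideal R := fun E => Ideal.span
      {r | ∃ (f : Fin E → Fin n) (g : Fin E → Fin n ⊕ A), r = ((adjoinCols φ A).submatrix f g).det}
    have hJ : ∀ (E : ℕ) (P : Ideal R) [P.IsPrime], J E ≤ P ↔
        ¬ E ≤ Module.finrank P.ResidueField (colSpan φ P A) := by
      intro E P _
      rw [← rank_adjoinCols]
      constructor
      · intro h hr
        obtain ⟨f, g, hfg⟩ := exists_submatrix_det_ne_zero _ hr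
        rw [Matrix.submatrix_map, ← RingHom.mapMatrix_apply, ← RingHom.map_det, Ne,
          Ideal.algebraMap_residueField_eq_zero] at hfg
        exact hfg (h (Ideal.subset_span ⟨f, g, rfl⟩))
      · intro h
        rw [Ideal.span_le]
        rintro _ ⟨f, g, rfl⟩
        by_contra hc
        refine h (le_rank_of_det_ne_zero _ f g ?_)
        rw [Matrix.submatrix_map, ← RingHom.mapMatrix_apply, ← RingHom.map_det, Ne,
          Ideal.algebraMap_residueField_eq_zero]
        exact hc
    have hfin2 : (⋃ c ∈ Finset.range d, (J (n + A.card - c)).minimalPrimes).Finite :=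
      Set.Finite.biUnion (Finset.finite_toSet _)
        fun c _ => (J _).finite_minimalPrimes_of_isNoetherianRing R
    refine Set.Finite.of_finite_image (f := PrimeSpectrum.asIdeal) (hfin2.subset ?_)
      (fun a _ b _ h => PrimeSpectrum.ext h)
    rintro _ ⟨P, ⟨c, hPc, hc, he, hn⟩, rfl⟩
    simp only [Set.mem_iUnion]
    refine ⟨c, Finset.mem_range.mpr hc, ⟨P.isPrime, (hJ _ _).mpr (by omega)⟩, ?_⟩
    rintro Q ⟨hQ, hJQ⟩ hQP
    by_contra hne
    have hlt : Q < P.asIdeal := lt_of_le_not_ge hQP hne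
    have h1 := Ideal.height_strict_mono_of_isPrime_of_isPrime hlt
    rw [hPc] at h1
    obtain ⟨c', hc'⟩ := ENat.ne_top_iff_exists.mp h1.ne_top
    rw [← hc', Nat.cast_lt] at h1
    have := (hJ _ _).mp hJQ
    rcases hA Q c' hc'.symm (by omega) with h2 | h2 <;> omega
  refine ⟨(hfin.toFinset).image fun P => colSpanComap φ P.asIdeal A, ?_, ?_⟩
  · simp only [Finset.mem_image, Set.Finite.mem_toFinset, not_exists, not_and]
    rintro P ⟨c, -, -, -, hn⟩
    exact colSpanComap_ne_top hn
  · intro h hh P _ c hPc hc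
    obtain ⟨h1, h2⟩ := finrank_colSpan_insert φ P A h
    have hcard := Finset.card_insert_le h A
    by_cases hb : (⟨P, inferInstance⟩ : PrimeSpectrum R) ∈ bad
    · have := h2 (hh _ (Finset.mem_image.mpr ⟨⟨P, inferInstance⟩, by simpa using hb, rfl⟩))
      obtain ⟨c', hc', -, he, -⟩ := hb
      have hcc : c = c' := by
        have := hPc.symm.trans hc'
        exact_mod_cast this
      subst hcc
      left
      simp only at he
      omega
    · rcases hA P c hPc hc with h3 | h3
      · by_cases h4 : n ≤ Module.finrank P.ResidueField (colSpan φ P A)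
        · right; omega
        · left
          have : ¬ (Module.finrank P.ResidueField (colSpan φ P A) + 1 + c = n + A.card) := fun he =>
            hb ⟨c, hPc, hc, he, not_le.mp h4⟩
          omega
      · right; omega

open scoped Classical in
lemma exists_generic_finset [Infinite k] [IsNoetherianRing R] {φ : Matrix (Fin n) (Fin n) R}
    (h0 : IsGeneric d φ (∅ : Finset (Fin n → k))) (r : ℕ) (hr : r ≤ n) :
    ∃ H : Finset (Fin n → k), H.card = r ∧ LinearIndepOn k id (H : Set (Fin n → k)) ∧
      ∀ A ⊆ H, IsGeneric d φ A := by
  induction r with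
  | zero =>
    refine ⟨∅, rfl, by simp, fun A hA => ?_⟩
    rwa [Finset.subset_empty.mp hA]
  | succ r ih =>
    obtain ⟨H, hc, hli, hH⟩ := ih (by omega)
    have hW : ∀ A : Finset (Fin n → k), ∃ W : Finset (Submodule k (Fin n → k)), ⊤ ∉ W ∧
        (A ⊆ H → ∀ h, (∀ w ∈ W, h ∉ w) → IsGeneric d φ (insert h A)) := by
      intro A
      by_cases hA : A ⊆ H
      · obtain ⟨W, h1, h2⟩ := (hH A hA).exists_insert
        exact ⟨W, h1, fun _ => h2⟩
      · exact ⟨∅, by simp, fun h => absurd h hA⟩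
    choose W hW1 hW2 using hW
    have hspan : Submodule.span k (H : Set (Fin n → k)) ≠ ⊤ := by
      intro ht
      have : Module.finrank k (Submodule.span k (H : Set (Fin n → k))) ≤ H.card :=
        finrank_span_finset_le_card H
      rw [ht, finrank_top] at this
      simp at this
      omega
    have := Subspace.biUnion_ne_univ_of_top_notMem (k := k) (E := Fin n → k)
      (s := insert (Submodule.span k (H : Set (Fin n → k))) (H.powerset.biUnion W)) (by
        simp only [Finset.mem_insert, Finset.mem_biUnion, not_or, not_exists, not_and]
        exact ⟨hspan.symm, fun A _ => hW1 A⟩)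
    obtain ⟨h, hh⟩ := (Set.ne_univ_iff_exists_notMem _).mp this
    simp only [Set.mem_iUnion, SetLike.mem_coe, not_exists, Finset.mem_insert, Finset.mem_biUnion,
      Finset.mem_powerset, exists_prop, not_and] at hh
    have hhs := hh _ (Or.inl rfl)
    have hhH : h ∉ H := fun hm => hhs (Submodule.subset_span hm)
    refine ⟨insert h H, by rw [Finset.card_insert_of_notMem hhH, hc], ?_, ?_⟩
    · rw [Finset.coe_insert]
      exact hli.id_insert hhs
    · intro A hA
      by_cases hm : h ∈ A
      · rw [← Finset.insert_erase hm]
        have hsub : A.erase h ⊆ H := by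
          intro y hy
          have := hA (Finset.mem_of_mem_erase hy)
          exact (Finset.mem_insert.mp this).resolve_left (Finset.ne_of_mem_erase hy)
        exact hW2 _ hsub h fun w hw => hh w (Or.inr ⟨_, hsub, hw⟩)
      · refine hH A fun y hy => (Finset.mem_insert.mp (hA hy)).resolve_left ?_
        rintro rfl; exact hm hy

/-- `s` annihilates the cokernel of `φ` with the columns `hh a`, `a ∈ A`, adjoined. -/
def Annihilates (φ : Matrix (Fin n) (Fin n) R) (hh : Fin n → Fin n → k) (A : Finset (Fin n))
    (s : R) : Prop :=
  ∀ y : Fin n → R, ∃ u w : Fin n → R, ∀ i,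
    ∑ l, φ i l * u l + ∑ a ∈ A, algebraMap k R (hh a i) * w a = s * y i

/-- A basis of `k ^ n` in general position with respect to `φ`. -/
theorem StdGraded.exists_generic_basis {𝒜 : ℤ → AddSubgroup R} [GradedRing 𝒜] {x : Fin d → R}
    (h : StdGraded k 𝒜 x) [Infinite k] {φ : Matrix (Fin n) (Fin n) R} (hdn : d ≤ n)
    (hlin : ∀ i j, φ i j ∈ 𝒜 1)
    (hF : ∀ i : ℕ, (n : ℤ) - d ≤ i → (i : ℤ) ≤ (n : ℤ) - 1 →
      ((n - i : ℕ) : ℕ∞) ≤ idealHeight (minorsIdeal n i φ)) :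
    ∃ hh : Fin n → Fin n → k, LinearIndependent k hh ∧ ∀ A : Finset (Fin n), A.card = d →
      (∀ P : Ideal R, P.IsPrime → P.height < d → ∃ s ∉ P, Annihilates φ hh A s) ∧
      ∀ a, ∃ N, Annihilates φ hh A (x a ^ N) := by
  classical
  have := h.isNoetherianRing
  obtain ⟨H, hc, hli, hH⟩ := exists_generic_finset (isGeneric_empty (k := k) hdn hF) n le_rfl
  let e : Fin n ≃ H := (Finset.equivFinOfCardEq hc).symm
  refine ⟨fun i => (e i).1, ?_, ?_⟩
  · exact hli.linearIndependent.comp e e.injective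
  · intro A hA
    have hinj : Function.Injective fun i => (e i).1 := Subtype.val_injective.comp e.injective
    set B : Finset (Fin n → k) := A.image fun i => (e i).1 with hB
    have hBc : B.card = d := by rw [Finset.card_image_of_injective _ hinj, hA]
    have hBH : IsGeneric d φ B := hH B (by
      intro y hy
      obtain ⟨i, -, rfl⟩ := Finset.mem_image.mp hy
      exact (e i).2)
    have hconv : ∀ s ∈ annCoker (adjoinCols φ B), Annihilates φ (fun i => (e i).1) A s := by
      intro s hs y
      obtain ⟨v, hv⟩ := hs y
      refine ⟨fun l => v (Sum.inl l), fun a => if ha : (e a).1 ∈ B then v (Sum.inr ⟨_, ha⟩) else 0,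
        fun i => ?_⟩
      have h1 := congrFun hv i
      simp only [Matrix.mulVec, dotProduct, Fintype.sum_sum_type, adjoinCols,
        Matrix.fromCols_apply_inl, Matrix.fromCols_apply_inr, Matrix.of_apply, Pi.smul_apply,
        smul_eq_mul] at h1
      rw [← h1]
      congr 1
      rw [← Finset.sum_attach]
      refine Finset.sum_bij (fun a _ => ⟨(e a.1).1, Finset.mem_image_of_mem _ a.2⟩)
        (by simp) ?_ ?_ ?_
      · rintro a - b - hab
        have h2 : (e a.1).1 = (e b.1).1 := by
          rw [Subtype.mk.injEq] at hab
          exact hab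
        exact Subtype.ext (hinj h2)
      · rintro ⟨b, hb⟩ -
        obtain ⟨a, ha, rfl⟩ := Finset.mem_image.mp hb
        exact ⟨⟨a, ha⟩, Finset.mem_attach _ _, rfl⟩
      · rintro a -
        have hm : (e a).1 ∈ B := Finset.mem_image_of_mem (fun i => (e i).1) a.2
        simp only [dif_pos hm]
    have hht : ∀ P : Ideal R, P.IsPrime → P.height < d →
        ∃ s ∉ P, s ∈ annCoker (adjoinCols φ B) := by
      intro P hP hPd
      obtain ⟨c, hc'⟩ := ENat.ne_top_iff_exists.mp hPd.ne_top
      rw [← hc', Nat.cast_lt] at hPd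
      obtain ⟨s, hs, hsv⟩ := exists_notMem_mulVec_eq (adjoinCols φ B) P (by
        rw [rank_adjoinCols]
        rcases hBH P c hc'.symm hPd with h1 | h1 <;> omega)
      exact ⟨s, hs, hsv⟩
    refine ⟨fun P hP hPd => ?_, fun a => ?_⟩
    · obtain ⟨s, hs, hs'⟩ := hht P hP hPd
      exact ⟨s, hs, hconv s hs'⟩
    · obtain ⟨N, hN⟩ := h.exists_pow_mem (J := annCoker (adjoinCols φ B))
        (isHomogeneous_annCoker _ (Sum.elim (fun _ => 1) fun _ => 0) (by
          rintro i (j | b)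
          · exact hlin i j
          · exact h.algebraMap_mem _))
        (by
          intro P hP hle
          by_contra hlt
          obtain ⟨s, hs, hs'⟩ := hht P hP (not_le.mp hlt)
          exact hs (hle hs'))
        (Ideal.subset_span ⟨a, rfl⟩)
      exact ⟨N, hconv _ hN⟩

end Generic

lemma mem_colon_span_iff {R α : Type} [CommRing R] (J : Ideal R) (p : α → R) (f : R) :
    f ∈ Submodule.colon J (Ideal.span (Set.range p) : Ideal R) ↔ ∀ i, f * p i ∈ J := by
  rw [Submodule.mem_colon]
  constructor
  · intro hf i
    exact hf _ (Ideal.subset_span ⟨i, rfl⟩)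
  · intro hf z hz
    have : Ideal.span (Set.range p) ≤ Submodule.comap (LinearMap.mulLeft R f) J := by
      rw [Ideal.span_le]
      rintro _ ⟨i, rfl⟩
      exact hf i
    exact this hz

section Lower
variable {k R : Type} [Field k] [CommRing R] [Algebra k R] {𝒜 : ℤ → AddSubgroup R}
  [GradedRing 𝒜] {d n m : ℕ} {x : Fin d → R}

lemma pfaffianIdeal_eq_span_pfVec (hn : 1 ≤ n) (φ : Matrix (Fin n) (Fin n) R) :
    pfaffianIdeal n (n - 1) φ = Ideal.span (Set.range (pfVec φ)) := by
  rw [pfaffianIdeal_eq_span_pfE]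
  apply le_antisymm
  · rw [Ideal.span_le]
    rintro _ ⟨T, hT, rfl⟩
    have hc : Tᶜ.card = 1 := by rw [Finset.card_compl, hT, Fintype.card_fin]; omega
    obtain ⟨i, hi⟩ := Finset.card_eq_one.mp hc
    have hTi : T = Finset.univ.erase i := by
      rw [← compl_compl T, hi, Finset.compl_singleton]
    rw [hTi]
    have := Ideal.mul_mem_left (Ideal.span (Set.range (pfVec φ))) (wsign R i Finset.univ)
      (Ideal.subset_span ⟨i, rfl⟩)
    rwa [pfVec_eq, ← mul_assoc, wsign_mul_self, one_mul] at this
  · rw [Ideal.span_le]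
    rintro _ ⟨i, rfl⟩
    rw [pfVec_eq]
    exact Ideal.mul_mem_left _ _ (Ideal.subset_span ⟨_, by simp, rfl⟩)

lemma pfVec_mem {φ : Matrix (Fin n) (Fin n) R} (hlin : ∀ i j, φ i j ∈ 𝒜 1) (hn : Odd n)
    (i : Fin n) : pfVec φ i ∈ 𝒜 ((n / 2 : ℕ) : ℤ) := by
  obtain ⟨s, rfl⟩ := hn
  have h1 : pfE φ (Finset.univ.erase i) ∈ 𝒜 (s : ℤ) := pfE_mem hlin (by simp)
  rw [pfVec_eq, wsign, show (2 * s + 1) / 2 = s by omega]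
  rcases neg_one_pow_eq_or R (Finset.univ.filter (· < i)).card with h2 | h2
  · rwa [h2, one_mul]
  · rw [h2, neg_one_mul]; exact neg_mem h1

lemma isHomogeneous_colon {J : Ideal R} (hJ : J.IsHomogeneous 𝒜) {α : Type} {p : α → R} {e : α → ℤ}
    (hp : ∀ i, p i ∈ 𝒜 (e i)) :
    Ideal.IsHomogeneous 𝒜 (Submodule.colon J (Ideal.span (Set.range p) : Ideal R)) := by
  intro z f hf
  rw [mem_colon_span_iff] at hf ⊢
  intro i
  have := hJ (z + e i) (hf i)
  rwa [DirectSum.coe_decompose_mul_add_of_right_mem 𝒜 (hp i)] at this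

lemma nonDegenerate_of_annihilates {φ : Matrix (Fin n) (Fin n) R} {lam hh : Fin n → Fin n → k}
    (hdual : ∀ i j, ∑ l, lam i l * hh j l = if i = j then 1 else 0) {A : Finset (Fin n)}
    (hA : ∀ a, ∃ N, Annihilates φ hh A (x a ^ N)) {ι : Fin m → Fin n} (hι : ∀ c, ι c ∉ A)
    (hinj : Function.Injective ι) : NonDegenerate x φ fun c => lam (ι c) := by
  rintro L _ g T ⟨a, ha⟩ hT
  set z : Fin n → L := fun i => ∑ c, T c * g (algebraMap k R (lam (ι c) i)) with hz
  have hz1 : ∀ l, ∑ i, z i * g (φ i l) = 0 := by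
    intro l
    rw [← hT l, Finset.sum_comm]
    exact Finset.sum_congr rfl fun i _ => Finset.sum_mul _ _ _
  have hz2 : ∀ b, ∑ i, z i * g (algebraMap k R (hh b i)) = ∑ c, T c * if ι c = b then 1 else 0 := by
    intro b
    simp only [hz, Finset.sum_mul]
    rw [Finset.sum_comm]
    refine Finset.sum_congr rfl fun c _ => ?_
    have := congrArg (fun t => g (algebraMap k R t)) (hdual (ι c) b)
    simp only [map_sum, map_mul] at this
    simp only [mul_assoc, ← Finset.mul_sum]
    rw [this]
    split_ifs <;> simp
  obtain ⟨N, hN⟩ := hA a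
  have hz0 : z = 0 := by
    ext i0
    obtain ⟨u, w, huw⟩ := hN (Pi.single i0 1)
    have h1 : ∑ i, z i * g (x a ^ N * (Pi.single i0 1 : Fin n → R) i) = g (x a) ^ N * z i0 := by
      rw [Finset.sum_eq_single i0]
      · simp [mul_comm]
      · intro b _ hb; simp [hb]
      · simp
    have h2 : ∑ i, z i * g (x a ^ N * (Pi.single i0 1 : Fin n → R) i) = 0 := by
      simp only [← huw, map_add, map_sum, map_mul, mul_add, Finset.mul_sum, Finset.sum_add_distrib]
      rw [Finset.sum_comm, Finset.sum_comm (s := Finset.univ) (t := A)]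
      have e1 : ∀ l, ∑ i, z i * (g (φ i l) * g (u l)) = 0 := fun l => by
        simp only [← mul_assoc, ← Finset.sum_mul]; rw [hz1, zero_mul]
      have e2 : ∀ b ∈ A, ∑ i, z i * (g (algebraMap k R (hh b i)) * g (w b)) = 0 := fun b hb => by
        simp only [← mul_assoc, ← Finset.sum_mul]
        rw [hz2, Finset.sum_eq_zero, zero_mul]
        intro c _
        rw [if_neg, mul_zero]
        rintro rfl; exact hι c hb
      rw [Finset.sum_eq_zero fun l _ => e1 l, Finset.sum_eq_zero e2, add_zero]
    rw [h1] at h2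
    exact (mul_eq_zero.mp h2).resolve_left (pow_ne_zero _ ha)
  ext c
  have := hz2 (ι c)
  simp only [hz0, Pi.zero_apply, zero_mul, Finset.sum_const_zero] at this
  rw [Finset.sum_eq_single c] at this
  · simpa using this.symm
  · intro b _ hb
    rw [if_neg (hinj.ne hb), mul_zero]
  · simp

/-- The matrix `Λ φ Λᵀ`. -/
def congruent (lam : Fin n → Fin n → k) (φ : Matrix (Fin n) (Fin n) R) :
    Matrix (Fin n) (Fin n) R :=
  Matrix.of fun i j => ∑ l, ∑ m, algebraMap k R (lam i l * lam j m) * φ l m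

lemma isAlternating_congruent {φ : Matrix (Fin n) (Fin n) R} (halt : IsAlternating φ)
    (lam : Fin n → Fin n → k) : IsAlternating (congruent lam φ) := by
  constructor
  · intro i
    simp only [congruent, Matrix.of_apply]
    rw [← Fintype.sum_prod_type']
    refine Finset.sum_involution (fun p _ => (p.2, p.1)) ?_ ?_ (by simp) (by simp)
    · rintro ⟨l, m⟩ -
      simp only
      rw [halt.2 l m, mul_comm (lam i m)]; ring
    · rintro ⟨l, m⟩ - hne he
      simp only [Prod.mk.injEq] at he
      simp only [ne_eq] at hne
      rw [he.1, halt.1, mul_zero] at hne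
      exact hne rfl
  · intro i j
    simp only [congruent, Matrix.of_apply]
    rw [Finset.sum_comm, ← Finset.sum_neg_distrib]
    refine Finset.sum_congr rfl fun l _ => ?_
    rw [← Finset.sum_neg_distrib]
    refine Finset.sum_congr rfl fun m _ => ?_
    rw [halt.2 l m, mul_comm (lam j m)]; ring

lemma congruent_mem (h : StdGraded k 𝒜 x) {φ : Matrix (Fin n) (Fin n) R}
    (hlin : ∀ i j, φ i j ∈ 𝒜 1) (lam : Fin n → Fin n → k) (i j : Fin n) :
    congruent lam φ i j ∈ 𝒜 1 := by
  simp only [congruent, Matrix.of_apply]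
  refine sum_mem fun l _ => sum_mem fun m _ => ?_
  rw [← Algebra.smul_def]
  exact h.smul_mem _ (hlin l m)

/-- `Λ φ Λᵀ H = Λ φ` if `Λᵀ H = 1`. -/
lemma sum_congruent_mul {φ : Matrix (Fin n) (Fin n) R} {lam hh : Fin n → Fin n → k}
    (hdual' : ∀ l m, ∑ i, lam i l * hh i m = if l = m then 1 else 0) (i m : Fin n) :
    ∑ j, congruent lam φ i j * algebraMap k R (hh j m) =
      ∑ l, algebraMap k R (lam i l) * φ l m := by
  simp only [congruent, Matrix.of_apply, Finset.sum_mul]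
  rw [Finset.sum_comm]
  refine Finset.sum_congr rfl fun l _ => ?_
  rw [Finset.sum_comm]
  have : ∀ m', ∑ j, algebraMap k R (lam i l * lam j m') * φ l m' * algebraMap k R (hh j m) =
      algebraMap k R (lam i l) * φ l m' * (if m' = m then 1 else 0) := by
    intro m'
    have := congrArg (algebraMap k R) (hdual' m' m)
    simp only [map_sum, map_mul] at this
    have e : (algebraMap k R) (if m' = m then 1 else 0) = if m' = m then 1 else 0 := by
      split_ifs <;> simp
    rw [e] at this
    rw [← this, Finset.mul_sum]
    exact Finset.sum_congr rfl fun j _ => by rw [map_mul]; ring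
  rw [Finset.sum_congr rfl fun m' _ => this m']
  simp

lemma NonDegenerate.congruent {φ : Matrix (Fin n) (Fin n) R} {lam hh : Fin n → Fin n → k}
    (hdual' : ∀ l m, ∑ i, lam i l * hh i m = if l = m then 1 else 0) {ι : Fin m → Fin n}
    (hND : NonDegenerate x φ fun c => lam (ι c)) :
    NonDegenerate x (congruent lam φ) fun c => (Pi.single (ι c) 1 : Fin n → k) := by
  intro L _ g T hx hT
  refine hND L g T hx fun m => ?_
  have h1 : ∀ l, ∑ c, T c * g (Paper.congruent lam φ (ι c) l) = 0 := by
    intro l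
    rw [← hT l]
    refine Finset.sum_congr rfl fun c _ => ?_
    rw [Finset.sum_eq_single (ι c)]
    · simp
    · intro b _ hb; simp [hb]
    · simp
  have h2 : ∀ c, ∑ i, T c * g (algebraMap k R (lam (ι c) i)) * g (φ i m) =
      ∑ j, T c * g (Paper.congruent lam φ (ι c) j) * g (algebraMap k R (hh j m)) := by
    intro c
    have := congrArg g (sum_congruent_mul (φ := φ) hdual' (ι c) m)
    simp only [map_sum, map_mul] at this
    simp only [mul_assoc, ← Finset.mul_sum]
    rw [this]
  simp only [h2]
  rw [Finset.sum_comm]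
  refine Finset.sum_eq_zero fun j _ => ?_
  rw [← Finset.sum_mul, h1, zero_mul]

lemma congruent_mulVec {φ : Matrix (Fin n) (Fin n) R} {lam hh : Fin n → Fin n → k}
    (hdual' : ∀ l m, ∑ i, lam i l * hh i m = if l = m then 1 else 0) (p : Fin n → R)
    (hp : φ.mulVec p = 0) (i : Fin n) :
    ∑ j, congruent lam φ i j * ∑ m, algebraMap k R (hh j m) * p m = 0 := by
  simp only [Finset.mul_sum, ← mul_assoc]
  rw [Finset.sum_comm]
  simp only [← Finset.sum_mul]
  simp only [sum_congruent_mul hdual', Finset.sum_mul]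
  rw [Finset.sum_comm]
  refine Finset.sum_eq_zero fun l _ => ?_
  have := congrFun hp l
  simp only [Matrix.mulVec, dotProduct, Pi.zero_apply] at this
  simp only [mul_assoc, ← Finset.mul_sum]
  rw [this, mul_zero]

theorem StdGraded.isHomogResidualIntersection (h : StdGraded k 𝒜 x) {φ : Matrix (Fin n) (Fin n) R}
    (halt : IsAlternating φ) (hlin : ∀ i j, φ i j ∈ 𝒜 1) (hn : Odd n) {hh : Fin n → Fin n → k}
    {A : Finset (Fin n)} (hA : A.card = d)
    (hP : ∀ P : Ideal R, P.IsPrime → P.height < d → ∃ s ∉ P, Annihilates φ hh A s) :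
    IsHomogResidualIntersection 𝒜 (pfaffianIdeal n (n - 1) φ)
      (Submodule.colon (Ideal.span ((fun a => ∑ m, algebraMap k R (hh a m) * pfVec φ m) '' A))
        (pfaffianIdeal n (n - 1) φ)) d := by
  set y : Fin n → R := fun a => ∑ m, algebraMap k R (hh a m) * pfVec φ m with hy
  have hym : ∀ a, y a ∈ 𝒜 ((n / 2 : ℕ) : ℤ) := fun a => sum_mem fun m _ => by
    rw [← Algebra.smul_def]; exact h.smul_mem _ (pfVec_mem hlin hn m)
  have hrange : Set.range (y ∘ A.orderEmbOfFin hA) = y '' A := by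
    rw [Set.range_comp, Finset.range_orderEmbOfFin]
  have hI := pfaffianIdeal_eq_span_pfVec hn.pos φ
  refine ⟨y ∘ A.orderEmbOfFin hA, fun j => ⟨_, hym _⟩, ?_, ?_, ?_, ?_⟩
  · rw [Ideal.span_le, hI]
    rintro _ ⟨j, rfl⟩
    exact Ideal.sum_mem _ fun m _ => Ideal.mul_mem_left _ _ (Ideal.subset_span ⟨m, rfl⟩)
  · rw [hrange]
  · rw [hI]
    refine isHomogeneous_colon (Ideal.homogeneous_span 𝒜 _ ?_) fun i => pfVec_mem hlin hn i
    rintro _ ⟨a, -, rfl⟩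
    exact ⟨_, hym a⟩
  · refine le_idealHeight fun P hPp hPK => ?_
    by_contra hlt
    obtain ⟨s, hs, hann⟩ := hP P hPp (not_le.mp hlt)
    refine hs (hPK ?_)
    rw [hI, mem_colon_span_iff]
    intro l
    obtain ⟨u, w, huw⟩ := hann (Pi.single l 1)
    have h1 : s * pfVec φ l = ∑ i, pfVec φ i * (s * (Pi.single l 1 : Fin n → R) i) := by
      rw [Finset.sum_eq_single l]
      · simp [mul_comm]
      · intro b _ hb; simp [hb]
      · simp
    have h0 : ∀ j, ∑ i, pfVec φ i * φ i j = 0 := by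
      intro j
      have := congrFun (mulVec_pfVec halt) j
      simp only [Matrix.mulVec, dotProduct, Pi.zero_apply] at this
      rw [← neg_eq_zero, ← this, ← Finset.sum_neg_distrib]
      exact Finset.sum_congr rfl fun i _ => by rw [halt.2 j i]; ring
    rw [h1]
    simp only [← huw, mul_add, Finset.mul_sum, Finset.sum_add_distrib]
    rw [Finset.sum_comm, Finset.sum_comm (s := Finset.univ) (t := A)]
    refine Ideal.add_mem _ (Ideal.sum_mem _ fun j _ => ?_) (Ideal.sum_mem _ fun a ha => ?_)
    · simp only [← mul_assoc, ← Finset.sum_mul]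
      rw [h0, zero_mul]; exact zero_mem _
    · have : ∑ i, pfVec φ i * (algebraMap k R (hh a i) * w a) = w a * y a := by
        rw [hy, Finset.mul_sum]
        exact Finset.sum_congr rfl fun i _ => by ring
      rw [this]
      exact Ideal.mul_mem_left _ _ (Ideal.subset_span ⟨a, ha, rfl⟩)

theorem StdGraded.pfaffianIdeal_eq_and_le_sSup (h : StdGraded k 𝒜 x) [Infinite k]
    {φ : Matrix (Fin n) (Fin n) R} (halt : IsAlternating φ) (hlin : ∀ i j, φ i j ∈ 𝒜 1)
    (hdn : d ≤ n) (hn : Odd n)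
    (hF : ∀ i : ℕ, (n : ℤ) - d ≤ i → (i : ℤ) ≤ (n : ℤ) - 1 →
      ((n - i : ℕ) : ℕ∞) ≤ idealHeight (minorsIdeal n i φ)) :
    (∀ s, 2 * s ≤ n - d + 1 → pfaffianIdeal n (2 * s) φ = Ideal.span (Set.range x) ^ s) ∧
      Ideal.span (Set.range x) ^ ((n - d + 1) / 2) ≤
        sSup {K | IsHomogResidualIntersection 𝒜 (pfaffianIdeal n (n - 1) φ) K d} := by
  obtain ⟨hh, hli, hgen⟩ := h.exists_generic_basis hdn hlin hF
  have hunit : IsUnit (Matrix.of hh) := Matrix.linearIndependent_rows_iff_isUnit.mp hli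
  have hdet := (Matrix.isUnit_iff_isUnit_det _).mp hunit
  set lam : Fin n → Fin n → k := fun i l => (Matrix.of hh)⁻¹ l i with hlam
  have hdual : ∀ i j, ∑ l, lam i l * hh j l = if i = j then 1 else 0 := by
    intro i j
    have := congrFun (congrFun (Matrix.mul_nonsing_inv _ hdet) j) i
    rw [Matrix.mul_apply, Matrix.one_apply] at this
    simp only [Matrix.of_apply] at this
    simp only [hlam, mul_comm _ (hh _ _), this, eq_comm]
  have hdual' : ∀ l m, ∑ i, lam i l * hh i m = if l = m then 1 else 0 := by
    intro l m
    have := congrFun (congrFun (Matrix.nonsing_inv_mul _ hdet) l) m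
    rw [Matrix.mul_apply, Matrix.one_apply] at this
    exact this
  have hND : ∀ A : Finset (Fin n), A.card = d → ∃ ι : Fin (n - d) → Fin n,
      NonDegenerate x φ fun c => lam (ι c) := by
    intro A hA
    have hc : Aᶜ.card = n - d := by rw [Finset.card_compl, hA, Fintype.card_fin]
    refine ⟨Aᶜ.orderEmbOfFin hc, nonDegenerate_of_annihilates hdual (hgen A hA).2 (fun c => ?_)
      (Aᶜ.orderEmbOfFin hc).injective⟩
    exact Finset.mem_compl.mp (Finset.orderEmbOfFin_mem _ hc c)
  obtain ⟨A0, -, hA0⟩ := Finset.exists_subset_card_eq (s := (Finset.univ : Finset (Fin n))) (n := d)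
    (by simpa using hdn)
  obtain ⟨ι, hι⟩ := hND A0 hA0
  refine ⟨fun s hs => pfaffianIdeal_eq_pow h halt hlin hι hs, ?_⟩
  set s := (n - d + 1) / 2 with hs
  rw [← pfaffianIdeal_eq_pow h (isAlternating_congruent halt lam) (congruent_mem h hlin lam)
    (hι.congruent hdual') (by omega : 2 * s ≤ n - d + 1), pfaffianIdeal_eq_span_pfE, Ideal.span_le]
  rintro _ ⟨U, hU, rfl⟩
  obtain ⟨A, hUA, hA⟩ := Finset.exists_superset_card_eq (s := Uᶜ) (n := d)
    (by rw [Finset.card_compl, hU, Fintype.card_fin]; omega) (by simpa using hdn)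
  refine le_sSup (a := Submodule.colon _ _)
    (h.isHomogResidualIntersection halt hlin hn hA (hgen A hA).1) ?_
  set y : Fin n → R := fun a => ∑ m, algebraMap k R (hh a m) * pfVec φ m with hy
  set J := Ideal.span (y '' A) with hJ
  have hyA : ∀ a ∈ A, y a ∈ J := fun a ha => Ideal.subset_span ⟨a, ha, rfl⟩
  have hsum : ∀ i, ∑ j, congruent lam φ i j * y j = 0 :=
    congruent_mulVec hdual' _ (mulVec_pfVec halt)
  have hyU : ∀ j, y j * pfE (congruent lam φ) U ∈ J := by
    intro j
    by_cases hj : j ∈ U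
    · refine mul_pfE_mem (isAlternating_congruent halt lam) y U J (fun i _ => ?_) hj
      have h1 := hsum i
      rw [← Finset.sum_add_sum_compl U] at h1
      rw [eq_neg_of_add_eq_zero_left h1]
      exact neg_mem (Ideal.sum_mem _ fun l hl => Ideal.mul_mem_left _ _ (hyA l (hUA hl)))
    · exact Ideal.mul_mem_right _ _ (hyA j (hUA (Finset.mem_compl.mpr hj)))
  rw [pfaffianIdeal_eq_span_pfVec hn.pos, mem_colon_span_iff]
  intro i
  have hpi : pfVec φ i = ∑ j, algebraMap k R (lam j i) * y j := by
    simp only [hy, Finset.mul_sum, ← mul_assoc, ← map_mul]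
    rw [Finset.sum_comm]
    simp only [← Finset.sum_mul, ← map_sum, hdual']
    simp
  rw [hpi, Finset.mul_sum]
  refine Ideal.sum_mem _ fun j _ => ?_
  have := Ideal.mul_mem_left J (algebraMap k R (lam j i)) (hyU j)
  convert this using 1
  ring

end Lower

section Syzygy
variable {R S : Type} [CommRing R] [CommRing S] {n : ℕ}

lemma pf_map (f : R →+* S) : ∀ (n : ℕ) (A : Matrix (Fin n) (Fin n) R), pf n (A.map f) = f (pf n A)
  | 0, _ => by simp [pf]
  | 1, _ => by simp [pf]
  | n + 2, A => by
    simp only [pf, map_sum, map_mul, map_pow, map_neg, map_one, Matrix.map_apply]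
    refine Finset.sum_congr rfl fun j _ => ?_
    rw [← pf_map f n, Matrix.submatrix_map]

lemma pfVec_map (f : R →+* S) (φ : Matrix (Fin n) (Fin n) R) (i : Fin n) :
    pfVec (φ.map f) i = f (pfVec φ i) := by
  rw [pfVec_eq, pfVec_eq, pfE, pfE, Matrix.submatrix_map, pf_map, map_mul]
  simp [wsign]

/-- The maps in the complex `R → Rⁿ → Rⁿ → R` given by the Pfaffians, `φ` and the Pfaffians. -/
def pfComplex (φ : Matrix (Fin n) (Fin n) R) (i₀ : Fin n) : ℕ → (Fin n → R) →ₗ[R] (Fin n → R)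
  | 1 => (LinearMap.proj i₀).smulRight (pfVec φ)
  | 2 => φ.mulVecLin
  | 3 => (LinearMap.single R (fun _ => R) i₀).comp
      (∑ i, (pfVec φ i) • (LinearMap.proj i : (Fin n → R) →ₗ[R] R))
  | _ => 0

/-- The projections onto the terms of the complex. -/
def pfComplexProj (i₀ : Fin n) : ℕ → (Fin n → R) →ₗ[R] (Fin n → R)
  | 0 => 0
  | 2 => LinearMap.id
  | 3 => LinearMap.id
  | _ => (LinearMap.single R (fun _ => R) i₀).comp (LinearMap.proj i₀)

theorem exists_mulVec_eq_of_isWeaklyRegular {φ : Matrix (Fin n) (Fin n) R} (hφ : IsAlternating φ)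
    (i₀ : Fin n) {rs : List R} (hreg : IsWeaklyRegular R rs) (hlen : rs.length = 3)
    (hrs : ∀ r ∈ rs, ∃ N, r ^ N ∈ Ideal.span (Set.range (pfVec φ))) (c : Fin n → R)
    (hc : pfVec φ ⬝ᵥ c = 0) : ∃ v, φ.mulVec v = c := by
  have h3 : ∀ c : Fin n → R, pfComplex φ i₀ 3 c = Pi.single i₀ (pfVec φ ⬝ᵥ c) := fun c => by
    simp only [pfComplex, LinearMap.comp_apply, LinearMap.sum_apply, LinearMap.smul_apply,
      LinearMap.proj_apply, smul_eq_mul, dotProduct]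
    rfl
  have h1 : ∀ c : Fin n → R, pfComplex φ i₀ 1 c = c i₀ • pfVec φ := fun c => rfl
  have h2 : ∀ c : Fin n → R, pfComplex φ i₀ 2 c = φ.mulVec c := fun c => rfl
  have hpφ : ∀ v, pfVec φ ⬝ᵥ φ.mulVec v = 0 := by
    intro v
    rw [Matrix.dotProduct_mulVec]
    have : Matrix.vecMul (pfVec φ) φ = 0 := by
      have ht : φ.transpose = -φ := by ext i j; simpa using hφ.2 i j
      rw [← Matrix.mulVec_transpose, ht, Matrix.neg_mulVec, mulVec_pfVec hφ, neg_zero]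
    rw [this, zero_dotProduct]
  have hsingle : ∀ c : Fin n → R, pfComplexProj i₀ 1 c = Pi.single i₀ (c i₀) := fun c => rfl
  obtain ⟨v, -, hv⟩ := acyclicity rs (Fin n → R) (pfComplex φ i₀) (pfComplexProj i₀) rfl
    (by
      rintro (_ | _ | _ | _ | t) v <;> simp [pfComplexProj])
    (by
      rintro (_ | _ | _ | _ | t) v
      · simp [pfComplexProj, pfComplex]
      · rw [h1, hsingle, h1]; simp [pfComplexProj]
      · simp [pfComplexProj]
      · simp [pfComplexProj, h3]
      · simp [pfComplex])
    (by
      rintro (_ | _ | _ | _ | t) v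
      · simp [pfComplexProj]
      · rw [h1, h2, Matrix.mulVec_smul, mulVec_pfVec hφ, smul_zero]
      · rw [h2, h3, hpφ, Pi.single_zero]
      · simp [pfComplex]
      · simp [pfComplex])
    (isWeaklyRegular_pi rs R hreg)
    (by
      intro r hr i hi z hz hdz
      obtain ⟨N, hN⟩ := hrs r hr
      rw [hlen] at hi
      suffices ∀ s ∈ Ideal.span (Set.range (pfVec φ)), ∃ v, pfComplex φ i₀ i v = s • z from
        ⟨N, this _ hN⟩
      intro s hs
      induction hs using Submodule.span_induction with
      | zero => exact ⟨0, by simp⟩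
      | add a b _ _ ha hb =>
        obtain ⟨u, hu⟩ := ha
        obtain ⟨w, hw⟩ := hb
        exact ⟨u + w, by rw [map_add, hu, hw, add_smul]⟩
      | smul a b _ hb =>
        obtain ⟨u, hu⟩ := hb
        exact ⟨a • u, by rw [map_smul, hu, smul_smul, smul_eq_mul]⟩
      | mem s hs =>
        obtain ⟨l, rfl⟩ := hs
        interval_cases i
        · refine ⟨0, ?_⟩
          rw [h1] at hdz
          rw [hsingle] at hz
          rw [map_zero]
          ext j
          have := congrFun hdz l
          simp only [Pi.smul_apply, smul_eq_mul, Pi.zero_apply] at this ⊢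
          rw [← hz]
          by_cases hj : j = i₀
          · subst hj; rw [Pi.single_eq_same, mul_comm, this]
          · rw [Pi.single_eq_of_ne hj, mul_zero]
        · refine ⟨Pi.single i₀ (z l), ?_⟩
          rw [h1, Pi.single_eq_same]
          rw [h2] at hdz
          ext j
          exact (pfVec_mul_comm_of_mulVec_eq_zero hφ z hdz l j).symm
        · rw [h3] at hdz
          obtain ⟨v, hv⟩ := exists_mulVec_eq_pfVec_smul hφ l z (by simpa using hdz)
          exact ⟨v, hv⟩)
    2 (by omega) c rfl (by rw [h3, hc, Pi.single_zero])
  exact ⟨v, hv⟩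

/-- Relations of the Pfaffians modulo `L` come from the columns of `φ`, up to a factor `r`. -/
def RelationsSpanned (φ : Matrix (Fin n) (Fin n) R) (L : Ideal R) (r : R) : Prop :=
  ∀ z : Fin n → R, pfVec φ ⬝ᵥ z ∈ L → ∃ v w : Fin n → R, (∀ i, w i ∈ L) ∧
    r • z = φ.mulVec v + w

lemma relationsSpanned_of_isWeaklyRegular {φ : Matrix (Fin n) (Fin n) R} (hφ : IsAlternating φ)
    (i₀ : Fin n) {ls ys : List R} (hreg : IsWeaklyRegular R (ls ++ ys)) (hlen : ys.length = 3)
    (hrs : ∀ r ∈ ys, ∃ N, r ^ N ∈ Ideal.span (Set.range (pfVec φ)) ⊔ Ideal.ofList ls) :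
    RelationsSpanned φ (Ideal.ofList ls) 1 := by
  set L := Ideal.ofList ls with hL
  set q := Ideal.Quotient.mk L with hq
  have hreg' : IsWeaklyRegular (R ⧸ L) (ys.map q) := by
    have h1 := ((isWeaklyRegular_append_iff' R ls ys).mp hreg).2
    have e : (Ideal.ofList ls • ⊤ : Submodule R R) = L := by rw [smul_eq_mul, Ideal.mul_top]
    have h2 := ((isWeaklyRegular_append_iff R ls ys).mp hreg).2
    have h3 : IsWeaklyRegular (R ⧸ L) ys :=
      ((Submodule.quotEquivOfEq _ _ e).isWeaklyRegular_congr ys).mp h2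
    exact (isWeaklyRegular_map_algebraMap_iff (R ⧸ L) (R ⧸ L) ys).mpr h3
  have hφ' : IsAlternating (φ.map q) := by
    refine ⟨fun i => by simp [hφ.1 i], fun i j => ?_⟩
    rw [Matrix.map_apply, Matrix.map_apply, hφ.2 i j, map_neg]
  intro z hz
  obtain ⟨v, hv⟩ := exists_mulVec_eq_of_isWeaklyRegular hφ' i₀ hreg' (by simpa using hlen) (by
    intro r hr
    obtain ⟨y, hy, rfl⟩ := List.mem_map.mp hr
    obtain ⟨N, hN⟩ := hrs y hy
    refine ⟨N, ?_⟩
    obtain ⟨a, ha, b, hb, hab⟩ := Submodule.mem_sup.mp hN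
    rw [← map_pow, ← hab, map_add, Ideal.Quotient.eq_zero_iff_mem.mpr hb, add_zero]
    have h1 : Ideal.span (Set.range (pfVec φ)) ≤
        (Ideal.span (Set.range (pfVec (φ.map q)))).comap q := by
      rw [Ideal.span_le]
      rintro _ ⟨i, rfl⟩
      exact Ideal.subset_span ⟨i, pfVec_map q φ i⟩
    exact h1 ha) (fun i => q (z i)) (by
    rw [← Ideal.Quotient.eq_zero_iff_mem] at hz
    rw [← hz]
    simp only [dotProduct, map_sum, map_mul, pfVec_map]
    rfl)
  choose u hu using fun i => Ideal.Quotient.mk_surjective (v i)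
  refine ⟨u, z - φ.mulVec u, fun i => ?_, by rw [one_smul]; abel⟩
  rw [← Ideal.Quotient.eq_zero_iff_mem, Pi.sub_apply, map_sub, sub_eq_zero]
  have := congrFun hv i
  simp only [Matrix.mulVec, dotProduct, Matrix.map_apply] at this
  rw [← this]
  simp only [Matrix.mulVec, dotProduct, map_sum, map_mul]
  exact Finset.sum_congr rfl fun j _ => by rw [← hu j]

lemma RelationsSpanned.descend [IsNoetherianRing R] {φ : Matrix (Fin n) (Fin n) R}
    (hφ : IsAlternating φ) {𝔪 L : Ideal R} {l r : R} (hl : l ∈ 𝔪) (hr : r - 1 ∈ 𝔪)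
    (hreg : ∀ s, l * s ∈ L → s ∈ L) (h : RelationsSpanned φ (L ⊔ Ideal.span {l}) r) :
    ∃ r', r' - 1 ∈ 𝔪 ∧ RelationsSpanned φ L r' := by
  let Z : Submodule R (Fin n → R) := Submodule.comap
    (∑ i, (pfVec φ i) • (LinearMap.proj i : (Fin n → R) →ₗ[R] R)) L
  have hZ : ∀ z, z ∈ Z ↔ pfVec φ ⬝ᵥ z ∈ L := fun z => by
    simp only [Z, Submodule.mem_comap, LinearMap.sum_apply, LinearMap.smul_apply,
      LinearMap.proj_apply, smul_eq_mul, dotProduct]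
  let B : Submodule R (Fin n → R) := LinearMap.range φ.mulVecLin ⊔ Submodule.pi Set.univ fun _ => L
  have hB : ∀ z, z ∈ B ↔ ∃ v w : Fin n → R, (∀ i, w i ∈ L) ∧ z = φ.mulVec v + w := fun z => by
    simp only [B, Submodule.mem_sup, LinearMap.mem_range, Matrix.mulVecLin_apply, Submodule.mem_pi,
      Set.mem_univ, true_implies]
    constructor
    · rintro ⟨_, ⟨v, rfl⟩, w, hw, rfl⟩
      exact ⟨v, w, hw, rfl⟩
    · rintro ⟨v, w, hw, rfl⟩
      exact ⟨_, ⟨v, rfl⟩, w, hw, rfl⟩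
  have hpφ : ∀ v, pfVec φ ⬝ᵥ φ.mulVec v = 0 := by
    intro v
    rw [Matrix.dotProduct_mulVec]
    have : Matrix.vecMul (pfVec φ) φ = 0 := by
      have ht : φ.transpose = -φ := by ext i j; simpa using hφ.2 i j
      rw [← Matrix.mulVec_transpose, ht, Matrix.neg_mulVec, mulVec_pfVec hφ, neg_zero]
    rw [this, zero_dotProduct]
  have key : ∀ z ∈ Z, r • z ∈ B ⊔ 𝔪 • Z := by
    intro z hz
    rw [hZ] at hz
    obtain ⟨v, w, hw, he⟩ := h z (Ideal.mem_sup_left hz)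
    have : ∀ i, ∃ a b, a ∈ L ∧ w i = a + l * b := fun i => by
      obtain ⟨a, ha, b, hb, hab⟩ := Submodule.mem_sup.mp (hw i)
      obtain ⟨c, rfl⟩ := Ideal.mem_span_singleton'.mp hb
      exact ⟨a, c, ha, by rw [← hab, mul_comm]⟩
    choose a b ha hab using this
    have hw' : w = a + l • b := funext hab
    have hb : b ∈ Z := by
      rw [hZ]
      apply hreg
      have h1 : l * pfVec φ ⬝ᵥ b = r * pfVec φ ⬝ᵥ z - pfVec φ ⬝ᵥ a := by
        have := congrArg (fun t => pfVec φ ⬝ᵥ t) he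
        simp only [hw', dotProduct_add, dotProduct_smul, smul_eq_mul, hpφ] at this
        rw [this]; ring
      rw [h1]
      exact sub_mem (Ideal.mul_mem_left _ _ hz) (Ideal.sum_mem _ fun i _ =>
        Ideal.mul_mem_left _ _ (ha i))
    rw [he, hw', ← add_assoc]
    exact add_mem (Submodule.mem_sup_left ((hB _).mpr ⟨v, a, ha, rfl⟩))
      (Submodule.mem_sup_right (Submodule.smul_mem_smul hl hb))
  have key2 : Z ≤ B ⊔ 𝔪 • Z := by
    intro z hz
    have h1 := sub_mem (key z hz) (Submodule.mem_sup_right (Submodule.smul_mem_smul hr hz))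
    rwa [← sub_smul, sub_sub_cancel, one_smul] at h1
  have key3 : Z.map B.mkQ ≤ 𝔪 • Z.map B.mkQ := by
    rw [← Submodule.map_smul'']
    refine (Submodule.map_mono key2).trans ?_
    rw [Submodule.map_sup]
    simp
  obtain ⟨r', h1, h2⟩ := Submodule.exists_sub_one_mem_and_smul_eq_zero_of_fg_of_le_smul 𝔪 _
    ((IsNoetherian.noetherian Z).map _) key3
  refine ⟨r', h1, fun z hz => ?_⟩
  have h3 := h2 _ (Submodule.mem_map_of_mem ((hZ z).mpr hz))
  rw [← map_smul, Submodule.mkQ_apply, Submodule.Quotient.mk_eq_zero] at h3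
  exact (hB _).mp h3

lemma exists_relationsSpanned_bot [IsNoetherianRing R] {φ : Matrix (Fin n) (Fin n) R}
    (hφ : IsAlternating φ) (i₀ : Fin n) {𝔪 : Ideal R} {ls ys : List R}
    (hls : ∀ l ∈ ls, l ∈ 𝔪)
    (hreg : IsWeaklyRegular R (ls ++ ys)) (hlen : ys.length = 3)
    (hrs : ∀ r ∈ ys, ∃ N, r ^ N ∈ Ideal.span (Set.range (pfVec φ)) ⊔ Ideal.ofList ls) :
    ∃ r, r - 1 ∈ 𝔪 ∧ RelationsSpanned φ ⊥ r := by
  have h0 := relationsSpanned_of_isWeaklyRegular hφ i₀ hreg hlen hrs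
  have hls_reg := ((isWeaklyRegular_append_iff R ls ys).mp hreg).1
  suffices ∀ e ≤ ls.length,
      ∃ r, r - 1 ∈ 𝔪 ∧ RelationsSpanned φ (Ideal.ofList (ls.take (ls.length - e))) r by
    obtain ⟨r, hr, h1⟩ := this ls.length le_rfl
    rw [Nat.sub_self, List.take_zero, Ideal.ofList_nil] at h1
    exact ⟨r, hr, h1⟩
  intro e
  induction e with
  | zero =>
    intro _
    refine ⟨1, by simp, ?_⟩
    rwa [Nat.sub_zero, List.take_length]
  | succ e ih =>
    intro he
    obtain ⟨r, hr, h1⟩ := ih (by omega)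
    have hlt : ls.length - (e + 1) < ls.length := by omega
    rw [show ls.length - e = ls.length - (e + 1) + 1 by omega, List.take_add_one,
      List.getElem?_eq_getElem hlt, Option.toList_some, Ideal.ofList_append,
      Ideal.ofList_singleton] at h1
    refine h1.descend hφ (hls _ (List.getElem_mem hlt)) hr fun s hs => ?_
    have h2 := hls_reg.regular_mod_prev _ hlt
    rw [isSMulRegular_iff_right_eq_zero_of_smul] at h2
    have h3 := h2 (Submodule.Quotient.mk s)
    rw [← Submodule.Quotient.mk_smul, Submodule.Quotient.mk_eq_zero,
      Submodule.Quotient.mk_eq_zero, smul_eq_mul, smul_eq_mul, Ideal.mul_top] at h3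
    exact h3 hs

end Syzygy

section LinearSection
variable {k R : Type} [Field k] [CommRing R] [Algebra k R] {𝒜 : ℤ → AddSubgroup R}
  [GradedRing 𝒜] {d n : ℕ} {x : Fin d → R}

/-- The linear form with coefficients `c`. -/
def linForm (x : Fin d → R) (c : Fin d → k) : R := ∑ a, c a • x a

lemma linForm_mem (h : StdGraded k 𝒜 x) (c : Fin d → k) : linForm x c ∈ 𝒜 1 :=
  sum_mem fun a _ => h.smul_mem _ (h.mem_one a)

lemma linForm_mem_span (c : Fin d → k) : linForm x c ∈ Ideal.span (Set.range x) :=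
  Ideal.sum_mem _ fun a _ => by
    rw [Algebra.smul_def]; exact Ideal.mul_mem_left _ _ (Ideal.subset_span ⟨a, rfl⟩)

/-- The coefficient vectors of the linear forms in an ideal. -/
def linFormComap (k : Type) [Field k] [Algebra k R] (x : Fin d → R) (Q : Ideal R) :
    Submodule k (Fin d → k) where
  carrier := {c | linForm x c ∈ Q}
  zero_mem' := by
    change linForm x 0 ∈ Q
    simp [linForm]
  add_mem' {a b} ha hb := by
    have := Q.add_mem ha hb
    change linForm x (a + b) ∈ Q
    simpa [linForm, add_smul, Finset.sum_add_distrib] using this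
  smul_mem' c a ha := by
    have := Q.mul_mem_left (algebraMap k R c) ha
    change linForm x (c • a) ∈ Q
    simpa [linForm, mul_smul, ← Finset.smul_sum, ← Algebra.smul_def] using this

lemma mem_linFormComap {Q : Ideal R} {c : Fin d → k} : c ∈ linFormComap k x Q ↔ linForm x c ∈ Q :=
  Iff.rfl

lemma linFormComap_ne_top (h : StdGraded k 𝒜 x) {Q : Ideal R} (hQ : Q.IsHomogeneous 𝒜)
    (hQt : Q ≠ ⊤) (hne : Q ≠ Ideal.span (Set.range x)) : linFormComap k x Q ≠ ⊤ := by
  intro ht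
  refine hne (le_antisymm (h.le_span_of_isHomogeneous hQ hQt) ?_)
  rw [Ideal.span_le]
  rintro _ ⟨a, rfl⟩
  have : (Pi.single a 1 : Fin d → k) ∈ linFormComap k x Q := by rw [ht]; trivial
  rw [mem_linFormComap, linForm, Finset.sum_eq_single a] at this
  · simpa using this
  · intro b _ hb; simp [hb]
  · simp

/-- The ideal obtained from `I` by adjoining the first `r` linear forms. -/
def adjoinForms (I : Ideal R) (x : Fin d → R) (c : ℕ → Fin d → k) (r : ℕ) : Ideal R :=
  I ⊔ Ideal.span (Set.range fun i : Fin r => linForm x (c i))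

lemma isHomogeneous_adjoinForms (h : StdGraded k 𝒜 x) {I : Ideal R} (hI : I.IsHomogeneous 𝒜)
    (c : ℕ → Fin d → k) (r : ℕ) : (adjoinForms I x c r).IsHomogeneous 𝒜 := by
  refine hI.sup (Ideal.homogeneous_span 𝒜 _ ?_)
  rintro _ ⟨i, rfl⟩
  exact ⟨1, linForm_mem h _⟩

open scoped Classical in
lemma StdGraded.exists_linForms (h : StdGraded k 𝒜 x) [Infinite k] {I : Ideal R}
    (hI : I.IsHomogeneous 𝒜) {e : ℕ} (he : (e : ℕ∞) ≤ idealHeight I) (r : ℕ) (hr : r ≤ d) :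
    ∃ c : ℕ → Fin d → k, ∀ s ≤ r, LinearIndependent k (fun i : Fin s => c i) ∧
      ∀ Q ∈ (adjoinForms I x c s).minimalPrimes,
        Q = Ideal.span (Set.range x) ∨ ((e + s : ℕ) : ℕ∞) ≤ Q.height := by
  have := h.isNoetherianRing
  induction r with
  | zero =>
    refine ⟨0, fun s hs => ?_⟩
    obtain rfl : s = 0 := by omega
    refine ⟨linearIndependent_empty_type, fun Q hQ => Or.inr ?_⟩
    have := hQ.1.1
    exact he.trans (idealHeight_le (le_sup_left.trans hQ.1.2))
  | succ r ih =>
    obtain ⟨c, hc⟩ := ih (by omega)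
    obtain ⟨hli, hmin⟩ := hc r le_rfl
    have hhom := isHomogeneous_adjoinForms h hI c r
    have hfin := (adjoinForms I x c r).finite_minimalPrimes_of_isNoetherianRing R
    have hspan : Submodule.span k (Set.range fun i : Fin r => c i) ≠ ⊤ := by
      intro ht
      have h1 := finrank_range_le_card (R := k) (fun i : Fin r => c i)
      rw [Set.finrank, ht, finrank_top] at h1
      simp at h1
      omega
    have h2 := Subspace.biUnion_ne_univ_of_top_notMem (k := k) (E := Fin d → k)
      (s := insert (Submodule.span k (Set.range fun i : Fin r => c i))
        ((hfin.toFinset.filter (· ≠ Ideal.span (Set.range x))).image (linFormComap k x))) (by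
        simp only [Finset.mem_insert, Finset.mem_image, Finset.mem_filter, Set.Finite.mem_toFinset,
          not_or, not_exists, not_and]
        refine ⟨hspan.symm, fun Q hQ => ?_⟩
        exact linFormComap_ne_top h (isHomogeneous_of_mem_minimalPrimes hhom hQ.1)
          hQ.1.1.1.ne_top hQ.2)
    obtain ⟨v, hv⟩ := (Set.ne_univ_iff_exists_notMem _).mp h2
    simp only [Set.mem_iUnion, SetLike.mem_coe, not_exists, Finset.mem_insert, Finset.mem_image,
      Finset.mem_filter, Set.Finite.mem_toFinset, exists_prop, not_and] at hv
    have hvspan := hv _ (Or.inl rfl)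
    have hvQ : ∀ Q ∈ (adjoinForms I x c r).minimalPrimes, Q ≠ Ideal.span (Set.range x) →
        linForm x v ∉ Q := fun Q hQ hne => hv _ (Or.inr ⟨Q, ⟨hQ, hne⟩, rfl⟩)
    refine ⟨Function.update c r v, fun s hs => ?_⟩
    have hupd : ∀ s ≤ r, (fun i : Fin s => Function.update c r v i) = fun i : Fin s => c i := by
      intro s hs
      ext1 i
      rw [Function.update_of_ne (by omega)]
    rcases Nat.lt_or_ge s (r + 1) with hs' | hs'
    · have h3 : adjoinForms I x (Function.update c r v) s = adjoinForms I x c s := by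
        unfold adjoinForms
        congr 3
        ext1 i
        rw [Function.update_of_ne (by omega)]
      rw [hupd s (by omega), h3]
      exact hc s (by omega)
    · obtain rfl : s = r + 1 := by omega
      constructor
      · have : (fun i : Fin (r + 1) => Function.update c r v i) =
            Fin.snoc (α := fun _ => Fin d → k) (fun i : Fin r => c i) v := by
          ext1 i
          refine Fin.lastCases ?_ (fun j => ?_) i
          · simp
          · simp only [Fin.snoc_castSucc, Fin.val_castSucc]
            rw [Function.update_of_ne (by omega)]
        rw [this, linearIndependent_finSnoc]
        exact ⟨hli, hvspan⟩
      · intro Q hQ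
        by_cases hne : Q = Ideal.span (Set.range x)
        · exact Or.inl hne
        right
        have hQp := hQ.1.1
        have hQhom := isHomogeneous_of_mem_minimalPrimes
          (isHomogeneous_adjoinForms h hI (Function.update c r v) (r + 1)) hQ
        have hle : adjoinForms I x c r ≤ Q := by
          refine le_trans ?_ hQ.1.2
          refine sup_le_sup_left (Ideal.span_mono ?_) _
          rintro _ ⟨i, rfl⟩
          refine ⟨i.castSucc, ?_⟩
          simp only [Fin.val_castSucc]
          rw [Function.update_of_ne (by omega)]
        have hvQ' : linForm x v ∈ Q := by
          refine hQ.1.2 (Ideal.mem_sup_right (Ideal.subset_span ⟨Fin.last r, ?_⟩))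
          simp
        obtain ⟨Q', hQ', hQ'le⟩ := Ideal.exists_minimalPrimes_le hle
        have hQ'p := hQ'.1.1
        have hne' : Q' ≠ Ideal.span (Set.range x) := by
          rintro rfl
          exact hne (le_antisymm (h.le_span_of_isHomogeneous hQhom hQp.ne_top) hQ'le)
        have hlt : Q' < Q := lt_of_le_of_ne hQ'le fun he => hvQ Q' hQ' hne' (he ▸ hvQ')
        have h4 := (hmin Q' hQ').resolve_left hne'
        have h5 := Ideal.height_strict_mono_of_isPrime_of_isPrime hlt
        have h6 := h4.trans_lt h5
        have h7 := Order.add_one_le_of_lt h6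
        exact_mod_cast h7

/-- The linear relations among the submaximal Pfaffians are generated by `φ`. -/
theorem StdGraded.exists_mulVec_eq (h : StdGraded k 𝒜 x) [Infinite k]
    {φ : Matrix (Fin n) (Fin n) R} (halt : IsAlternating φ) (hlin : ∀ i j, φ i j ∈ 𝒜 1)
    (hn : Odd n) (hd : 3 ≤ d) (hht : 3 ≤ idealHeight (pfaffianIdeal n (n - 1) φ))
    {c : Fin n → R} (hc : pfVec φ ⬝ᵥ c = 0) : ∃ v, φ.mulVec v = c := by
  have := h.isNoetherianRing
  obtain ⟨e, rfl⟩ : ∃ e, d = e + 3 := ⟨d - 3, by omega⟩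
  rw [pfaffianIdeal_eq_span_pfVec hn.pos] at hht
  have hI : (Ideal.span (Set.range (pfVec φ))).IsHomogeneous 𝒜 := by
    refine Ideal.homogeneous_span 𝒜 _ ?_
    rintro _ ⟨i, rfl⟩
    exact ⟨_, pfVec_mem hlin hn i⟩
  obtain ⟨b, hb⟩ := h.exists_linForms hI (e := 3) hht (e + 3) le_rfl
  have hbasis : StdGraded k 𝒜 (fun i : Fin (e + 3) => linForm x (b i)) := by
    refine h.of_linearIndependent (fun i => linForm_mem h _) ?_
    have h1 := (hb _ le_rfl).1
    have h2 := h1.map' (Fintype.linearCombination k x) (by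
      rw [LinearMap.ker_eq_bot]
      exact h.linearIndependent.fintypeLinearCombination_injective)
    exact h2
  have hreg := hbasis.isWeaklyRegular
  rw [List.ofFn_add] at hreg
  obtain ⟨r, hr, hcl⟩ := exists_relationsSpanned_bot halt ⟨0, hn.pos⟩
    (𝔪 := Ideal.span (Set.range x))
    (by
      intro l hl
      obtain ⟨i, rfl⟩ := (List.mem_ofFn' _ _).mp hl
      exact linForm_mem_span _) hreg (by simp) (by
      intro y hy
      obtain ⟨i, rfl⟩ := (List.mem_ofFn' _ _).mp hy
      set J := adjoinForms (Ideal.span (Set.range (pfVec φ))) x b e with hJ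
      have hJe : J ≤ Ideal.span (Set.range (pfVec φ)) ⊔ Ideal.ofList
          (List.ofFn fun i : Fin e => linForm x (b (i.castLE (Nat.le_add_right e 3)))) := by
        refine sup_le_sup_left (Ideal.span_mono ?_) _
        rintro _ ⟨i, rfl⟩
        exact (List.mem_ofFn' _ _).mpr ⟨i, rfl⟩
      suffices linForm x (b (Fin.natAdd e i)) ∈ J.radical by
        obtain ⟨N, hN⟩ := this
        exact ⟨N, hJe hN⟩
      rw [← Ideal.sInf_minimalPrimes, Ideal.mem_sInf]
      intro Q hQ
      have hQp := hQ.1.1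
      have : Q = Ideal.span (Set.range x) := by
        rcases (hb e (by omega)).2 Q hQ with h1 | h1
        · exact h1
        · exact h.eq_span_of_le_height (isHomogeneous_of_mem_minimalPrimes
            (isHomogeneous_adjoinForms h hI b e) hQ) (by rwa [add_comm])
      rw [this]
      exact linForm_mem_span _)
  classical
  have hr0 : (DirectSum.decompose 𝒜 r 0 : R) = 1 := by
    have hm : Ideal.IsHomogeneous 𝒜 (Ideal.span (Set.range x)) := by
      refine Ideal.homogeneous_span 𝒜 _ ?_
      rintro _ ⟨i, rfl⟩
      exact ⟨1, h.mem_one i⟩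
    have h1 := hm 0 hr
    rw [DirectSum.decompose_sub, DirectSum.sub_apply, AddSubgroup.coe_sub,
      DirectSum.decompose_of_mem_same 𝒜 (SetLike.GradedOne.one_mem)] at h1
    by_contra hne
    obtain ⟨u, hu⟩ := h.mem_zero_iff _ |>.mp (sub_mem (DirectSum.decompose 𝒜 r 0).2
      (SetLike.GradedOne.one_mem (A := 𝒜)))
    have hu0 : u ≠ 0 := by
      rintro rfl
      rw [map_zero, eq_comm, sub_eq_zero] at hu
      exact hne hu
    refine h.isPrime_span.ne_top (Ideal.eq_top_of_isUnit_mem _ h1 ?_)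
    rw [← hu]
    exact (IsUnit.mk0 u hu0).map _
  have hcomp : ∀ z : ℤ, ∃ v, φ.mulVec v = fun i => (DirectSum.decompose 𝒜 (c i) z : R) := by
    intro z
    have hz : pfVec φ ⬝ᵥ (fun i => (DirectSum.decompose 𝒜 (c i) z : R)) = 0 := by
      have h1 := congrArg (fun t => (DirectSum.decompose 𝒜 t (((n / 2 : ℕ) : ℤ) + z) : R)) hc
      simp only [dotProduct, ← GradedRing.proj_apply, map_sum, map_zero] at h1
      rw [dotProduct, ← h1]
      refine Finset.sum_congr rfl fun i _ => ?_
      rw [GradedRing.proj_apply,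
        DirectSum.coe_decompose_mul_add_of_left_mem 𝒜 (pfVec_mem hlin hn i)]
    obtain ⟨v, w, hw, he⟩ := hcl _ (by rw [hz]; exact zero_mem _)
    refine ⟨fun j => (DirectSum.decompose 𝒜 (v j) (z - 1) : R), ?_⟩
    ext i
    have h1 := congrArg (fun t => (DirectSum.decompose 𝒜 t (0 + z) : R)) (congrFun he i)
    simp only [Pi.smul_apply, Pi.add_apply, (Ideal.mem_bot).mp (hw i), add_zero, smul_eq_mul,
      Matrix.mulVec, dotProduct, ← GradedRing.proj_apply, map_sum] at h1
    rw [GradedRing.proj_apply, GradedRing.proj_apply,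
      DirectSum.coe_decompose_mul_add_of_right_mem 𝒜 (SetLike.coe_mem _), hr0, one_mul] at h1
    rw [h1, Matrix.mulVec, dotProduct]
    refine Finset.sum_congr rfl fun j _ => ?_
    rw [GradedRing.proj_apply, show (0 : ℤ) + z = 1 + (z - 1) by ring,
      DirectSum.coe_decompose_mul_add_of_left_mem 𝒜 (hlin i j)]
  choose v hv using hcomp
  set T : Finset ℤ := Finset.univ.biUnion fun i => (DirectSum.decompose 𝒜 (c i)).support with hT
  refine ⟨∑ z ∈ T, v z, ?_⟩
  rw [Matrix.mulVec_sum]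
  ext i
  simp only [hv, Finset.sum_apply]
  conv_rhs => rw [← DirectSum.sum_support_decompose 𝒜 (c i)]
  symm
  refine Finset.sum_subset (Finset.subset_biUnion_of_mem (fun i =>
    (DirectSum.decompose 𝒜 (c i)).support) (Finset.mem_univ i)) fun z _ hz => ?_
  simpa using hz

end LinearSection

section SymmetricStrands

variable {A ι : Type} [CommRing A] {N : ℕ}
  {o : ι → Ext A N →ₗ[A] Ext A N}

lemma opList_degE (ho : ∀ i b f, o i (degE A (b + 1) f) = degE A b (o i f)) (l : List ι) (b : ℕ)
    (f : Ext A N) : opList o l (degE A (l.length + b) f) = degE A b (opList o l f) := by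
  induction l generalizing b with
  | nil => simp [opList]
  | cons i l ih =>
    simp only [opList, LinearMap.comp_apply, List.length_cons]
    rw [show l.length + 1 + b = l.length + (b + 1) by ring, ih, ho]

lemma opList_anticomm (h : ∀ i j f, o i (o j f) + o j (o i f) = 0)
    (i : ι) (l : List ι) (f : Ext A N) :
    opList o l (o i f) = (-1 : A) ^ l.length • o i (opList o l f) := by
  induction l with
  | nil => simp [opList]
  | cons j l ih =>
    simp only [opList, LinearMap.comp_apply, List.length_cons, ih, map_smul, pow_succ]
    rw [eq_neg_of_add_eq_zero_left (h j i _), smul_neg, mul_neg_one, neg_smul]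

lemma apply_opList_of_mem (h0 : ∀ i f, o i (o i f) = 0)
    (h : ∀ i j f, o i (o j f) + o j (o i f) = 0) {i : ι} {l : List ι} (hi : i ∈ l) (f : Ext A N) :
    o i (opList o l f) = 0 := by
  induction l with
  | nil => simp at hi
  | cons j l ih =>
    simp only [opList, LinearMap.comp_apply]
    rcases List.mem_cons.mp hi with rfl | hi
    · exact h0 _ _
    · rw [eq_neg_of_add_eq_zero_left (h i j _), ih hi, map_zero, neg_zero]

lemma opList_apply_of_mem (h0 : ∀ i f, o i (o i f) = 0)
    (h : ∀ i j f, o i (o j f) + o j (o i f) = 0) {i : ι} {l : List ι} (hi : i ∈ l) (f : Ext A N) :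
    opList o l (o i f) = 0 := by
  rw [opList_anticomm h, apply_opList_of_mem h0 h hi, smul_zero]

variable [Fintype ι]

/-- The map splicing the divided power strand to the symmetric strand. -/
def spliceMap (o : ι → Ext A N →ₗ[A] Ext A N) :
    ((ι → ℕ) → Ext A N) →ₗ[A] ((ι → ℕ) → Ext A N) where
  toFun f μ := if μ = 0 then opList o Finset.univ.toList (f 0) else 0
  map_add' f g := by ext1 μ; by_cases h : μ = 0 <;> simp [h]
  map_smul' a f := by ext1 μ; by_cases h : μ = 0 <;> simp [h]

lemma spliceMap_apply (f : (ι → ℕ) → Ext A N) (μ) :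
    spliceMap o f μ = if μ = 0 then opList o Finset.univ.toList (f 0) else 0 := rfl

lemma sum_eq_zero_iff_eq_zero (μ : ι → ℕ) : ∑ i, μ i = 0 ↔ μ = 0 := by
  simp [funext_iff]

lemma spliceMap_biE (ho : ∀ i b f, o i (degE A (b + 1) f) = degE A b (o i f)) (b : ℕ)
    (f : (ι → ℕ) → Ext A N) :
    spliceMap o (biE A ι 0 (Fintype.card ι + b) f) = biE A ι 0 b (spliceMap o f) := by
  ext1 μ
  simp only [spliceMap_apply, biE_apply, sum_eq_zero_iff_eq_zero, if_true]
  split_ifs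
  · have := opList_degE ho Finset.univ.toList b (f 0)
    simpa using this
  · rfl

variable [DecidableEq ι]

lemma spliceMap_dDiv (h0 : ∀ i f, o i (o i f) = 0)
    (h : ∀ i j f, o i (o j f) + o j (o i f) = 0) (f : (ι → ℕ) → Ext A N) :
    spliceMap o (dDiv o f) = 0 := by
  ext1 μ
  simp only [spliceMap_apply, dDiv_apply, map_sum]
  split_ifs
  · exact Finset.sum_eq_zero fun i _ => opList_apply_of_mem h0 h (by simp) _
  · rfl

lemma dSym_spliceMap (h0 : ∀ i f, o i (o i f) = 0)
    (h : ∀ i j f, o i (o j f) + o j (o i f) = 0) (f : (ι → ℕ) → Ext A N) :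
    dSym o (spliceMap o f) = 0 := by
  ext1 μ
  simp only [spliceMap_apply, dSym_apply]
  refine Finset.sum_eq_zero fun i _ => ?_
  split_ifs
  · rfl
  · exact apply_opList_of_mem h0 h (by simp) _
  · exact map_zero _

/-- Exactness at quadratic coefficients of the symmetric complex of degree-lowering operators,
given enough partners. -/
theorem dSym_strand_exact (h0 : ∀ i f, o i (o i f) = 0)
    (h : ∀ i j f, o i (o j f) + o j (o i f) = 0)
    (ho : ∀ i b f, o i (degE A (b + 1) f) = degE A b (o i f)) (rs : List A)
    (hreg : IsWeaklyRegular A rs)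
    (hpart : ∀ r ∈ rs, ∃ (K : ℕ) (e : ι → Ext A N →ₗ[A] Ext A N),
      ∀ i j f, o j (e i f) + e i (o j f) = if i = j then r ^ K • f else 0)
    {q b : ℕ} (hq : rs.length = q + 3) (hb : 1 ≤ b) (hN : N < Fintype.card ι + b + q + 2)
    (z : (ι → ℕ) → Ext A N)
    (hz : biE A ι 2 b z = z) (hdz : dSym o z = 0) :
    ∃ w, biE A ι 1 (b + 1) w = w ∧ dSym o w = z := by
  set n := Fintype.card ι with hn
  set D : ℕ → ((ι → ℕ) → Ext A N) →ₗ[A] ((ι → ℕ) → Ext A N) :=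
    fun t => if t < q then dDiv o else if t = q then spliceMap o
      else if t < q + 4 then dSym o else 0 with hD
  set π : ℕ → ((ι → ℕ) → Ext A N) →ₗ[A] ((ι → ℕ) → Ext A N) :=
    fun t => if t ≤ q then biE A ι (q - t) (n + (b + 2) + (q - t)) else
      if t < q + 5 then biE A ι (t - q - 1) (b + 2 + q + 1 - t) else 0 with hπ
  have hDlt : ∀ t, t < q → D t = dDiv o := fun t ht => by simp only [hD, if_pos ht]
  have hDq : D q = spliceMap o := by simp [hD]
  have hDgt : ∀ t, q < t → t < q + 4 → D t = dSym o := fun t ht ht' => by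
    simp only [hD]
    rw [if_neg (by omega), if_neg (by omega), if_pos ht']
  have hDgt' : ∀ t, q + 4 ≤ t → D t = 0 := fun t ht => by
    simp only [hD]
    rw [if_neg (by omega), if_neg (by omega), if_neg (by omega)]
  have hπle : ∀ c t, t + c = q → π t = biE A ι c (n + (b + 2) + c) := fun c t ht => by
    simp only [hπ]
    rw [if_pos (by omega), show q - t = c by omega]
  have hπgt : ∀ a, a < 4 → π (q + 1 + a) = biE A ι a (b + 2 - a) := fun a ha => by
    simp only [hπ]
    rw [if_neg (by omega), if_pos (by omega), show q + 1 + a - q - 1 = a by omega,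
      show b + 2 + q + 1 - (q + 1 + a) = b + 2 - a by omega]
  have hπgt' : ∀ t, q + 5 ≤ t → π t = 0 := fun t ht => by
    simp only [hπ]
    rw [if_neg (by omega), if_neg (by omega)]
  have key := acyclicity rs _ D π
    (by
      rw [hπle q 0 (by omega)]
      exact biE_eq_zero (by omega))
    (by
      intro t x
      simp only [hπ]
      split_ifs
      · exact biE_biE _ _ _
      · exact biE_biE _ _ _
      · simp)
    (by
      intro t x
      rcases lt_trichotomy t q with hlt | rfl | hlt
      · obtain ⟨c, hc⟩ : ∃ c, t + (c + 1) = q := ⟨q - t - 1, by omega⟩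
        rw [hDlt t hlt, hπle _ _ hc, hπle c (t + 1) (by omega)]
        exact dDiv_biE (fun i f => ho i _ f) c x
      · rw [hDq, hπle 0 t (by omega), hπgt 0 (by omega)]
        exact spliceMap_biE ho _ _
      · by_cases h4 : t < q + 4
        · obtain ⟨a, rfl⟩ : ∃ a, t = q + 1 + a := ⟨t - q - 1, by omega⟩
          rw [hDgt _ hlt h4, hπgt a (by omega), add_assoc, hπgt (a + 1) (by omega)]
          rw [show b + 2 - a = b + 2 - (a + 1) + 1 by omega]
          exact dSym_biE (fun i f => ho i _ f) a x
        · rw [hDgt' t (by omega)]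
          simp)
    (by
      intro t x
      rcases lt_trichotomy (t + 1) q with hlt | hq' | hlt
      · rw [hDlt _ hlt, hDlt t (by omega)]
        exact dDiv_dDiv h0 h _
      · rw [hq', hDq, hDlt t (by omega)]
        exact spliceMap_dDiv h0 h _
      · by_cases h4 : t + 1 < q + 4
        · rw [hDgt _ hlt h4]
          rcases (show t = q ∨ q < t by omega) with rfl | hlt'
          · rw [hDq]
            exact dSym_spliceMap h0 h _
          · rw [hDgt t hlt' (by omega)]
            exact dSym_dSym h0 h _
        · rw [hDgt' _ (by omega), LinearMap.zero_apply])
    (isWeaklyRegular_pi rs _ (isWeaklyRegular_pi rs A hreg))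
    (by
      intro r hr i hi y hy hdy
      obtain ⟨K, e, he⟩ := hpart r hr
      have hnd : (Finset.univ : Finset ι).toList.Nodup := Finset.nodup_toList _
      have hlen : (Finset.univ : Finset ι).toList.length = n := by simp [hn]
      rcases lt_trichotomy (i + 1) q with hlt | hq' | hlt
      · obtain ⟨c, hc⟩ : ∃ c, i + 1 + c = q := ⟨q - i - 1, by omega⟩
        rw [hDlt _ hlt] at hdy
        rw [hπle c _ hc] at hy
        obtain ⟨w, hw⟩ := dDiv_exact h0 h he y hdy
          (by rw [← hy]; exact biE_apply_zero (by omega) _)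
        exact ⟨K * n, w, by rw [hDlt i (by omega), hw, pow_mul]⟩
      · rw [hq', hDq] at hdy
        rw [hπle 0 _ (by omega)] at hy
        have h1 := congrFun hdy 0
        rw [spliceMap_apply, if_pos rfl] at h1
        obtain ⟨w, hw⟩ := exists_sum_eq_of_opList_eq_zero h he _ hnd _ h1
        refine ⟨K * n, fun μ => if ∑ i, μ i = 1 then ∑ i, μ i • w i else 0, ?_⟩
        rw [hDlt i (by omega)]
        ext1 μ
        simp only [dDiv_apply, sum_add_single, add_eq_right, sum_eq_zero_iff_eq_zero]
        by_cases hμ : μ = 0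
        · subst hμ
          rw [Pi.smul_apply, pow_mul, ← hlen, ← hw]
          refine Finset.sum_congr rfl fun j _ => ?_
          simp [Pi.single_apply]
        · simp only [if_neg hμ, map_zero, Finset.sum_const_zero]
          rw [← hy, Pi.smul_apply, biE_apply, if_neg (by rwa [sum_eq_zero_iff_eq_zero]), smul_zero]
      · rw [hDgt _ hlt (by omega)] at hdy
        rcases (show i = q ∨ q < i by omega) with rfl | hlt'
        · rw [show i + 1 = i + 1 + 0 by rfl, hπgt 0 (by omega)] at hy
          have hy0 : ∀ μ, μ ≠ 0 → y μ = 0 := fun μ hμ => by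
            rw [← hy, biE_apply, if_neg (by rwa [sum_eq_zero_iff_eq_zero])]
          have h1 : ∀ j, o j (y 0) = 0 := by
            intro j
            have := congrFun hdy (Pi.single j 1)
            rw [dSym_apply, Finset.sum_eq_single j] at this
            · simpa using this
            · intro j' _ hj'
              simp [hj']
            · simp
          obtain ⟨w, hw, -⟩ := exists_opList_eq he _ hnd _ h1
          refine ⟨K * n, fun μ => if μ = 0 then w else 0, ?_⟩
          rw [hDq]
          ext1 μ
          rw [spliceMap_apply, if_pos rfl, Pi.smul_apply]
          by_cases hμ : μ = 0
          · rw [if_pos hμ, hμ, hw, hlen, pow_mul]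
          · rw [if_neg hμ, hy0 μ hμ, smul_zero]
        · obtain ⟨a, rfl⟩ : ∃ a, i = q + 1 + a := ⟨i - q - 1, by omega⟩
          rw [add_assoc, hπgt (a + 1) (by omega)] at hy
          obtain ⟨w, hw⟩ := dSym_exact h0 h he y hdy
            (by rw [← hy]; exact biE_apply_zero (by omega) _)
          exact ⟨K * n, w, by rw [hDgt _ hlt' (by omega), hw, pow_mul]⟩)
  obtain ⟨w, hw, hw'⟩ := key (q + 2) (by omega) z (by
      rw [show q + 2 + 1 = q + 1 + 2 by ring, hπgt 2 (by omega)]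
      exact hz) (by rw [hDgt _ (by omega) (by omega)]; exact hdz)
  rw [show q + 2 = q + 1 + 1 by ring, hπgt 1 (by omega)] at hw
  rw [hDgt _ (by omega) (by omega)] at hw'
  exact ⟨w, hw, hw'⟩

end SymmetricStrands

section Lifting

variable {A : Type} [CommRing A] {N n : ℕ}

/-- The elements with no components of exterior degree less than `b`. -/
def extFil (A : Type) [CommRing A] (N b : ℕ) : Submodule A (Ext A N) where
  carrier := {f | ∀ S, S.card < b → f S = 0}
  zero_mem' := fun _ _ => rfl
  add_mem' := fun hf hg S hS => by rw [Pi.add_apply, hf S hS, hg S hS, add_zero]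
  smul_mem' := fun a f hf S hS => by rw [Pi.smul_apply, hf S hS, smul_zero]

lemma extFil_anti {b b' : ℕ} (h : b ≤ b') : extFil A N b' ≤ extFil A N b :=
  fun _ hf S hS => hf S (hS.trans_le h)

lemma wedgeE_mem_extFil {b : ℕ} (i : Fin N) {f : Ext A N} (hf : f ∈ extFil A N b) :
    wedgeE A i f ∈ extFil A N (b + 1) := by
  intro S hS
  rw [wedgeE_apply]
  split_ifs with h
  · rw [hf _ (by rw [Finset.card_erase_of_mem h]; have := Finset.card_pos.mpr ⟨i, h⟩; omega),
      mul_zero]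
  · rfl

lemma contrE_mem_extFil {b : ℕ} (i : Fin N) {f : Ext A N} (hf : f ∈ extFil A N (b + 1)) :
    contrE A i f ∈ extFil A N b := by
  intro S hS
  rw [contrE_apply]
  split_ifs with h
  · rfl
  · rw [hf _ (by rw [Finset.card_insert_of_notMem h]; omega), mul_zero]

lemma contrV_mem_extFil {b : ℕ} (v : Fin N → A) {f : Ext A N} (hf : f ∈ extFil A N (b + 1)) :
    contrV v f ∈ extFil A N b := by
  rw [contrV_apply]
  exact sum_mem fun i _ => Submodule.smul_mem _ _ (contrE_mem_extFil i hf)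

/-- Contraction by the rows of `ψ`, deformed by exterior multiplication. -/
def twistOp (ψ : Fin n → Fin N → A) (γ : Fin n → Fin N) (i : Fin n) : Ext A N →ₗ[A] Ext A N :=
  contrV (ψ i) + wedgeE A (γ i)

variable {ψ : Fin n → Fin N → A} {γ : Fin n → Fin N}

lemma twistOp_apply (i : Fin n) (f : Ext A N) :
    twistOp ψ γ i f = contrV (ψ i) f + wedgeE A (γ i) f := rfl

lemma wedgeV_single (i : Fin N) (f : Ext A N) : wedgeV (Pi.single i 1) f = wedgeE A i f := by
  rw [wedgeV_apply, Finset.sum_eq_single i]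
  · simp
  · intro j _ hj; simp [hj]
  · simp

lemma contrV_single (i : Fin N) (f : Ext A N) : contrV (Pi.single i 1) f = contrE A i f := by
  rw [contrV_apply, Finset.sum_eq_single i]
  · simp
  · intro j _ hj; simp [hj]
  · simp

lemma wedgeE_contrV (i : Fin N) (v : Fin N → A) (f : Ext A N) :
    wedgeE A i (contrV v f) + contrV v (wedgeE A i f) = v i • f := by
  have := wedgeV_contrV (Pi.single i 1) v f
  simpa [wedgeV_single] using this

lemma twistOp_anticomm (hψ : ∀ i j, ψ i (γ j) + ψ j (γ i) = 0) (i j : Fin n) (f : Ext A N) :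
    twistOp ψ γ i (twistOp ψ γ j f) + twistOp ψ γ j (twistOp ψ γ i f) = 0 := by
  simp only [twistOp_apply, map_add]
  have h1 := contrV_anticomm (ψ i) (ψ j) f
  have h2 := wedgeE_anticomm (γ i) (γ j) f
  have h3 := wedgeE_contrV (γ i) (ψ j) f
  have h4 := wedgeE_contrV (γ j) (ψ i) f
  have h5 : ψ i (γ j) • f + ψ j (γ i) • f = 0 := by rw [← add_smul, hψ, zero_smul]
  rw [← h3, ← h4] at h5
  linear_combination (exp := 1) h1 + h2 + h5

lemma twistOp_self (hψ : ∀ i, ψ i (γ i) = 0) (i : Fin n) (f : Ext A N) :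
    twistOp ψ γ i (twistOp ψ γ i f) = 0 := by
  simp only [twistOp_apply, map_add, contrV_contrV_self, wedgeE_wedgeE_self]
  have h3 := wedgeE_contrV (γ i) (ψ i) f
  rw [hψ, zero_smul] at h3
  linear_combination (exp := 1) h3

lemma contrE_twistOp (hγ : Function.Injective γ) (i j : Fin n) (f : Ext A N) :
    twistOp ψ γ j (contrE A (γ i) f) + contrE A (γ i) (twistOp ψ γ j f) =
      if i = j then (1 : A) • f else 0 := by
  simp only [twistOp_apply, map_add]
  have h1 := contrV_anticomm (Pi.single (γ i) 1) (ψ j) f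
  have h2 := wedgeE_contrE (γ j) (γ i) f
  rw [contrV_single, contrV_single] at h1
  simp only [hγ.eq_iff, eq_comm (a := j)] at h2
  rw [one_smul]
  linear_combination (exp := 1) h1 + h2

lemma twistOp_mem_extFil {b : ℕ} (i : Fin n) {f : Ext A N} (hf : f ∈ extFil A N (b + 1)) :
    twistOp ψ γ i f ∈ extFil A N b :=
  add_mem (contrV_mem_extFil _ hf) (extFil_anti (by omega) (wedgeE_mem_extFil _ hf))

lemma degE_twistOp {b : ℕ} (i : Fin n) {f : Ext A N} (hf : f ∈ extFil A N (b + 1)) :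
    degE A b (twistOp ψ γ i f) = contrV (ψ i) (degE A (b + 1) f) := by
  rw [twistOp_apply, map_add, ← contrV_degE, add_eq_left]
  ext S
  rw [degE_apply]
  split_ifs with h
  · exact wedgeE_mem_extFil _ hf _ (by omega)
  · rfl

/-- Exactness of the undeformed quadratic strands lifts to the deformed operators. -/
theorem exists_dSym_twistOp_eq (hψ0 : ∀ i, ψ i (γ i) = 0)
    (hψ : ∀ i j, ψ i (γ j) + ψ j (γ i) = 0) {b₀ : ℕ} (hb₀ : 1 ≤ b₀)
    (hex : ∀ b, b₀ ≤ b → ∀ z : (Fin n → ℕ) → Ext A N, biE A (Fin n) 2 b z = z →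
      dSym (fun i => contrV (ψ i)) z = 0 →
      ∃ w, biE A (Fin n) 1 (b + 1) w = w ∧ dSym (fun i => contrV (ψ i)) w = z)
    (m b : ℕ) (hb : b₀ ≤ b) (hm : N < b + m) (r : (Fin n → ℕ) → Ext A N)
    (hr2 : ∀ μ, ∑ i, μ i ≠ 2 → r μ = 0) (hrb : ∀ μ, r μ ∈ extFil A N b)
    (hr : dSym (twistOp ψ γ) r = 0) :
    ∃ w : (Fin n → ℕ) → Ext A N, (∀ μ, ∑ i, μ i ≠ 1 → w μ = 0) ∧
      (∀ μ, w μ ∈ extFil A N (b + 1)) ∧ dSym (twistOp ψ γ) w = r := by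
  induction m generalizing b r with
  | zero =>
    have : r = 0 := by
      ext μ S
      exact hrb μ S (lt_of_le_of_lt (card_finset_fin_le S) hm)
    exact ⟨0, fun _ _ => rfl, fun _ => zero_mem _, by rw [map_zero, this]⟩
  | succ m ih =>
    obtain ⟨a, rfl⟩ : ∃ a, b = a + 1 := ⟨b - 1, by omega⟩
    obtain ⟨w, hw, hwr⟩ := hex _ hb (biE A (Fin n) 2 (a + 1) r) (biE_biE _ _ _) (by
      ext1 μ
      have h1 := congrArg (degE A a) (congrFun hr μ)
      rw [Pi.zero_apply, map_zero, dSym_apply, map_sum] at h1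
      rw [dSym_apply]
      refine (Finset.sum_congr rfl fun i _ => ?_).trans h1
      split_ifs with hi
      · rw [map_zero]
      · rw [degE_twistOp i (hrb _), biE_apply]
        split_ifs with h2
        · rfl
        · rw [hr2 _ h2, map_zero, map_zero, map_zero])
    have hw1 : ∀ μ, ∑ i, μ i ≠ 1 → w μ = 0 := fun μ hμ => by rw [← hw, biE_apply, if_neg hμ]
    have hwfil : ∀ μ, w μ ∈ extFil A N (a + 1 + 1) := by
      intro μ S hS
      rw [← hw, biE_apply]
      split_ifs
      · rw [degE_apply, if_neg (by omega)]
      · rfl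
    obtain ⟨w', h1, h2, h3⟩ := ih (a + 1 + 1) (by omega) (by omega) (r - dSym (twistOp ψ γ) w)
      (by
        intro μ hμ
        rw [Pi.sub_apply, hr2 μ hμ, zero_sub, neg_eq_zero, dSym_apply]
        refine Finset.sum_eq_zero fun i _ => ?_
        split_ifs with hi
        · rfl
        · have := sum_sub_single hi
          rw [hw1 _ (by omega), map_zero])
      (by
        intro μ S hS
        have hmem : (r - dSym (twistOp ψ γ) w) μ ∈ extFil A N (a + 1) := by
          refine sub_mem (hrb μ) ?_
          rw [dSym_apply]
          refine sum_mem fun i _ => ?_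
          split_ifs
          · exact zero_mem _
          · exact twistOp_mem_extFil _ (hwfil _)
        rcases Nat.lt_succ_iff_lt_or_eq.mp hS with hS | hS
        · exact hmem S hS
        have h1 := congrArg (fun t => t S) (congrFun hwr μ)
        have h2 : degE A (a + 1) (dSym (twistOp ψ γ) w μ) = dSym (fun i => contrV (ψ i)) w μ := by
          rw [dSym_apply, dSym_apply, map_sum]
          refine Finset.sum_congr rfl fun i _ => ?_
          split_ifs
          · rw [map_zero]
          · rw [degE_twistOp _ (hwfil _)]
            congr 1
            conv_rhs => rw [← hw]
            rw [biE_apply]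
            split_ifs with h3
            · conv_rhs => rw [← hw]
              rw [biE_apply, if_pos h3, degE_degE]
            · rw [hw1 _ h3, map_zero]
        rw [← h2, degE_apply, if_pos hS, biE_apply] at h1
        rw [Pi.sub_apply, Pi.sub_apply, h1]
        split_ifs with h3
        · rw [degE_apply, if_pos hS, sub_self]
        · rw [hr2 _ h3, sub_self])
      (by rw [map_sub, hr, dSym_dSym (twistOp_self hψ0) (twistOp_anticomm hψ), sub_zero])
    refine ⟨w + w', ?_, ?_, ?_⟩
    · intro μ hμ
      rw [Pi.add_apply, hw1 μ hμ, h1 μ hμ, add_zero]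
    · exact fun μ => add_mem (hwfil μ) (extFil_anti (by omega) (h2 μ))
    · rw [map_add, h3, add_sub_cancel]

lemma eq_single_of_sum_eq_one {ι : Type} [Fintype ι] [DecidableEq ι] {μ : ι → ℕ} {i : ι}
    (h : ∑ j, μ j = 1) (hi : μ i ≠ 0) : μ = Pi.single i 1 := by
  have h1 := sum_sub_single hi
  have h2 : μ - Pi.single i 1 = 0 := by rw [← sum_eq_zero_iff_eq_zero]; omega
  ext j
  have := congrFun h2 j
  simp only [Pi.sub_apply, Pi.zero_apply] at this
  by_cases hj : j = i
  · subst hj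
    simp only [Pi.single_eq_same] at this ⊢
    omega
  · simpa [hj] using this

/-- Compatible families lift through the deformed operators. -/
theorem exists_twistOp_sub_mem (hγ : Function.Injective γ) (hψ0 : ∀ i, ψ i (γ i) = 0)
    (hψ : ∀ i j, ψ i (γ j) + ψ j (γ i) = 0) {b₀ : ℕ} (hb₀ : 1 ≤ b₀)
    (hex : ∀ b, b₀ ≤ b → ∀ z : (Fin n → ℕ) → Ext A N, biE A (Fin n) 2 b z = z →
      dSym (fun i => contrV (ψ i)) z = 0 →
      ∃ w, biE A (Fin n) 1 (b + 1) w = w ∧ dSym (fun i => contrV (ψ i)) w = z)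
    {b : ℕ} (hb : b₀ ≤ b) (z : Fin n → Ext A N)
    (hz0 : ∀ i, twistOp ψ γ i (z i) ∈ extFil A N b)
    (hz : ∀ i j, twistOp ψ γ i (z j) + twistOp ψ γ j (z i) ∈ extFil A N b) :
    ∃ v, ∀ i, twistOp ψ γ i v - z i ∈ extFil A N (b + 1) := by
  set y : (Fin n → ℕ) → Ext A N := fun μ => if ∑ i, μ i = 1 then ∑ i, μ i • z i else 0 with hy
  have hy1 : ∀ i, y (Pi.single i 1) = z i := by
    intro i
    simp only [hy]
    rw [if_pos (by simp), Finset.sum_eq_single i]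
    · simp
    · intro j _ hj; simp [hj]
    · simp
  have hyn : ∀ μ, ∑ i, μ i ≠ 1 → y μ = 0 := fun μ hμ => by simp only [hy, if_neg hμ]
  obtain ⟨w, hw1, hw2, hw3⟩ := exists_dSym_twistOp_eq hψ0 hψ hb₀ hex (N + 1) b hb (by omega)
    (dSym (twistOp ψ γ) y)
    (by
      intro μ hμ
      rw [dSym_apply]
      refine Finset.sum_eq_zero fun i _ => ?_
      split_ifs with hi
      · rfl
      · have := sum_sub_single hi
        rw [hyn _ (by omega), map_zero])
    (by
      intro μ
      rw [dSym_apply]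
      by_cases h2 : ∑ i, μ i = 2
      · obtain ⟨i, hi⟩ : ∃ i, μ i ≠ 0 := by
          by_contra! h
          simp [h] at h2
        have h1 := sum_sub_single hi
        obtain ⟨j, hj⟩ : ∃ j, (μ - Pi.single i 1 : Fin n → ℕ) j ≠ 0 := by
          by_contra! h
          simp only [h, Finset.sum_const_zero] at h1
          omega
        have h3 := eq_single_of_sum_eq_one (by omega) hj
        have hμ : μ = Pi.single i 1 + Pi.single j 1 := by
          rw [← h3]
          ext k
          by_cases hk : k = i
          · subst hk
            simp only [Pi.add_apply, Pi.sub_apply, Pi.single_eq_same]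
            omega
          · simp [hk]
        by_cases hij : i = j
        · subst hij
          rw [Finset.sum_eq_single i, if_neg hi, h3, hy1]
          · exact hz0 i
          · intro k _ hk
            rw [if_pos (by simp [hμ, hk])]
          · simp
        · rw [← Finset.add_sum_erase _ _ (Finset.mem_univ i),
            ← Finset.add_sum_erase _ _ (Finset.mem_erase.mpr ⟨Ne.symm hij, Finset.mem_univ j⟩),
            Finset.sum_eq_zero (s := (Finset.univ.erase i).erase j), add_zero, if_neg hi,
            if_neg (by simp [hμ]), h3, hy1,
            show μ - Pi.single j 1 = Pi.single i 1 by rw [hμ, add_tsub_cancel_right], hy1]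
          · exact hz i j
          · intro k hk
            simp only [Finset.mem_erase] at hk
            rw [if_pos (by simp [hμ, hk.1, hk.2.1])]
      · refine sum_mem fun i _ => ?_
        split_ifs with hi
        · exact zero_mem _
        · have := sum_sub_single hi
          rw [hyn _ (by omega), map_zero]
          exact zero_mem _)
    (dSym_dSym (twistOp_self hψ0) (twistOp_anticomm hψ) _)
  obtain ⟨v, hv⟩ := dSym_exact (δ := 1) (twistOp_self hψ0) (twistOp_anticomm hψ)
    (contrE_twistOp hγ) (y - w) (by rw [map_sub, hw3, sub_self])
    (by rw [Pi.sub_apply, hyn 0 (by simp), hw1 0 (by simp), sub_zero])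
  rw [one_pow, one_smul] at hv
  refine ⟨v 0, fun i => ?_⟩
  have h1 := congrFun hv (Pi.single i 1)
  rw [dSym_apply, Finset.sum_eq_single i, Pi.sub_apply, hy1] at h1
  · simp only [Pi.single_eq_same, one_ne_zero, if_false, tsub_self] at h1
    rw [h1, sub_sub_cancel_left]
    exact neg_mem (hw2 _)
  · intro j _ hj
    simp [hj]
  · simp

end Lifting

section Counting

variable {A : Type} [CommRing A] {N n : ℕ} {ψ : Fin n → Fin N → A} {γ : Fin n → Fin N}

lemma wsign_mul_wsign_erase {i j : Fin n} {I : Finset (Fin n)} (hi : i ∈ I) (hj : j ∈ I)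
    (hij : i ≠ j) :
    wsign A j I * wsign A i (I.erase j) + wsign A i I * wsign A j (I.erase i) = 0 := by
  rcases lt_or_gt_of_ne hij with h | h
  · rw [wsign_erase_of_le h.le, wsign_erase_of_lt hi h]
    ring
  · rw [wsign_erase_of_lt hj h, wsign_erase_of_le h.le]
    ring

/-- The deformed operators act on `κ` as contractions, up to higher exterior degree. -/
def ContractsUpTo (ψ : Fin n → Fin N → A) (γ : Fin n → Fin N) (κ : Finset (Fin n) → Ext A N)
    (p : ℕ) : Prop :=
  ∀ I : Finset (Fin n), I.card ≤ p → ∀ i,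
    twistOp ψ γ i (κ I) - (if i ∈ I then wsign A i I • κ (I.erase i) else 0) ∈
      extFil A N (I.card + 1)

lemma contractsUpTo_one (f : A) (a : Fin n → Fin N → A)
    (ha : ∀ i j, ψ i ⬝ᵥ a j = if i = j then f else 0) :
    ∃ κ, ContractsUpTo ψ γ κ 1 ∧ κ ∅ ∅ = f := by
  set u : Ext A N := Pi.single ∅ 1 with hu
  have hu0 : ∀ v, contrV v u = 0 := by
    intro v
    rw [contrV_apply]
    refine Finset.sum_eq_zero fun i _ => ?_
    ext S
    rw [Pi.smul_apply, contrE_apply, hu]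
    simp
  refine ⟨fun I => if I = ∅ then f • u else ∑ i ∈ I, wedgeV (a i) u, ?_, by simp [hu]⟩
  intro I hI i
  rcases Nat.le_one_iff_eq_zero_or_eq_one.mp hI with h | h
  · rw [Finset.card_eq_zero] at h
    subst h
    simp only [Finset.notMem_empty, if_false, if_true, sub_zero]
    rw [twistOp_apply, map_smul, hu0, smul_zero, zero_add]
    refine wedgeE_mem_extFil _ fun S hS => by simp at hS
  · obtain ⟨j, rfl⟩ := Finset.card_eq_one.mp h
    have h1 := wedgeV_contrV (a j) (ψ i) u
    rw [hu0, map_zero, zero_add, dotProduct_comm, ha] at h1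
    simp only [Finset.singleton_ne_empty, if_false, Finset.sum_singleton, Finset.card_singleton,
      Finset.mem_singleton]
    rw [twistOp_apply, h1]
    have h2 : wedgeE A (γ i) (wedgeV (a j) u) ∈ extFil A N (1 + 1) := by
      refine wedgeE_mem_extFil _ ?_
      rw [wedgeV_apply]
      exact sum_mem fun k _ => Submodule.smul_mem _ _
        (wedgeE_mem_extFil _ fun S hS => by simp at hS)
    by_cases hij : i = j
    · subst hij
      simp only [if_true, Finset.erase_singleton]
      rw [show wsign A i {i} = 1 by simp [wsign, Finset.filter_singleton], one_smul,
        add_sub_cancel_left]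
      exact h2
    · simp only [hij, if_false, zero_smul, zero_add, sub_zero]
      exact h2

theorem ContractsUpTo.succ (hγ : Function.Injective γ) (hψ0 : ∀ i, ψ i (γ i) = 0)
    (hψ : ∀ i j, ψ i (γ j) + ψ j (γ i) = 0)
    (hex : ∀ b, 2 ≤ b → ∀ z : (Fin n → ℕ) → Ext A N, biE A (Fin n) 2 b z = z →
      dSym (fun i => contrV (ψ i)) z = 0 →
      ∃ w, biE A (Fin n) 1 (b + 1) w = w ∧ dSym (fun i => contrV (ψ i)) w = z)
    {κ : Finset (Fin n) → Ext A N} {p : ℕ} (hp : 1 ≤ p) (hκ : ContractsUpTo ψ γ κ p) :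
    ∃ κ', ContractsUpTo ψ γ κ' (p + 1) ∧ κ' ∅ = κ ∅ := by
  have hstep : ∀ I : Finset (Fin n), I.card = p + 1 → ∃ v, ∀ i, twistOp ψ γ i v -
      (if i ∈ I then wsign A i I • κ (I.erase i) else 0) ∈ extFil A N (I.card + 1) := by
    intro I hI
    rw [hI]
    have hz : ∀ i j, twistOp ψ γ i (if j ∈ I then wsign A j I • κ (I.erase j) else 0) -
        (if j ∈ I ∧ i ∈ I ∧ i ≠ j then
          (wsign A j I * wsign A i (I.erase j)) • κ ((I.erase j).erase i) else 0) ∈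
        extFil A N (p + 1) := by
      intro i j
      by_cases hj : j ∈ I
      · have hc : (I.erase j).card = p := by rw [Finset.card_erase_of_mem hj, hI]; rfl
        have h1 := hκ (I.erase j) hc.le i
        rw [hc] at h1
        have h2 := Submodule.smul_mem _ (wsign A j I) h1
        rw [smul_sub, smul_ite, smul_zero, smul_smul, ← map_smul] at h2
        simpa [hj, and_comm] using h2
      · simp [hj]
    refine exists_twistOp_sub_mem hγ hψ0 hψ one_le_two hex (by omega) _ (fun i => ?_)
      fun i j => ?_
    · simpa using hz i i
    · have h1 := add_mem (hz i j) (hz j i)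
      rw [← add_sub_add_comm] at h1
      convert h1 using 1
      symm
      rw [sub_eq_self]
      by_cases hc : i ∈ I ∧ j ∈ I ∧ i ≠ j
      · obtain ⟨hi, hj, hij⟩ := hc
        rw [if_pos ⟨hj, hi, hij⟩, if_pos ⟨hi, hj, hij.symm⟩, Finset.erase_right_comm, ← add_smul,
          wsign_mul_wsign_erase hi hj hij, zero_smul]
      · rw [if_neg (by tauto), if_neg (by tauto), add_zero]
  choose v hv using hstep
  refine ⟨fun I => if h : I.card = p + 1 then v I h else κ I, fun I hI i => ?_, by simp⟩
  by_cases h : I.card = p + 1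
  · simp only [h, dite_true]
    have h1 := hv I h i
    rw [h] at h1
    convert h1 using 2
    split_ifs with hi h2
    · rw [Finset.card_erase_of_mem hi] at h2
      omega
    · rfl
    · rfl
  · simp only [h, dite_false]
    convert hκ I (by omega) i using 2
    split_ifs with hi h2
    · rw [Finset.card_erase_of_mem hi] at h2
      omega
    · rfl
    · rfl

lemma opList_append {ι : Type} (o : ι → Ext A N →ₗ[A] Ext A N) (l l' : List ι) (f : Ext A N) :
    opList o (l ++ l') f = opList o l (opList o l' f) := by
  induction l with
  | nil => rfl
  | cons i l ih => simp only [List.cons_append, opList, LinearMap.comp_apply, ih]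

lemma opList_twistOp_mem_extFil (l : List (Fin n)) (b : ℕ) {f : Ext A N}
    (hf : f ∈ extFil A N (l.length + b)) : opList (twistOp ψ γ) l f ∈ extFil A N b := by
  induction l generalizing b with
  | nil => simpa [opList] using hf
  | cons i l ih =>
    refine twistOp_mem_extFil i (ih (b + 1) ?_)
    rwa [List.length_cons, add_assoc, add_comm 1 b] at hf

lemma ContractsUpTo.exists_mul_opList {κ : Finset (Fin n) → Ext A N} {p : ℕ}
    (hκ : ContractsUpTo ψ γ κ p) (l : List (Fin n)) (hl : l.Nodup) (hlp : l.length ≤ p) :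
    ∃ ε : A, ε * opList (twistOp ψ γ) l (κ l.toFinset) ∅ = κ ∅ ∅ := by
  induction l using List.reverseRecOn with
  | nil => exact ⟨1, by simp [opList]⟩
  | append_singleton l a ih =>
    have hl' : l.Nodup ∧ a ∉ l := by
      rw [List.nodup_append] at hl
      exact ⟨hl.1, fun h => hl.2.2 a h a (by simp) rfl⟩
    rw [List.length_append, List.length_singleton] at hlp
    obtain ⟨ε, hε⟩ := ih hl'.1 (by omega)
    set I := (l ++ [a]).toFinset with hI
    have hIe : I.erase a = l.toFinset := by
      ext j
      simp only [hI, Finset.mem_erase, List.mem_toFinset, List.mem_append, List.mem_singleton]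
      constructor
      · tauto
      · exact fun hj => ⟨fun h => hl'.2 (h ▸ hj), Or.inl hj⟩
    have hIc : I.card = l.length + 1 := by
      rw [hI, List.toFinset_card_of_nodup hl, List.length_append, List.length_singleton]
    have h1 := hκ I (by omega) a
    rw [if_pos (by simp [hI]), hIe, hIc, add_assoc] at h1
    have h2 := opList_twistOp_mem_extFil (ψ := ψ) (γ := γ) l (1 + 1) h1 ∅ (by simp)
    rw [map_sub, map_smul, Pi.sub_apply, Pi.smul_apply, sub_eq_zero] at h2
    refine ⟨ε * wsign A a I, ?_⟩
    rw [opList_append, show opList (twistOp ψ γ) [a] (κ I) = twistOp ψ γ a (κ I) from rfl, h2,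
      smul_eq_mul, mul_assoc, ← mul_assoc (wsign A a I), wsign_mul_self, one_mul, hε]

/-- Coefficients of iterated deformed operators lie in powers of an ideal. -/
theorem opList_twistOp_apply_mem {𝔪 : Ideal A} {Γ : Finset (Fin N)} {d : ℕ} (hΓ : ∀ i, γ i ∈ Γ)
    (hψ : ∀ i, ∀ j ∈ Γ, ψ i j ∈ 𝔪) (hd : Γᶜ.card ≤ d) (l : List (Fin n)) (v : Ext A N) :
    ∀ (S : Finset (Fin N)) (k : ℕ),
      2 * k + d + (S ∩ Γ).card ≤ l.length + (S \ Γ).card + 1 →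
        opList (twistOp ψ γ) l v S ∈ 𝔪 ^ k := by
  induction l with
  | nil =>
    intro S k hk
    have : (S \ Γ).card ≤ d := by
      refine (Finset.card_le_card fun j hj => ?_).trans hd
      simp only [Finset.mem_sdiff] at hj
      simpa using hj.2
    simp only [List.length_nil] at hk
    obtain rfl : k = 0 := by omega
    simp
  | cons i l ih =>
    intro S k hk
    simp only [opList, LinearMap.comp_apply]
    set g := opList (twistOp ψ γ) l v with hg
    rw [List.length_cons] at hk
    rw [twistOp_apply, Pi.add_apply, contrV_apply, Finset.sum_apply]
    refine add_mem (sum_mem fun j _ => ?_) ?_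
    · rw [Pi.smul_apply, contrE_apply, smul_eq_mul]
      split_ifs with hj
      · rw [mul_zero]; exact zero_mem _
      by_cases hjΓ : j ∈ Γ
      · rcases Nat.eq_zero_or_pos k with rfl | hk0
        · simp
        obtain ⟨k, rfl⟩ : ∃ k', k = k' + 1 := ⟨k - 1, by omega⟩
        rw [pow_succ']
        refine Ideal.mul_mem_mul (hψ i j hjΓ) (Ideal.mul_mem_left _ _ (ih _ _ ?_))
        rw [Finset.insert_inter_of_mem hjΓ, Finset.insert_sdiff_of_mem _ hjΓ,
          Finset.card_insert_of_notMem (by simp [hj])]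
        omega
      · refine Ideal.mul_mem_left _ _ (Ideal.mul_mem_left _ _ (ih _ _ ?_))
        rw [Finset.insert_inter_of_notMem hjΓ, Finset.insert_sdiff_of_notMem _ hjΓ,
          Finset.card_insert_of_notMem (by simp [hj])]
        omega
    · rw [wedgeE_apply]
      split_ifs with hj
      · refine Ideal.mul_mem_left _ _ (ih _ _ ?_)
        have he : S.erase (γ i) \ Γ = S \ Γ := by
          ext j
          simp only [Finset.mem_sdiff, Finset.mem_erase]
          exact ⟨fun h => ⟨h.1.2, h.2⟩, fun h => ⟨⟨fun e => h.2 (e ▸ hΓ i), h.1⟩, h.2⟩⟩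
        have hpos : 0 < (S ∩ Γ).card :=
          Finset.card_pos.mpr ⟨γ i, Finset.mem_inter.mpr ⟨hj, hΓ i⟩⟩
        rw [Finset.erase_inter, Finset.card_erase_of_mem (by simp [hj, hΓ]), he]
        omega
      · exact zero_mem _

/-- Elements annihilating the cokernel of `ψ` lie in a power of the ideal containing the entries
of its alternating block. -/
theorem mem_pow_of_dotProduct_eq (hγ : Function.Injective γ) (hψ0 : ∀ i, ψ i (γ i) = 0)
    (hψ : ∀ i j, ψ i (γ j) + ψ j (γ i) = 0)
    (hex : ∀ b, 2 ≤ b → ∀ z : (Fin n → ℕ) → Ext A N, biE A (Fin n) 2 b z = z →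
      dSym (fun i => contrV (ψ i)) z = 0 →
      ∃ w, biE A (Fin n) 1 (b + 1) w = w ∧ dSym (fun i => contrV (ψ i)) w = z)
    {𝔪 : Ideal A} (hm : ∀ i j, ψ i (γ j) ∈ 𝔪) {d k : ℕ} (hN : N = n + d) (hk : 2 * k + d ≤ n + 1)
    (f : A) (a : Fin n → Fin N → A) (ha : ∀ i j, ψ i ⬝ᵥ a j = if i = j then f else 0) :
    f ∈ 𝔪 ^ k := by
  have hκ : ∀ p, 1 ≤ p → ∃ κ, ContractsUpTo ψ γ κ p ∧ κ ∅ ∅ = f := by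
    intro p hp
    induction p, hp using Nat.le_induction with
    | base => exact contractsUpTo_one f a ha
    | succ p hp ih =>
      obtain ⟨κ, h1, h2⟩ := ih
      obtain ⟨κ', h3, h4⟩ := h1.succ hγ hψ0 hψ hex hp
      exact ⟨κ', h3, by rw [h4, h2]⟩
  obtain ⟨κ, h1, h2⟩ := hκ (n + 1) (by omega)
  obtain ⟨ε, hε⟩ := h1.exists_mul_opList (List.finRange n) (List.nodup_finRange n) (by simp)
  rw [← h2, ← hε]
  refine Ideal.mul_mem_left _ _ (opList_twistOp_apply_mem (Γ := Finset.univ.image γ) (d := d)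
    (fun i => Finset.mem_image_of_mem _ (Finset.mem_univ i)) (fun i j hj => ?_) ?_ _ _ _ _ ?_)
  · obtain ⟨j, -, rfl⟩ := Finset.mem_image.mp hj
    exact hm i j
  · rw [Finset.card_compl, Finset.card_image_of_injective _ hγ]
    simp [hN]
  · simpa using hk

end Counting

section UpperBound

variable {k R : Type} [Field k] [CommRing R] [Algebra k R] {𝒜 : ℤ → AddSubgroup R}
  [GradedRing 𝒜] {d n : ℕ} {x : Fin d → R}

theorem StdGraded.isHomogResidualIntersection_le (h : StdGraded k 𝒜 x) [Infinite k]
    {φ : Matrix (Fin n) (Fin n) R} (halt : IsAlternating φ) (hlin : ∀ i j, φ i j ∈ 𝒜 1)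
    (hn : Odd n) (hd : 3 ≤ d) (hdn : d ≤ n)
    (hht : 3 ≤ idealHeight (pfaffianIdeal n (n - 1) φ)) {K : Ideal R}
    (hK : IsHomogResidualIntersection 𝒜 (pfaffianIdeal n (n - 1) φ) K d) :
    K ≤ Ideal.span (Set.range x) ^ ((n - d + 1) / 2) := by
  obtain ⟨a, -, ha, rfl, hhom, hdK⟩ := hK
  have hI := pfaffianIdeal_eq_span_pfVec hn.pos φ
  have hc : ∀ j, ∃ c : Fin n → R, ∑ i, c i * pfVec φ i = a j := fun j => by
    have h1 := ha (Ideal.subset_span ⟨j, rfl⟩)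
    rwa [hI, Ideal.mem_span_range_iff_exists_fun] at h1
  choose c hc using hc
  set ψ : Fin n → Fin (n + d) → R := fun i => Fin.append (φ i) (fun j => c j i) with hψ
  have hψγ : ∀ i j, ψ i (Fin.castAdd d j) = φ i j := fun i j => by simp only [hψ, Fin.append_left]
  have hψF : ∀ i j, ψ i (Fin.natAdd n j) = c j i := fun i j => by simp only [hψ, Fin.append_right]
  have hann : ∀ g ∈ Submodule.colon (Ideal.span (Set.range a)) (pfaffianIdeal n (n - 1) φ),
      ∃ u : Fin n → Fin (n + d) → R, ∀ i l, ψ i ⬝ᵥ u l = if i = l then g else 0 := by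
    intro g hg
    rw [hI, mem_colon_span_iff] at hg
    suffices ∀ l, ∃ u : Fin (n + d) → R, ∀ i, ψ i ⬝ᵥ u = if i = l then g else 0 by
      choose u hu using this
      exact ⟨u, fun i l => hu l i⟩
    intro l
    obtain ⟨b, hb⟩ := Ideal.mem_span_range_iff_exists_fun.mp (hg l)
    obtain ⟨v, hv⟩ := h.exists_mulVec_eq halt hlin hn hd hht
      (c := fun i => (if i = l then g else 0) - ∑ j, b j * c j i) (by
        simp only [dotProduct, mul_sub, Finset.sum_sub_distrib, mul_ite, mul_zero,
          Finset.sum_ite_eq', Finset.mem_univ, if_true, Finset.mul_sum]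
        rw [Finset.sum_comm, mul_comm, ← hb, sub_eq_zero]
        refine Finset.sum_congr rfl fun j _ => ?_
        rw [← hc, Finset.mul_sum]
        exact Finset.sum_congr rfl fun i _ => by ring)
    refine ⟨Fin.append v b, fun i => ?_⟩
    have h1 := congrFun hv i
    simp only [Matrix.mulVec, dotProduct] at h1
    rw [dotProduct, Fin.sum_univ_add]
    simp only [hψγ, hψF, Fin.append_left, Fin.append_right]
    rw [h1, sub_add_eq_add_sub, sub_eq_iff_eq_add]
    congr 1
    exact Finset.sum_congr rfl fun j _ => mul_comm _ _
  intro f hf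
  obtain ⟨u, hu⟩ := hann f hf
  refine mem_pow_of_dotProduct_eq (γ := Fin.castAdd d) (ψ := ψ) (Fin.castAdd_injective n d)
    (fun i => by rw [hψγ, halt.1]) (fun i j => by rw [hψγ, hψγ, halt.2 i j, add_neg_cancel])
    (fun b hb z hz hdz => ?_) (fun i j => ?_) (d := d) rfl (by omega) f u hu
  · refine dSym_strand_exact (fun i f => contrV_contrV_self _ _)
      (fun i j f => contrV_anticomm _ _ _) (fun i b f => contrV_degE _ _ _) (List.ofFn x)
      h.isWeaklyRegular (fun r hr => ?_) (q := d - 3) (by rw [List.length_ofFn]; omega)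
      (by omega) (by rw [Fintype.card_fin]; omega) z hz hdz
    obtain ⟨i, rfl⟩ := (List.mem_ofFn' _ _).mp hr
    obtain ⟨M, hM⟩ := h.exists_pow_mem hhom (fun P _ hP => hdK.trans (idealHeight_le hP))
      (Ideal.subset_span ⟨i, rfl⟩)
    obtain ⟨e, he⟩ := hann _ hM
    refine ⟨M, fun i => wedgeV (e i), fun i j f => ?_⟩
    refine (add_comm _ _).trans ((wedgeV_contrV _ _ _).trans ?_)
    rw [dotProduct_comm, he]
    simp only [eq_comm (a := j)]
    split_ifs <;> simp
  · rw [hψγ, ← h.maxHomIdeal_eq]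
    exact Ideal.subset_span (Or.inr (Set.mem_iUnion₂.mpr ⟨1, one_ne_zero, hlin i j⟩))

end UpperBound

end

theorem statement17
    (𝒜 : ℤ → AddSubgroup R) [GradedRing 𝒜]
    -- `R = k[x₁,…,x_d]` standard graded over an infinite field `k = 𝒜 0`
    (hfield : IsField ↥(𝒜 0)) (hinf : Infinite ↥(𝒜 0))
    (d : ℕ) (x : Fin d → R) (hx1 : ∀ i, x i ∈ 𝒜 1)
    (hpoly : Function.Bijective
      (MvPolynomial.eval₂Hom (SetLike.GradeZero.subring 𝒜).subtype x))
    -- `3 ≤ d ≤ n`, `n` odd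
    (n : ℕ) (hd3 : 3 ≤ d) (hdn : d ≤ n) (hnodd : Odd n)
    -- `φ` an `n × n` alternating matrix of homogeneous linear entries
    (φ : Matrix (Fin n) (Fin n) R) (halt : IsAlternating φ)
    (hlin : ∀ i j, φ i j ∈ 𝒜 1)
    -- `I = Pf_{n-1}(φ)` has height three
    (hht : idealHeight (pfaffianIdeal n (n - 1) φ) = 3)
    -- `𝓕₀` on the punctured spectrum: `n − i ≤ ht I_i(φ)` for `n − d ≤ i ≤ n − 1`
    (hF : ∀ i : ℕ, (n : ℤ) - d ≤ i → (i : ℤ) ≤ (n : ℤ) - 1 →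
      ((n - i : ℕ) : ℕ∞) ≤ idealHeight (minorsIdeal n i φ)) :
    -- (a) `Pf_t(φ) = 𝔪^{t/2}` for all even `t` with `2 ≤ t ≤ n − d + 1`
    (∀ t : ℕ, Even t → 2 ≤ t → t ≤ n - d + 1 →
      pfaffianIdeal n t φ = (maxHomIdeal 𝒜) ^ (t / 2))
    -- (b) the sum of all homogeneous `d`-residual intersections of `I`
    --     is `𝔪^{⌈(n-d)/2⌉}`
    ∧ sSup {K : Ideal R |
        IsHomogResidualIntersection 𝒜 (pfaffianIdeal n (n - 1) φ) K d} =
      (maxHomIdeal 𝒜) ^ ((n - d + 1) / 2) := by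
  let : Field (SetLike.GradeZero.subring 𝒜) :=
    IsField.toField (R := SetLike.GradeZero.subring 𝒜) hfield
  have : Infinite (SetLike.GradeZero.subring 𝒜) := hinf
  have h : StdGraded (SetLike.GradeZero.subring 𝒜) 𝒜 x :=
    { mem_zero_iff := fun r => ⟨fun hr => ⟨⟨r, hr⟩, rfl⟩, by rintro ⟨c, rfl⟩; exact c.2⟩
      mem_one := hx1
      bijective := hpoly }
  obtain ⟨h1, h2⟩ := h.pfaffianIdeal_eq_and_le_sSup halt hlin hdn hnodd hF
  rw [h.maxHomIdeal_eq]
  refine ⟨fun t ht _ htn => ?_, le_antisymm (sSup_le fun K hK => ?_) h2⟩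
  · obtain ⟨s, rfl⟩ := ht.exists_two_nsmul
    rw [smul_eq_mul] at htn ⊢
    rw [h1 s htn, Nat.mul_div_cancel_left s two_pos]
  · exact h.isHomogResidualIntersection_le halt hlin hnodd hd3 hdn hht.ge hK

end Paper
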